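/- arXiv:0911.5589 — 3 statements merged into one kernel-verified Lean document; each statement's English description precedes it below -/
import Mathlib

section
/- Let q be a prime power, G = PSL(2,q), k = gcd(q−1,2). Then the number of elements of order (q+1)/k in G equals φ((q+1)/k)·q(q−1)/2, where φ is Euler's totient function. -/
open Matrix

namespace SpecialLinearTwo

open SpecialLinearGroup FiniteField

theorem eq_of_entries {F : Type*} [CommRing F] {A B : SpecialLinearGroup (Fin 2) F}
    (h00 : A 0 0 = B 0 0) (h01 : A 0 1 = B 0 1) (h10 : A 1 0 = B 1 0) (h11 : A 1 1 = B 1 1) :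
    A = B := by
  ext i j
  fin_cases i <;> fin_cases j <;> assumption

theorem mk_eq_one_iff {F : Type*} [Field F] (A : SpecialLinearGroup (Fin 2) F) :
    (A : ProjectiveSpecialLinearGroup (Fin 2) F) = 1 ↔ A = 1 ∨ A = -1 := by
  rw [QuotientGroup.eq_one_iff, Matrix.SpecialLinearGroup.mem_center_iff]
  constructor
  · rintro ⟨r, hr, hA⟩
    rw [Fintype.card_fin, sq_eq_one_iff] at hr
    rcases hr with rfl | rfl
    · left
      ext i j
      simp [← hA]
    · right
      apply Subtype.ext
      rw [← hA, map_neg, map_one, coe_neg, Matrix.SpecialLinearGroup.coe_one]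
  · rintro (rfl | rfl)
    · exact ⟨1, by simp, by simp⟩
    · exact ⟨-1, by simp, by rw [map_neg, map_one, coe_neg, Matrix.SpecialLinearGroup.coe_one]⟩

theorem mk_eq_mk_iff {F : Type*} [Field F] (A B : SpecialLinearGroup (Fin 2) F) :
    (A : ProjectiveSpecialLinearGroup (Fin 2) F) = B ↔ A = B ∨ A = -B := by
  rw [← inv_mul_eq_one, ← QuotientGroup.mk_inv, ← QuotientGroup.mk_mul, mk_eq_one_iff,
    inv_mul_eq_one, inv_mul_eq_iff_eq_mul, mul_neg, mul_one]
  constructor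
  · rintro (rfl | rfl) <;> simp
  · rintro (rfl | rfl) <;> simp

theorem out_eq_or_eq_neg {F : Type*} [Field F] (A : SpecialLinearGroup (Fin 2) F) :
    (A : ProjectiveSpecialLinearGroup (Fin 2) F).out = A ∨
      (A : ProjectiveSpecialLinearGroup (Fin 2) F).out = -A := by
  rw [← mk_eq_mk_iff, QuotientGroup.out_eq']

theorem pow_eq_one_or_pow_char_eq_one_of_root {F : Type*} [Field F] {p m k : ℕ}
    [Fact p.Prime] [CharP F p]
    (hm : ∀ z : F, z ≠ 0 → z ^ (m * k) = 1) (hk : ∀ z : F, z ^ k = 1 → z = 1 ∨ z = -1)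
    (A : SpecialLinearGroup (Fin 2) F) {a : F} (ha : a ^ 2 - (A 0 0 + A 1 1) * a + 1 = 0) :
    (A : ProjectiveSpecialLinearGroup (Fin 2) F) ^ m = 1 ∨
      (A : ProjectiveSpecialLinearGroup (Fin 2) F) ^ p = 1 := by
  set M : Matrix (Fin 2) (Fin 2) F := A.1
  have hdet : M 0 0 * M 1 1 - M 0 1 * M 1 0 = 1 := by
    rw [← det_fin_two]; exact A.2
  have ha0 : a ≠ 0 := by rintro rfl; simp at ha
  have htr : a + a⁻¹ = M 0 0 + M 1 1 := by
    field_simp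
    linear_combination ha
  have hch : M * M = (a + a⁻¹) • M - 1 := by
    rw [htr]
    ext i j
    fin_cases i <;> fin_cases j <;> simp [mul_apply, Fin.sum_univ_two] <;>
      first | ring1 | linear_combination -hdet
  have lift_eq {r : ℕ} {z : F} (hz : z = 1 ∨ z = -1) (h : M ^ r = z • 1) :
      (A : ProjectiveSpecialLinearGroup (Fin 2) F) ^ r = 1 := by
    rw [← QuotientGroup.mk_pow, mk_eq_one_iff]
    refine hz.imp ?_ ?_ <;> rintro rfl <;> apply Subtype.ext
    · simpa using h
    · simpa using h
  by_cases hab : a = a⁻¹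
  · right
    have ha1 : a = 1 ∨ a = -1 := by
      rw [← sq_eq_one_iff, sq]
      nth_rewrite 2 [hab]
      exact mul_inv_cancel₀ ha0
    have hsq : (M - a • 1) ^ 2 = 0 := by
      rw [sq, sub_mul, mul_sub, mul_sub, hch, ← hab]
      have : a * a = 1 := by nth_rewrite 2 [hab]; exact mul_inv_cancel₀ ha0
      simp only [add_smul, smul_smul, this, smul_mul_assoc, mul_smul_comm, one_mul,
        mul_one, one_smul]
      abel
    have hp : (M - a • 1) ^ p = 0 :=
      pow_eq_zero_of_le (Fact.out : p.Prime).two_le hsq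
    rw [sub_pow_char_of_commute _ ((Commute.one_right M).smul_right a), sub_eq_zero, smul_pow,
      one_pow] at hp
    refine lift_eq ?_ hp
    rcases ha1 with rfl | rfl
    · simp
    · exact neg_one_pow_eq_or F p
  · left
    have h1 (r : ℕ) : (M - a • 1) * M ^ r = a⁻¹ ^ r • (M - a • 1) := by
      induction r with
      | zero => simp
      | succ r ih =>
        have : (M - a • 1) * M = a⁻¹ • (M - a • 1) := by
          rw [sub_mul, hch]
          simp only [add_smul, smul_sub, smul_smul, inv_mul_cancel₀ ha0,
            smul_mul_assoc, one_mul, one_smul]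
          abel
        rw [pow_succ, ← mul_assoc, ih, smul_mul_assoc, this, smul_smul, pow_succ]
    have h2 (r : ℕ) : (M - a⁻¹ • 1) * M ^ r = a ^ r • (M - a⁻¹ • 1) := by
      induction r with
      | zero => simp
      | succ r ih =>
        have : (M - a⁻¹ • 1) * M = a • (M - a⁻¹ • 1) := by
          rw [sub_mul, hch]
          simp only [add_smul, smul_sub, smul_smul, mul_inv_cancel₀ ha0,
            smul_mul_assoc, one_mul, one_smul]
          abel
        rw [pow_succ, ← mul_assoc, ih, smul_mul_assoc, this, smul_smul, pow_succ]
    have hz := hk (a ^ m) (by rw [← pow_mul, hm a ha0])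
    have hinv : a⁻¹ ^ m = a ^ m := by
      rw [inv_pow]; rcases hz with h | h <;> simp [h]
    refine lift_eq hz ?_
    have h3 := congrArg₂ (· - ·) (h1 m) (h2 m)
    simp only [hinv, ← sub_mul, ← smul_sub, sub_sub_sub_cancel_left, ← sub_smul] at h3
    rw [smul_mul_assoc, one_mul, smul_comm] at h3
    exact smul_right_injective _ (sub_ne_zero.2 (Ne.symm hab)) h3

section Fixes

variable {F Ω : Type*} [Field F] [Field Ω] [Algebra F Ω]

/-- The eigenvalue of `A` on the vector `(1, τ)`, when that vector is an eigenvector. -/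
def eig (A : SpecialLinearGroup (Fin 2) F) (τ : Ω) : Ω :=
  algebraMap F Ω (A 0 0) + algebraMap F Ω (A 0 1) * τ

/-- The vector `(1, τ)` is an eigenvector of `A`. -/
def Fixes (A : SpecialLinearGroup (Fin 2) F) (τ : Ω) : Prop :=
  algebraMap F Ω (A 1 0) + algebraMap F Ω (A 1 1) * τ = eig A τ * τ

theorem eig_one (τ : Ω) : eig (1 : SpecialLinearGroup (Fin 2) F) τ = 1 := by
  simp [eig]

theorem eig_neg (A : SpecialLinearGroup (Fin 2) F) (τ : Ω) : eig (-A) τ = -eig A τ := by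
  simp [eig]; ring

theorem fixes_one (τ : Ω) : Fixes (1 : SpecialLinearGroup (Fin 2) F) τ := by
  simp [Fixes, eig]

theorem fixes_neg_iff {A : SpecialLinearGroup (Fin 2) F} {τ : Ω} : Fixes (-A) τ ↔ Fixes A τ := by
  have h (i j : Fin 2) : (-A) i j = -A i j := rfl
  unfold Fixes
  rw [eig_neg, ← neg_inj (b := eig A τ * τ), h, h, map_neg, map_neg, neg_add, neg_mul, neg_mul]

theorem Fixes.eig_mul {A B : SpecialLinearGroup (Fin 2) F} {τ : Ω} (hB : Fixes B τ) :
    eig (A * B) τ = eig A τ * eig B τ := by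
  unfold Fixes at hB
  have : eig (A * B) τ = algebraMap F Ω (A 0 0) * eig B τ + algebraMap F Ω (A 0 1) *
      (algebraMap F Ω (B 1 0) + algebraMap F Ω (B 1 1) * τ) := by
    simp [eig, mul_apply, Fin.sum_univ_two]; ring
  rw [this, hB]
  unfold eig
  ring

theorem Fixes.mul {A B : SpecialLinearGroup (Fin 2) F} {τ : Ω} (hA : Fixes A τ)
    (hB : Fixes B τ) : Fixes (A * B) τ := by
  have h := hB.eig_mul (A := A)
  unfold Fixes at *
  rw [h]
  have : algebraMap F Ω ((A * B) 1 0) + algebraMap F Ω ((A * B) 1 1) * τ =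
      algebraMap F Ω (A 1 0) * eig B τ + algebraMap F Ω (A 1 1) *
      (algebraMap F Ω (B 1 0) + algebraMap F Ω (B 1 1) * τ) := by
    simp [eig, mul_apply, Fin.sum_univ_two]; ring
  rw [this, hB]
  linear_combination eig B τ * hA

theorem Fixes.pow {A : SpecialLinearGroup (Fin 2) F} {τ : Ω} (hA : Fixes A τ) (m : ℕ) :
    Fixes (A ^ m) τ ∧ eig (A ^ m) τ = eig A τ ^ m := by
  induction m with
  | zero => simp [fixes_one, eig_one]
  | succ m ih =>
    rw [pow_succ, pow_succ, hA.eig_mul, ih.2]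
    exact ⟨ih.1.mul hA, rfl⟩

theorem apply_eq_zero_of_add_mul_eq_zero (σ : Ω →ₐ[F] Ω) {τ : Ω} (hτ : σ τ ≠ τ) {a b : F}
    (h : algebraMap F Ω a + algebraMap F Ω b * τ = 0) : a = 0 ∧ b = 0 := by
  have h' := congrArg σ h
  simp only [map_add, map_mul, AlgHom.commutes, map_zero] at h'
  have hb : algebraMap F Ω b = 0 := by
    have : algebraMap F Ω b * (σ τ - τ) = 0 := by linear_combination h' - h
    exact (mul_eq_zero.1 this).resolve_right (sub_ne_zero.2 hτ)
  have ha : algebraMap F Ω a = 0 := by simpa [hb] using h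
  simpa using And.intro ha hb

theorem Fixes.eq_of_eig_eq (σ : Ω →ₐ[F] Ω) {τ : Ω} (hτ : σ τ ≠ τ)
    {A B : SpecialLinearGroup (Fin 2) F} (hA : Fixes A τ) (hB : Fixes B τ)
    (h : eig A τ = eig B τ) : A = B := by
  have h0 := apply_eq_zero_of_add_mul_eq_zero σ hτ (a := A 0 0 - B 0 0) (b := A 0 1 - B 0 1)
    (by unfold eig at h; simp only [map_sub]; linear_combination h)
  have h1 := apply_eq_zero_of_add_mul_eq_zero σ hτ (a := A 1 0 - B 1 0) (b := A 1 1 - B 1 1)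
    (by unfold Fixes at hA hB; simp only [map_sub]; linear_combination hA - hB + τ * h)
  simp only [sub_eq_zero] at h0 h1
  exact eq_of_entries h0.1 h0.2 h1.1 h1.2

theorem Fixes.map (σ : Ω →ₐ[F] Ω) {τ : Ω} {A : SpecialLinearGroup (Fin 2) F} (hA : Fixes A τ) :
    Fixes A (σ τ) := by
  have h := congrArg σ hA
  simpa only [Fixes, eig, map_add, map_mul, AlgHom.commutes] using h

theorem Fixes.eig_mul_map_eig (σ : Ω →ₐ[F] Ω) {τ : Ω} (hτ : σ τ ≠ τ)
    {A : SpecialLinearGroup (Fin 2) F} (hA : Fixes A τ) : eig A τ * σ (eig A τ) = 1 := by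
  have hdet : algebraMap F Ω (A 0 0) * algebraMap F Ω (A 1 1) -
      algebraMap F Ω (A 0 1) * algebraMap F Ω (A 1 0) = 1 := by
    rw [← map_mul, ← map_mul, ← map_sub, ← det_fin_two, A.2, map_one]
  have hσ : σ (eig A τ) = eig A (σ τ) := by simp [eig]
  have hA' := hA.map σ
  rw [hσ]
  apply mul_right_cancel₀ (sub_ne_zero.2 hτ)
  rw [one_mul]
  unfold Fixes at hA hA'
  unfold eig at *
  linear_combination (σ τ - τ) * hdet - (algebraMap F Ω (A 0 0) + algebraMap F Ω (A 0 1) * τ) * hA'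
    + (algebraMap F Ω (A 0 0) + algebraMap F Ω (A 0 1) * σ τ) * hA

theorem exists_fixes_of_mul_map_eq_one (σ : Ω →ₐ[F] Ω)
    (hσ : ∀ x, σ x = x → x ∈ Set.range (algebraMap F Ω)) {τ : Ω} (hτ : σ τ ≠ τ)
    (hτ2 : σ (σ τ) = τ) {l : Ω} (hl : l * σ l = 1) (hl2 : σ (σ l) = l) :
    ∃ A : SpecialLinearGroup (Fin 2) F, Fixes A τ ∧ eig A τ = l := by
  have h0 : σ τ - τ ≠ 0 := sub_ne_zero.2 hτ
  have h1 : τ - σ τ ≠ 0 := sub_ne_zero.2 hτ.symm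
  have entry {u : Ω} (hu : σ (σ u) = u) :
      ∃ a b : F, algebraMap F Ω a + algebraMap F Ω b * τ = u := by
    obtain ⟨b, hb⟩ := hσ ((σ u - u) / (σ τ - τ)) (by
      rw [map_div₀, map_sub, map_sub, hu, hτ2]; field_simp; ring)
    obtain ⟨a, ha⟩ := hσ (u - (σ u - u) / (σ τ - τ) * τ) (by
      rw [map_sub, map_mul, map_div₀, map_sub, map_sub, hu, hτ2]; field_simp; ring)
    exact ⟨a, b, by rw [ha, hb]; ring⟩
  obtain ⟨a, b, hab⟩ := entry hl2
  obtain ⟨c, d, hcd⟩ := entry (u := l * τ) (by simp [hl2, hτ2])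
  have hab' := congrArg σ hab
  have hcd' := congrArg σ hcd
  simp only [map_add, map_mul, AlgHom.commutes] at hab' hcd'
  have hdet : a * d - b * c = 1 := by
    apply (algebraMap F Ω).injective
    simp only [map_sub, map_mul, map_one]
    apply mul_right_cancel₀ h0
    generalize algebraMap F Ω a = a' at *
    generalize algebraMap F Ω b = b' at *
    generalize algebraMap F Ω c = c' at *
    generalize algebraMap F Ω d = d' at *
    have e1 : (a' * d' - b' * c') * (σ τ - τ) =
      (a' + b' * τ) * (c' + d' * σ τ) - (a' + b' * σ τ) * (c' + d' * τ) := by ring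
    rw [e1, hab, hcd, hab', hcd']
    linear_combination (σ τ - τ) * hl
  refine ⟨⟨!![a, b; c, d], by rw [det_fin_two_of, hdet]⟩, ?_, ?_⟩
  · simp [Fixes, eig, hab, hcd]
  · simp [eig, hab]

theorem fixes_iff_eq_or_eq_map (σ : Ω →ₐ[F] Ω) {τ : Ω} (hτ : σ τ ≠ τ)
    {A : SpecialLinearGroup (Fin 2) F} (hA1 : (A : ProjectiveSpecialLinearGroup (Fin 2) F) ≠ 1)
    (hA : Fixes A τ) (ρ : Ω) : Fixes A ρ ↔ ρ = τ ∨ ρ = σ τ := by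
  refine ⟨fun hρ ↦ ?_, ?_⟩
  · have hA' := hA.map σ
    have hdet : A 0 0 * A 1 1 - A 0 1 * A 1 0 = 1 := by
      rw [← det_fin_two]; exact A.2
    have hb : A 0 1 ≠ 0 := by
      intro hb
      have h := apply_eq_zero_of_add_mul_eq_zero σ hτ (a := A 1 0) (b := A 1 1 - A 0 0) (by
        unfold Fixes eig at hA
        rw [hb, map_zero] at hA
        rw [map_sub]
        linear_combination hA)
      have hd : A 1 1 = A 0 0 := sub_eq_zero.1 h.2
      have h2 : A 0 0 ^ 2 = 1 := by rw [hd, hb] at hdet; linear_combination hdet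
      apply hA1
      rw [mk_eq_one_iff]
      refine (sq_eq_one_iff.1 h2).imp ?_ ?_ <;> intro h3 <;> apply eq_of_entries <;>
        simp [h3, hd, hb, h.1]
    have hb' : algebraMap F Ω (A 0 1) ≠ 0 := by simpa using hb
    unfold Fixes eig at hA hA' hρ
    have hs : algebraMap F Ω (A 1 1) - algebraMap F Ω (A 0 0) =
        algebraMap F Ω (A 0 1) * (τ + σ τ) := by
      apply mul_right_cancel₀ (sub_ne_zero.2 hτ)
      linear_combination hA' - hA
    have : algebraMap F Ω (A 0 1) * ((ρ - τ) * (ρ - σ τ)) = 0 := by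
      linear_combination hA - hρ + (ρ - τ) * hs
    simpa [hb', sub_eq_zero] using this
  · rintro (rfl | rfl)
    exacts [hA, hA.map σ]

end Fixes

theorem pow_gcd_eq_one_iff {K : Type*} [Field K] {p f : ℕ} [Fact p.Prime] [CharP K p]
    (hf : f ≠ 0) (z : K) : z ^ Nat.gcd (p ^ f - 1) 2 = 1 ↔ z = 1 ∨ z = -1 := by
  rcases (Fact.out : p.Prime).eq_two_or_odd' with rfl | hp
  · have h2 : Nat.gcd (2 ^ f - 1) 2 = 1 := by
      rw [← Nat.coprime_iff_gcd_eq_one, Nat.coprime_two_right]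
      exact Nat.Even.sub_odd Nat.one_le_two_pow (even_two.pow_of_ne_zero hf) odd_one
    rw [h2, pow_one, CharTwo.neg_eq, or_self]
  · have h2 : Nat.gcd (p ^ f - 1) 2 = 2 :=
      Nat.gcd_eq_right (even_iff_two_dvd.1 (Nat.Odd.sub_odd hp.pow odd_one))
    rw [h2, sq_eq_one_iff]

theorem exists_torus_orders {p f : ℕ} [Fact p.Prime] (hf : f ≠ 0) :
    ∃ n m : ℕ, n * Nat.gcd (p ^ f - 1) 2 = p ^ f + 1 ∧ m * Nat.gcd (p ^ f - 1) 2 = p ^ f - 1 ∧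
      n.Coprime m ∧ n.Coprime p ∧ 2 ≤ n := by
  have hp : p.Prime := Fact.out
  have hq : 2 ≤ p ^ f := hp.two_le.trans (Nat.le_self_pow hf p)
  have hcop : (p ^ f + 1).Coprime p := by
    refine Nat.Coprime.coprime_dvd_right (dvd_pow_self p hf) ?_
    simp
  rcases Nat.even_or_odd' (p ^ f) with ⟨r, hr | hr⟩
  · have h2 : Nat.gcd (p ^ f - 1) 2 = 1 := by
      rw [← Nat.coprime_iff_gcd_eq_one, Nat.coprime_two_right, Nat.odd_iff]
      omega
    refine ⟨p ^ f + 1, p ^ f - 1, by rw [h2, mul_one], by rw [h2, mul_one], ?_, hcop, by omega⟩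
    have : p ^ f + 1 = 2 + (p ^ f - 1) := by omega
    rw [this, Nat.coprime_add_self_left, Nat.coprime_two_left, Nat.odd_iff]
    omega
  · have h2 : Nat.gcd (p ^ f - 1) 2 = 2 := Nat.gcd_eq_right (by omega)
    refine ⟨r + 1, r, by rw [h2]; omega, by rw [h2]; omega, by simp,
      Nat.Coprime.coprime_dvd_left ⟨2, by omega⟩ hcop, by omega⟩

section Count

variable (F : Type*) {Ω : Type*} [Field F] [Fintype F] [Field Ω] [Algebra F Ω]

theorem frobeniusAlgHom_sq_apply (x : Ω) :
    frobeniusAlgHom F Ω (frobeniusAlgHom F Ω x) = x ^ (Fintype.card F ^ 2) := by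
  simp only [coe_frobeniusAlgHom, sq, pow_mul]

variable (Ω) in
theorem ncard_pow_eq_self [IsAlgClosed Ω] (p m : ℕ) [CharP Ω p] (hpm : p ∣ m) (hm : 1 < m) :
    {x : Ω | x ^ m = x}.ncard = m := by
  have hsep := galois_poly_separable (K := Ω) p m hpm
  have h0 := X_pow_card_sub_X_ne_zero Ω hm
  have h := Polynomial.card_rootSet_eq_natDegree (K := Ω) hsep (IsAlgClosed.splits _)
  rw [X_pow_card_sub_X_natDegree_eq Ω hm, ← Nat.card_eq_fintype_card] at h
  rw [Nat.card_coe_set_eq] at h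
  refine Eq.trans (congrArg Set.ncard ?_) h
  ext x
  simp [Polynomial.mem_rootSet, h0, sub_eq_zero]

variable [IsAlgClosed Ω]

theorem mem_range_of_frobeniusAlgHom_eq {x : Ω} (hx : frobeniusAlgHom F Ω x = x) :
    x ∈ Set.range (algebraMap F Ω) := by
  obtain ⟨p, _⟩ := CharP.exists F
  have : CharP Ω p := charP_of_injective_algebraMap (algebraMap F Ω).injective p
  have hcard := ncard_pow_eq_self Ω p (Fintype.card F)
    ((CharP.cast_eq_zero_iff F p _).1 (cast_card_eq_zero F)) Fintype.one_lt_card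
  have hsub : Set.range (algebraMap F Ω) ⊆ {x : Ω | x ^ Fintype.card F = x} := by
    rintro _ ⟨y, rfl⟩
    rw [Set.mem_ofPred_eq, ← map_pow, FiniteField.pow_card]
  have heq := Set.eq_of_subset_of_ncard_le hsub (by
    rw [hcard, ← Set.image_univ, Set.ncard_image_of_injective _ (algebraMap F Ω).injective,
      Set.ncard_univ, Nat.card_eq_fintype_card])
    (Set.finite_of_ncard_pos (by rw [hcard]; exact Fintype.card_pos))
  rw [heq]
  exact hx

variable (Ω) in
/-- The elements of the quadratic extension of `F` in `Ω` that do not lie in `F`. -/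
def quadratic : Set Ω :=
  {τ | frobeniusAlgHom F Ω (frobeniusAlgHom F Ω τ) = τ ∧ frobeniusAlgHom F Ω τ ≠ τ}

variable (Ω) in
theorem ncard_quadratic :
    (quadratic F Ω).ncard = Fintype.card F ^ 2 - Fintype.card F ∧ (quadratic F Ω).Finite := by
  obtain ⟨p, _⟩ := CharP.exists F
  have : CharP Ω p := charP_of_injective_algebraMap (algebraMap F Ω).injective p
  have hp := (CharP.cast_eq_zero_iff F p _).1 (cast_card_eq_zero F)
  have h1 : 1 < Fintype.card F := Fintype.one_lt_card
  have hcard := ncard_pow_eq_self Ω p (Fintype.card F) hp h1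
  have hcard2 := ncard_pow_eq_self Ω p (Fintype.card F ^ 2) (dvd_pow hp two_ne_zero)
    (Nat.one_lt_pow two_ne_zero h1)
  have hfin : {x : Ω | x ^ Fintype.card F ^ 2 = x}.Finite :=
    Set.finite_of_ncard_pos (by rw [hcard2]; positivity)
  have hfin1 : {x : Ω | x ^ Fintype.card F = x}.Finite :=
    Set.finite_of_ncard_pos (by rw [hcard]; positivity)
  have hS : quadratic F Ω = {x : Ω | x ^ Fintype.card F ^ 2 = x} \
      {x : Ω | x ^ Fintype.card F = x} := by
    ext x
    rw [quadratic, Set.mem_ofPred_eq, frobeniusAlgHom_sq_apply]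
    rfl
  rw [hS]
  refine ⟨?_, hfin.sdiff⟩
  rw [Set.ncard_sdiff _ hfin1, hcard, hcard2]
  intro x hx
  rw [Set.mem_ofPred_eq] at hx ⊢
  rw [sq, pow_mul, hx, hx]

variable {F} in
theorem exists_fixes_or_exists_root (A : SpecialLinearGroup (Fin 2) F) :
    (∃ τ ∈ quadratic F Ω, Fixes A τ) ∨ ∃ a : F, a ^ 2 - (A 0 0 + A 1 1) * a + 1 = 0 := by
  have hdet : A 0 0 * A 1 1 - A 0 1 * A 1 0 = 1 := by
    rw [← det_fin_two]; exact A.2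
  by_cases hb : A 0 1 = 0
  · right
    exact ⟨A 0 0, by rw [hb] at hdet; linear_combination -hdet⟩
  have hb' : algebraMap F Ω (A 0 1) ≠ 0 := by simpa using hb
  obtain ⟨τ, hτ⟩ : ∃ τ : Ω, Fixes A τ := by
    obtain ⟨τ, hτ⟩ := IsAlgClosed.exists_root
      (Polynomial.C (algebraMap F Ω (A 0 1)) * Polynomial.X ^ 2 +
        Polynomial.C (algebraMap F Ω (A 0 0 - A 1 1)) * Polynomial.X +
        Polynomial.C (algebraMap F Ω (-A 1 0)))
      (by rw [Polynomial.degree_quadratic hb']; decide)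
    refine ⟨τ, ?_⟩
    simp only [Polynomial.IsRoot.def, Polynomial.eval_add, Polynomial.eval_mul, Polynomial.eval_C,
      Polynomial.eval_pow, Polynomial.eval_X] at hτ
    rw [map_sub, map_neg] at hτ
    unfold Fixes eig
    linear_combination -hτ
  by_cases hF : frobeniusAlgHom F Ω τ = τ
  · right
    obtain ⟨t, rfl⟩ := mem_range_of_frobeniusAlgHom_eq F hF
    unfold Fixes eig at hτ
    simp only [← map_mul, ← map_add] at hτ
    have h := (algebraMap F Ω).injective hτ
    exact ⟨A 0 0 + A 0 1 * t, by linear_combination -hdet - A 0 1 * h⟩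
  · left
    refine ⟨τ, ⟨?_, hF⟩, hτ⟩
    by_cases h1 : (A : ProjectiveSpecialLinearGroup (Fin 2) F) = 1
    · rw [mk_eq_one_iff] at h1
      rcases h1 with rfl | rfl <;> simp at hb
    · rcases (fixes_iff_eq_or_eq_map _ hF h1 hτ _).1
        ((hτ.map (frobeniusAlgHom F Ω)).map (frobeniusAlgHom F Ω)) with h | h
      · exact h
      · exact absurd ((frobeniusAlgHom F Ω).injective h) hF

variable {F} in
omit [IsAlgClosed Ω] in
theorem orderOf_mk_eq {k : ℕ} (hk : ∀ z : Ω, z ^ k = 1 ↔ z = 1 ∨ z = -1) {τ : Ω}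
    (hτ : τ ∈ quadratic F Ω) {A : SpecialLinearGroup (Fin 2) F} (hA : Fixes A τ) :
    orderOf (A : ProjectiveSpecialLinearGroup (Fin 2) F) = orderOf (eig A τ ^ k) := by
  rw [orderOf_eq_orderOf_iff]
  intro r
  obtain ⟨hr, he⟩ := hA.pow r
  rw [← QuotientGroup.mk_pow, mk_eq_one_iff, pow_right_comm, ← he, hk]
  refine or_congr ⟨?_, fun h ↦ ?_⟩ ⟨?_, fun h ↦ ?_⟩
  · intro h
    rw [h, eig_one]
  · exact hr.eq_of_eig_eq _ hτ.2 (fixes_one τ) (by rw [h, eig_one])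
  · intro h
    rw [h, eig_neg, eig_one]
  · exact hr.eq_of_eig_eq _ hτ.2 (fixes_neg_iff.2 (fixes_one τ)) (by rw [h, eig_neg, eig_one])

open scoped Classical in
theorem card_filter_fixes {k n : ℕ} (hk : ∀ z : Ω, z ^ k = 1 ↔ z = 1 ∨ z = -1) (hk0 : 0 < k)
    (hnk : n * k = Fintype.card F + 1) (hn : (n : Ω) ≠ 0) {τ : Ω} (hτ : τ ∈ quadratic F Ω) :
    (({x | orderOf x = n} : Finset (ProjectiveSpecialLinearGroup (Fin 2) F)).filter
      fun x ↦ Fixes x.out τ).card = n.totient := by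
  have : NeZero (n : Ω) := ⟨hn⟩
  obtain ⟨ζ, hζ⟩ := HasEnoughRootsOfUnity.exists_primitiveRoot Ω n
  have hn0 : 0 < n := Nat.pos_of_ne_zero fun h ↦ hn (by simp [h])
  rw [← hζ.card_primitiveRoots]
  have mem {y : Ω} : y ∈ primitiveRoots n Ω ↔ orderOf y = n := by
    rw [mem_primitiveRoots hn0, IsPrimitiveRoot.iff_orderOf]
  refine Finset.card_bij (fun x _ ↦ eig x.out τ ^ k) ?_ ?_ ?_
  · intro x hx
    simp only [Finset.mem_filter, Finset.mem_univ, true_and] at hx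
    rw [mem, ← orderOf_mk_eq hk hτ hx.2, QuotientGroup.out_eq', hx.1]
  · intro x hx y hy h
    simp only [Finset.mem_filter, Finset.mem_univ, true_and] at hx hy
    have hy0 : eig y.out τ ≠ 0 :=
      left_ne_zero_of_mul_eq_one (hy.2.eig_mul_map_eig (frobeniusAlgHom F Ω) hτ.2)
    have h1 : (eig x.out τ / eig y.out τ) ^ k = 1 := by
      rw [div_pow, h, div_self (pow_ne_zero _ hy0)]
    rw [hk, div_eq_one_iff_eq hy0, div_eq_iff hy0, neg_one_mul, ← eig_neg] at h1
    rw [← QuotientGroup.out_eq' x, ← QuotientGroup.out_eq' y, mk_eq_mk_iff]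
    exact h1.imp (hx.2.eq_of_eig_eq _ hτ.2 hy.2)
      (hx.2.eq_of_eig_eq _ hτ.2 (fixes_neg_iff.2 hy.2))
  · intro y hy
    rw [mem] at hy
    obtain ⟨l, rfl⟩ := IsAlgClosed.exists_pow_nat_eq y hk0
    have hl : l * frobeniusAlgHom F Ω l = 1 := by
      rw [coe_frobeniusAlgHom, ← pow_succ', ← hnk, mul_comm, pow_mul, ← hy, pow_orderOf_eq_one]
    have hl2 : frobeniusAlgHom F Ω (frobeniusAlgHom F Ω l) = l := by
      have h := congrArg (frobeniusAlgHom F Ω) hl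
      rw [map_mul, map_one, ← hl, mul_comm l] at h
      exact mul_left_cancel₀ (right_ne_zero_of_mul_eq_one hl) h
    obtain ⟨A, hA, rfl⟩ := exists_fixes_of_mul_map_eq_one (frobeniusAlgHom F Ω)
      (fun x ↦ mem_range_of_frobeniusAlgHom_eq F) hτ.2 hτ.1 hl hl2
    refine ⟨A, ?_, ?_⟩
    · simp only [Finset.mem_filter, Finset.mem_univ, true_and]
      rw [orderOf_mk_eq hk hτ hA]
      refine ⟨hy, ?_⟩
      rcases out_eq_or_eq_neg A with h | h <;> rw [h]
      exacts [hA, fixes_neg_iff.2 hA]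
    · rcases out_eq_or_eq_neg A with h | h <;> rw [h]
      rw [eig_neg, neg_pow, (hk _).2 (Or.inr rfl), one_mul]

open scoped Classical in
theorem card_filter_fixed_points {x : ProjectiveSpecialLinearGroup (Fin 2) F} {T : Finset Ω}
    (hT : (T : Set Ω) = quadratic F Ω) (hx1 : x ≠ 1)
    (hx : ∀ a : F, a ^ 2 - (x.out 0 0 + x.out 1 1) * a + 1 ≠ 0) :
    (T.filter fun τ ↦ Fixes x.out τ).card = 2 := by
  obtain ⟨τ, hτ, hfix⟩ := (exists_fixes_or_exists_root (Ω := Ω) x.out).resolve_right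
    (by simpa using hx)
  have hmem {ρ : Ω} : ρ ∈ T ↔ ρ ∈ quadratic F Ω := by rw [← hT, Finset.mem_coe]
  rw [Finset.card_eq_two]
  refine ⟨τ, frobeniusAlgHom F Ω τ, hτ.2.symm, ?_⟩
  ext ρ
  rw [Finset.mem_filter, hmem, Finset.mem_insert, Finset.mem_singleton,
    fixes_iff_eq_or_eq_map _ hτ.2 (by rwa [QuotientGroup.out_eq']) hfix, and_iff_right_iff_imp]
  rintro (rfl | rfl)
  · exact hτ
  · exact ⟨by rw [hτ.1], by rw [hτ.1]; exact hτ.2.symm⟩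

theorem ncard_orderOf_eq {p f : ℕ} [Fact p.Prime] [CharP F p] (hf : f ≠ 0)
    (hq : Fintype.card F = p ^ f) {n : ℕ} (hnk : n * Nat.gcd (p ^ f - 1) 2 = p ^ f + 1) :
    {x : ProjectiveSpecialLinearGroup (Fin 2) F | orderOf x = n}.ncard * 2 =
      (p ^ f * (p ^ f - 1)) * n.totient := by
  classical
  have : CharP (AlgebraicClosure F) p :=
    charP_of_injective_algebraMap (algebraMap F _).injective p
  obtain ⟨n', m, hn', hm, hnm, hnp, hn2⟩ := exists_torus_orders (p := p) hf
  have hk0 : 0 < Nat.gcd (p ^ f - 1) 2 := Nat.gcd_pos_of_pos_right _ two_pos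
  obtain rfl : n = n' := Nat.eq_of_mul_eq_mul_right hk0 (hnk.trans hn'.symm)
  have hn0 : (n : AlgebraicClosure F) ≠ 0 := by
    rw [Ne, CharP.cast_eq_zero_iff _ p, ← (Fact.out : p.Prime).coprime_iff_not_dvd]
    exact hnp.symm
  obtain ⟨hcard, hfin⟩ := ncard_quadratic F (AlgebraicClosure F)
  rw [Set.ncard_eq_toFinset_card _ hfin, hq] at hcard
  have hs : {x : ProjectiveSpecialLinearGroup (Fin 2) F | orderOf x = n} =
      ({x | orderOf x = n} : Finset (ProjectiveSpecialLinearGroup (Fin 2) F)) := by simp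
  rw [hs, Set.ncard_coe_finset, Nat.mul_sub_one, ← sq, ← hcard]
  refine Finset.card_mul_eq_card_mul (fun x τ ↦ Fixes x.out τ) ?_ ?_
  · intro x hx
    rw [Finset.mem_filter_univ] at hx
    have eq_one_of_coprime {r : ℕ} (hr : n.Coprime r) (h : x ^ r = 1) : n = 1 :=
      Nat.eq_one_of_dvd_coprimes hr dvd_rfl (hx ▸ orderOf_dvd_of_pow_eq_one h)
    refine card_filter_fixed_points F hfin.coe_toFinset ?_ ?_
    · rintro rfl
      rw [orderOf_one] at hx
      omega
    · intro a ha
      have h := pow_eq_one_or_pow_char_eq_one_of_root (p := p) (m := m)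
        (fun z hz ↦ by rw [hm, ← hq, pow_card_sub_one_eq_one z hz])
        (fun z ↦ (pow_gcd_eq_one_iff (p := p) hf z).1) x.out ha
      rw [QuotientGroup.out_eq'] at h
      rcases h with h | h
      · have := eq_one_of_coprime hnm h
        omega
      · have := eq_one_of_coprime hnp h
        omega
  · intro τ hτ
    rw [Set.Finite.mem_toFinset] at hτ
    exact card_filter_fixes F (pow_gcd_eq_one_iff hf) hk0 (by rw [hnk, hq]) hn0 hτ

end Count

end SpecialLinearTwo

/-- the number of elements of order `(q+1)/k` in `PSL(2,q)`,
where `k = gcd(q−1,2)`, equals `φ((q+1)/k)·q(q−1)/2`. -/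
theorem stmt_17 (p f : ℕ) [Fact p.Prime] (hf : f ≠ 0)
    (q : ℕ) (hq : q = p ^ f) (k : ℕ) (hk : k = Nat.gcd (q - 1) 2) :
    {x : ProjectiveSpecialLinearGroup (Fin 2) (GaloisField p f) |
      orderOf x = (q + 1) / k}.ncard =
      Nat.totient ((q + 1) / k) * (q * (q - 1) / 2) := by
  have : Fintype (GaloisField p f) := Fintype.ofFinite _
  have hcard : Fintype.card (GaloisField p f) = p ^ f := by
    rw [← Nat.card_eq_fintype_card, GaloisField.card p f hf]
  obtain ⟨n, -, hn, -⟩ := SpecialLinearTwo.exists_torus_orders (p := p) hf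
  have h := SpecialLinearTwo.ncard_orderOf_eq (GaloisField p f) hf hcard hn
  have hk0 : 0 < Nat.gcd (p ^ f - 1) 2 := Nat.gcd_pos_of_pos_right _ two_pos
  have hdiv : (q + 1) / k = n := by
    rw [hk, hq, ← hn, Nat.mul_div_cancel _ hk0]
  obtain ⟨r, hr⟩ : 2 ∣ q * (q - 1) := even_iff_two_dvd.1 (Nat.even_mul_pred_self q)
  rw [← hq, hr] at h
  rw [hdiv, hr, Nat.mul_div_cancel_left _ two_pos]
  apply Nat.eq_of_mul_eq_mul_right two_pos
  rw [h]
  ring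
end

section
/- Let q > 11 be a prime power and G = PSL(2,q). Then every involution s in G has vertex degree in the generating graph greater than the number of involutions in G; that is, |{g ∈ G : ⟨s,g⟩ = G}| > |{t ∈ G : t² = 1, t ≠ 1}|. -/
open Matrix

section Quadratic
variable {F : Type*} [Field F] [Fintype F] [DecidableEq F]

/-- A nonzero quadratic polynomial has at most two roots. -/
theorem card_quadratic_roots_le {a : F} (ha : a ≠ 0) (b c : F) :
    (Finset.univ.filter fun y : F => a * y ^ 2 + b * y + c = 0).card ≤ 2 := by
  by_cases h : ∃ y₀ : F, a * y₀ ^ 2 + b * y₀ + c = 0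
  · obtain ⟨y₀, h₀⟩ := h
    refine (Finset.card_le_card (t := {y₀, -b / a - y₀}) fun y hy => ?_).trans Finset.card_le_two
    have hy' : a * y ^ 2 + b * y + c = 0 := by simpa using hy
    have h1 : (y - y₀) * (a * (y + y₀) + b) = 0 := by linear_combination hy' - h₀
    rcases mul_eq_zero.1 h1 with h | h
    · simp [sub_eq_zero.1 h]
    · have : y = -b / a - y₀ := by
        field_simp
        linear_combination h
      simp [this]
  · push Not at h
    rw [Finset.filter_eq_empty_iff.2 fun y _ => h y]
    simp

/-- The nonzero squares of a finite field. -/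
def nonzeroSquares (F : Type*) [Field F] [Fintype F] [DecidableEq F] : Finset F :=
  (Finset.univ.filter fun z : F => z ≠ 0).image (· ^ 2)

theorem mem_nonzeroSquares {y : F} : y ∈ nonzeroSquares F ↔ ∃ z : F, z ≠ 0 ∧ z ^ 2 = y := by
  simp [nonzeroSquares]

theorem card_le_two_mul_card_nonzeroSquares_add_one :
    Fintype.card F ≤ 2 * (nonzeroSquares F).card + 1 := by
  have h1 : (Finset.univ.filter fun z : F => z ≠ 0).card ≤ 2 * (nonzeroSquares F).card := by
    refine Finset.card_le_mul_card_image _ 2 fun y _ => ?_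
    refine (Finset.card_le_card fun z hz => ?_).trans
      (card_quadratic_roots_le (one_ne_zero (α := F)) 0 (-y))
    have : z ^ 2 = y := (Finset.mem_filter.1 hz).2
    simp [this]
  have h2 : (Finset.univ.filter fun z : F => z ≠ 0).card = Fintype.card F - 1 := by
    rw [Finset.filter_ne', Finset.card_erase_of_mem (Finset.mem_univ _), Finset.card_univ]
  omega

/-- In a finite field the product of two non-squares is a square. -/
theorem isSquare_mul_of_not_isSquare {x y : F} (hx : ¬IsSquare x) (hy : ¬IsSquare y) :
    IsSquare (x * y) := by
  have hF : ringChar F ≠ 2 := fun h => hx (FiniteField.isSquare_of_char_two h x)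
  have hx0 : x ≠ 0 := by rintro rfl; simp at hx
  have hy0 : y ≠ 0 := by rintro rfl; simp at hy
  rw [← quadraticChar_one_iff_isSquare (mul_ne_zero hx0 hy0), map_mul,
    quadraticChar_neg_one_iff_not_isSquare.2 hx, quadraticChar_neg_one_iff_not_isSquare.2 hy]
  norm_num

/-- The field-theoretic constraints satisfied by a subgroup of `SL₂` that contains the diagonal
torus and a generic involution, but no nontrivial unipotent upper or lower triangular matrix. -/
theorem card_le_eleven_of_torus_constraints {A B : F} (hA : A ≠ 0) (hB : B ≠ 0) (hAB : A + B = -1)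
    (h1 : ∀ z : F, z ≠ 0 → z ^ 2 * A + B = 0 → z ^ 2 * B + A = 0)
    (h2 : ∀ u z : F, u ≠ 0 → z ≠ 0 → u ^ 2 * (z ^ 2 * A + B) - A * (z ^ 2 - 1) = 0 →
      u ^ 2 * A * (z ^ 2 - 1) + (z ^ 2 * B + A) = 0)
    (h3 : ∀ u z : F, u ≠ 0 → z ≠ 0 → u ^ 2 * (z ^ 2 * A + B) + B * (z ^ 2 - 1) = 0 →
      u ^ 2 * B * (z ^ 2 - 1) - (z ^ 2 * B + A) = 0)
    (h4 : ∀ v z : F, v ≠ 0 → z ≠ 0 →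
      v ^ 2 * ((z ^ 2 * A + B) * (z ^ 2 * B + A)) - A * B * (z ^ 2 - 1) ^ 2 = 0 →
      (z ^ 2 * A + B) * (z ^ 2 * B + A) - v ^ 2 * (A * B * (z ^ 2 - 1) ^ 2) = 0) :
    Fintype.card F ≤ 11 := by
  have hcard := card_le_two_mul_card_nonzeroSquares_add_one (F := F)
  suffices (nonzeroSquares F).card ≤ 5 by omega
  by_cases hα : IsSquare (-B / A)
  · obtain ⟨w, hw⟩ := hα
    have hw' : w ^ 2 * A + B = 0 := by
      rw [pow_two, ← hw]; field_simp; ring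
    have hw0 : w ≠ 0 := by rintro rfl; apply hB; simpa using hw'
    have hw2 := h1 w hw0 hw'
    have hAB2 : A = B := by
      have : (A - B) * (A + B) = 0 := by linear_combination A * hw2 - B * hw'
      rw [hAB] at this
      linear_combination -this
    subst hAB2
    have h2ne : (2 : F) ≠ 0 := by
      intro h; apply one_ne_zero (α := F); linear_combination hAB - A * h
    have hsub : nonzeroSquares F ⊆ insert 1 (insert (-1)
        (Finset.univ.filter fun y : F => 1 * y ^ 2 + 0 * y + 1 = 0)) := by
      intro y hy
      obtain ⟨z, hz, rfl⟩ := mem_nonzeroSquares.1 hy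
      by_cases hz1 : z ^ 2 = 1
      · simp [hz1]
      by_cases hz2 : z ^ 2 = -1
      · simp [hz2]
      have e1 : z ^ 2 - 1 ≠ 0 := sub_ne_zero.2 hz1
      have e2 : z ^ 2 + 1 ≠ 0 := by rwa [← sub_neg_eq_add, sub_ne_zero]
      have := h4 ((z ^ 2 - 1) / (z ^ 2 + 1)) z (div_ne_zero e1 e2) hz (by field_simp; ring)
      have h5 : A ^ 2 * ((z ^ 2 + 1) ^ 4 - (z ^ 2 - 1) ^ 4) = 0 := by
        field_simp at this
        linear_combination this
      have h6 : A ^ 2 * 2 ^ 3 * z ^ 2 * ((z ^ 2) ^ 2 + 1) = 0 := by linear_combination h5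
      have h7 : (z ^ 2) ^ 2 + 1 = 0 :=
        (mul_eq_zero.1 h6).resolve_left
          (mul_ne_zero (mul_ne_zero (pow_ne_zero _ hA) (pow_ne_zero _ h2ne)) (pow_ne_zero _ hz))
      simp [h7]
    have := Finset.card_le_card hsub
    have c1 := Finset.card_insert_le (1 : F) (insert (-1)
        (Finset.univ.filter fun y : F => 1 * y ^ 2 + 0 * y + 1 = 0))
    have c2 := Finset.card_insert_le (-1 : F)
        (Finset.univ.filter fun y : F => 1 * y ^ 2 + 0 * y + 1 = 0)
    have c3 := card_quadratic_roots_le (one_ne_zero (α := F)) 0 1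
    omega
  · have hsub : nonzeroSquares F ⊆ insert 1
        ((Finset.univ.filter fun y : F => A * y ^ 2 + (B - A) * y + A = 0) ∪
        (Finset.univ.filter fun y : F => B * y ^ 2 + (A - B) * y + B = 0)) := by
      intro y hy
      obtain ⟨z, hz, rfl⟩ := mem_nonzeroSquares.1 hy
      by_cases hz1 : z ^ 2 = 1
      · simp [hz1]
      have e1 : z ^ 2 - 1 ≠ 0 := sub_ne_zero.2 hz1
      have e2 : z ^ 2 * A + B ≠ 0 := fun h => hα ⟨z, by
        field_simp; linear_combination -h⟩
      simp only [Finset.mem_insert, Finset.mem_union, Finset.mem_filter, Finset.mem_univ, true_and]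
      right
      by_cases hr : IsSquare (-B * (z ^ 2 - 1) / (z ^ 2 * A + B))
      · right
        obtain ⟨u, hu⟩ := hr
        have hu' : u ^ 2 * (z ^ 2 * A + B) + B * (z ^ 2 - 1) = 0 := by
          rw [pow_two, ← hu]; field_simp; ring
        have hu0 : u ≠ 0 := by
          rintro rfl
          exact mul_ne_zero hB e1 (by simpa using hu')
        have := h3 u z hu0 hz hu'
        linear_combination (-B * (z ^ 2 - 1)) * hu' + (z ^ 2 * A + B) * this +
          (B * (z ^ 2) ^ 2 + (A - B) * z ^ 2 + B) * hAB
      · left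
        have hα' : ¬ IsSquare (-A / B) := by
          rintro ⟨w, hw⟩
          refine hα ⟨w⁻¹, ?_⟩
          rw [← mul_inv, ← hw, inv_div, div_neg, neg_div]
        obtain ⟨u, hu⟩ := isSquare_mul_of_not_isSquare hα' hr
        have hu2 : u ^ 2 = A * (z ^ 2 - 1) / (z ^ 2 * A + B) := by
          rw [pow_two, ← hu, div_mul_div_comm, div_eq_div_iff (mul_ne_zero hB e2) e2]
          ring
        have hu' : u ^ 2 * (z ^ 2 * A + B) - A * (z ^ 2 - 1) = 0 := by
          rw [hu2, div_mul_cancel₀ _ e2, sub_self]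
        have hu0 : u ≠ 0 := by
          rintro rfl
          exact mul_ne_zero hA e1 (by simpa using hu')
        have := h2 u z hu0 hz hu'
        linear_combination (A * (z ^ 2 - 1)) * hu' - (z ^ 2 * A + B) * this +
          (A * (z ^ 2) ^ 2 + (B - A) * z ^ 2 + A) * hAB
    have := Finset.card_le_card hsub
    have c1 := Finset.card_insert_le (1 : F)
      ((Finset.univ.filter fun y : F => A * y ^ 2 + (B - A) * y + A = 0) ∪
        (Finset.univ.filter fun y : F => B * y ^ 2 + (A - B) * y + B = 0))
    have c2 := Finset.card_union_le (Finset.univ.filter fun y : F => A * y ^ 2 + (B - A) * y + A = 0)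
        (Finset.univ.filter fun y : F => B * y ^ 2 + (A - B) * y + B = 0)
    have c3 := card_quadratic_roots_le hA (B - A) A
    have c4 := card_quadratic_roots_le hB (A - B) B
    omega
end Quadratic

section SpecialLinear
variable {F : Type*} [Field F]

open scoped MatrixGroups

theorem sl2_det (g : SL(2, F)) : g 0 0 * g 1 1 - g 0 1 * g 1 0 = 1 := by
  rw [← det_fin_two, Matrix.SpecialLinearGroup.det_coe]

theorem sl2_mul_apply (g h : SL(2, F)) (i j : Fin 2) :
    (g * h) i j = g i 0 * h 0 j + g i 1 * h 1 j := by
  simp [Matrix.SpecialLinearGroup.coe_mul, Matrix.mul_apply, Fin.sum_univ_two]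

theorem sl2_ext {g h : SL(2, F)} (h00 : g 0 0 = h 0 0) (h01 : g 0 1 = h 0 1)
    (h10 : g 1 0 = h 1 0) (h11 : g 1 1 = h 1 1) : g = h := by
  ext i j
  fin_cases i <;> fin_cases j <;> assumption

@[simp] theorem sl2_inv_zero_zero (g : SL(2, F)) : g⁻¹ 0 0 = g 1 1 := by
  simp [Matrix.SpecialLinearGroup.coe_inv, adjugate_fin_two]

@[simp] theorem sl2_inv_zero_one (g : SL(2, F)) : g⁻¹ 0 1 = -g 0 1 := by
  simp [Matrix.SpecialLinearGroup.coe_inv, adjugate_fin_two]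

@[simp] theorem sl2_inv_one_zero (g : SL(2, F)) : g⁻¹ 1 0 = -g 1 0 := by
  simp [Matrix.SpecialLinearGroup.coe_inv, adjugate_fin_two]

@[simp] theorem sl2_inv_one_one (g : SL(2, F)) : g⁻¹ 1 1 = g 0 0 := by
  simp [Matrix.SpecialLinearGroup.coe_inv, adjugate_fin_two]

/-- The element of `SL₂` with the given entries. -/
def sl2Mk (a b c d : F) (h : a * d - b * c = 1) : SL(2, F) :=
  ⟨!![a, b; c, d], by rw [det_fin_two_of, h]⟩

section
variable (a b c d : F) (h : a * d - b * c = 1)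
@[simp] theorem sl2Mk_zero_zero : sl2Mk a b c d h 0 0 = a := rfl
@[simp] theorem sl2Mk_zero_one : sl2Mk a b c d h 0 1 = b := rfl
@[simp] theorem sl2Mk_one_zero : sl2Mk a b c d h 1 0 = c := rfl
@[simp] theorem sl2Mk_one_one : sl2Mk a b c d h 1 1 = d := rfl
end

/-- The diagonal torus of `SL₂`. -/
def diagTorus (F : Type*) [Field F] : Fˣ →* SL(2, F) where
  toFun t := sl2Mk (t : F) 0 0 ((t : F)⁻¹) (by simp)
  map_one' := by apply sl2_ext <;> simp
  map_mul' s t := by apply sl2_ext <;> simp [sl2_mul_apply, mul_comm]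

section
variable (t : Fˣ)
@[simp] theorem diagTorus_zero_zero : diagTorus F t 0 0 = t := rfl
@[simp] theorem diagTorus_zero_one : diagTorus F t 0 1 = 0 := rfl
@[simp] theorem diagTorus_one_zero : diagTorus F t 1 0 = 0 := rfl
@[simp] theorem diagTorus_one_one : diagTorus F t 1 1 = (t : F)⁻¹ := rfl
end

/-- The upper unipotent elements of `SL₂`. -/
def upperUnipotent (x : F) : SL(2, F) := sl2Mk 1 x 0 1 (by simp)

section
variable (x : F)
@[simp] theorem upperUnipotent_zero_zero : upperUnipotent x 0 0 = 1 := rfl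
@[simp] theorem upperUnipotent_zero_one : upperUnipotent x 0 1 = x := rfl
@[simp] theorem upperUnipotent_one_zero : upperUnipotent x 1 0 = 0 := rfl
@[simp] theorem upperUnipotent_one_one : upperUnipotent x 1 1 = 1 := rfl
end

theorem sl2_trace_conj (P X : SL(2, F)) :
    (P⁻¹ * X * P) 0 0 + (P⁻¹ * X * P) 1 1 = X 0 0 + X 1 1 := by
  simp only [sl2_mul_apply, sl2_inv_zero_zero, sl2_inv_zero_one, sl2_inv_one_zero, sl2_inv_one_one]
  linear_combination (X 0 0 + X 1 1) * sl2_det P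

variable [Fintype F] [DecidableEq F]

theorem exists_triangular_not_diagonal_mem (hF : 11 < Fintype.card F) (H : Subgroup (SL(2, F)))
    (hD : ∀ t, diagTorus F t ∈ H) {S : SL(2, F)} (hS : S ∈ H) (htr : S 0 0 + S 1 1 = 0)
    (ha : S 0 0 ≠ 0) (hb : S 0 1 ≠ 0) (hc : S 1 0 ≠ 0) :
    ∃ h ∈ H, h 1 0 = 0 ∧ h 0 1 ≠ 0 ∨ h 1 0 ≠ 0 ∧ h 0 1 = 0 := by
  by_contra! hcon
  have h01 : ∀ h ∈ H, h 0 1 = 0 → h 1 0 = 0 := fun h hh h0 => by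
    by_contra h1; exact (hcon h hh).2 h1 h0
  obtain ⟨t, ht⟩ : ∃ t : Fˣ, (t : F) ^ 2 ≠ 1 := by
    by_contra! hall
    have : (Finset.univ : Finset F) ⊆
        insert 0 (Finset.univ.filter fun y : F => 1 * y ^ 2 + 0 * y + -1 = 0) := by
      intro y _
      by_cases hy : y = 0
      · simp [hy]
      · have := hall (Units.mk0 y hy)
        simp only [Units.val_mk0] at this
        simp [this]
    have h1 := Finset.card_le_card this
    have h2 := Finset.card_insert_le (0 : F)
      (Finset.univ.filter fun y : F => 1 * y ^ 2 + 0 * y + -1 = 0)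
    have h3 := card_quadratic_roots_le (one_ne_zero (α := F)) 0 (-1)
    rw [Finset.card_univ] at h1
    omega
  have hanti : ∀ h ∈ H, h 0 0 = 0 → h 1 1 = 0 := by
    intro h hh h0
    have hmem := H.mul_mem (H.mul_mem hh (hD t)) (H.inv_mem hh)
    have key := h01 _ hmem (by simp [sl2_mul_apply, h0])
    simp only [sl2_mul_apply, diagTorus_zero_zero, diagTorus_zero_one, diagTorus_one_zero,
      diagTorus_one_one, sl2_inv_zero_zero, sl2_inv_one_zero, mul_zero, zero_add, add_zero] at key
    have hdet := sl2_det h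
    have h10 : h 1 0 ≠ 0 := by
      intro h10; simp [h0, h10] at hdet
    have ht0 : (t : F) ≠ 0 := t.ne_zero
    have : h 1 0 * h 1 1 * ((t : F) ^ 2 - 1) = 0 := by
      field_simp at key
      linear_combination key
    simpa [h10, sub_eq_zero, ht] using this
  have hd : S 1 1 = -S 0 0 := by linear_combination htr
  have hdet : S 0 0 ^ 2 + S 0 1 * S 1 0 = -1 := by
    have := sl2_det S
    rw [hd] at this
    linear_combination -this
  have hM : ∀ z : Fˣ, S * diagTorus F z * S ∈ H := fun z => H.mul_mem (H.mul_mem hS (hD z)) hS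
  have hN : ∀ u z : Fˣ, S * diagTorus F u * (S * diagTorus F z * S) ∈ H := fun u z =>
    H.mul_mem (H.mul_mem hS (hD u)) (hM z)
  refine absurd (card_le_eleven_of_torus_constraints (pow_ne_zero 2 ha) (mul_ne_zero hb hc) hdet
    ?_ ?_ ?_ ?_) (not_le.2 hF)
  · intro z hz h
    have := hanti _ (hM (Units.mk0 z hz)) (by
      simp only [sl2_mul_apply, diagTorus_zero_zero, diagTorus_zero_one, diagTorus_one_zero,
        diagTorus_one_one, Units.val_mk0]
      field_simp
      linear_combination h)
    simp only [sl2_mul_apply, diagTorus_zero_zero, diagTorus_zero_one, diagTorus_one_zero,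
      diagTorus_one_one, Units.val_mk0, hd] at this
    field_simp at this
    linear_combination this
  · intro u z hu hz h
    have := (hcon _ (hN (Units.mk0 u hu) (Units.mk0 z hz))).1 (by
      simp only [sl2_mul_apply, diagTorus_zero_zero, diagTorus_zero_one, diagTorus_one_zero,
        diagTorus_one_one, Units.val_mk0, hd]
      field_simp
      linear_combination S 1 0 * h)
    simp only [sl2_mul_apply, diagTorus_zero_zero, diagTorus_zero_one, diagTorus_one_zero,
      diagTorus_one_one, Units.val_mk0, hd] at this
    field_simp at this
    refine mul_left_cancel₀ hb ?_
    linear_combination this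
  · intro u z hu hz h
    have := hanti _ (hN (Units.mk0 u hu) (Units.mk0 z hz)) (by
      simp only [sl2_mul_apply, diagTorus_zero_zero, diagTorus_zero_one, diagTorus_one_zero,
        diagTorus_one_one, Units.val_mk0, hd]
      field_simp
      linear_combination S 0 0 * h)
    simp only [sl2_mul_apply, diagTorus_zero_zero, diagTorus_zero_one, diagTorus_one_zero,
      diagTorus_one_one, Units.val_mk0, hd] at this
    field_simp at this
    refine mul_left_cancel₀ ha ?_
    linear_combination this
  · intro v z hv hz h
    have := hanti _ (H.mul_mem (H.mul_mem (H.inv_mem (hM (Units.mk0 z hz)))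
        (hD (Units.mk0 v hv))) (hM (Units.mk0 z hz))) (by
      simp only [sl2_mul_apply (_⁻¹), sl2_mul_apply (_ * _) (S * _ * S),
        sl2_inv_zero_zero, sl2_inv_zero_one]
      simp only [sl2_mul_apply, diagTorus_zero_zero, diagTorus_zero_one, diagTorus_one_zero,
        diagTorus_one_one, Units.val_mk0, hd]
      field_simp
      linear_combination h)
    simp only [sl2_mul_apply (_⁻¹), sl2_mul_apply (_ * _) (S * _ * S),
        sl2_inv_one_zero, sl2_inv_one_one] at this
    simp only [sl2_mul_apply, diagTorus_zero_zero, diagTorus_zero_one, diagTorus_one_zero,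
      diagTorus_one_one, Units.val_mk0, hd] at this
    field_simp at this
    linear_combination this

theorem eq_top_of_diagTorus_mem_of_upper_mem (H : Subgroup SL(2, F))
    (hD : ∀ t, diagTorus F t ∈ H) {S : SL(2, F)} (hS : S ∈ H) (hc : S 1 0 ≠ 0)
    {h : SL(2, F)} (hh : h ∈ H) (h10 : h 1 0 = 0) (h01 : h 0 1 ≠ 0) : H = ⊤ := by
  have hU_add : ∀ x y : F, upperUnipotent (x + y) = upperUnipotent x * upperUnipotent y :=
    fun x y => by apply sl2_ext <;> simp [sl2_mul_apply, add_comm]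
  let V : AddSubgroup F :=
    { carrier := {x | upperUnipotent x ∈ H}
      add_mem' := fun {x y} hx hy => by
        simp only [Set.mem_ofPred_eq, hU_add] at *
        exact H.mul_mem hx hy
      zero_mem' := by
        have : upperUnipotent (0 : F) = 1 := by apply sl2_ext <;> simp
        simp only [Set.mem_ofPred_eq, this, H.one_mem]
      neg_mem' := fun {x} hx => by
        have : upperUnipotent (-x) = (upperUnipotent x)⁻¹ := by apply sl2_ext <;> simp
        simp only [Set.mem_ofPred_eq, this] at *
        exact H.inv_mem hx }
  have hVmem : ∀ x, x ∈ V ↔ upperUnipotent x ∈ H := fun x => Iff.rfl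
  have hdet := sl2_det h
  have h00 : h 0 0 ≠ 0 := by
    intro h0; simp [h0, h10] at hdet
  have hx₀ : (h 0 0)⁻¹ * h 0 1 ∈ V := by
    have : upperUnipotent ((h 0 0)⁻¹ * h 0 1) = (diagTorus F (Units.mk0 _ h00))⁻¹ * h := by
      apply sl2_ext
      · simp [sl2_mul_apply, h00]
      · simp [sl2_mul_apply]
      · simp [sl2_mul_apply, h10]
      · simp only [h10, mul_zero, sub_zero] at hdet
        simp [sl2_mul_apply, hdet]
    rw [hVmem, this]
    exact H.mul_mem (H.inv_mem (hD _)) hh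
  set x₀ := (h 0 0)⁻¹ * h 0 1
  have hx₀0 : x₀ ≠ 0 := mul_ne_zero (inv_ne_zero h00) h01
  have hsq : ∀ y ∈ nonzeroSquares F, y * x₀ ∈ V := by
    intro y hy
    obtain ⟨z, hz, rfl⟩ := mem_nonzeroSquares.1 hy
    have : upperUnipotent (z ^ 2 * x₀) = diagTorus F (Units.mk0 z hz) * upperUnipotent x₀ *
        (diagTorus F (Units.mk0 z hz))⁻¹ := by
      apply sl2_ext <;> simp [sl2_mul_apply, hz]
      ring
    rw [hVmem, this]
    exact H.mul_mem (H.mul_mem (hD _) hx₀) (H.inv_mem (hD _))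
  have hV : V = ⊤ := by
    classical
    apply AddSubgroup.eq_top_of_card_eq
    have hsub : insert 0 ((nonzeroSquares F).image (· * x₀)) ⊆
        Finset.univ.filter (fun x => x ∈ V) := by
      intro y hy
      rcases Finset.mem_insert.1 hy with rfl | hy
      · simp [V.zero_mem]
      · obtain ⟨w, hw, rfl⟩ := Finset.mem_image.1 hy
        simpa using hsq w hw
    have h1 := Finset.card_le_card hsub
    rw [Finset.card_insert_of_notMem, Finset.card_image_of_injective _
      (mul_left_injective₀ hx₀0), ← Fintype.card_subtype] at h1
    · have h2 := card_le_two_mul_card_nonzeroSquares_add_one (F := F)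
      obtain ⟨k, hk⟩ := V.card_addSubgroup_dvd_card
      have h3 : Fintype.card {x // x ∈ V} = Nat.card V := Nat.card_eq_fintype_card.symm
      rw [h3] at h1
      rw [← Nat.card_eq_fintype_card] at h2
      have h4 : 0 < Nat.card F := Nat.card_pos
      have hk2 : k < 2 := by
        by_contra! hk2
        have := Nat.mul_le_mul_left (Nat.card V) hk2
        omega
      have hk1 : k = 1 := by
        rcases Nat.eq_zero_or_pos k with rfl | h'
        · omega
        · omega
      rw [hk, hk1, mul_one]
    · intro h0
      obtain ⟨w, hw, hw0⟩ := Finset.mem_image.1 h0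
      obtain ⟨z, hz, rfl⟩ := mem_nonzeroSquares.1 hw
      exact mul_ne_zero (pow_ne_zero 2 hz) hx₀0 hw0
  have hU : ∀ x, upperUnipotent x ∈ H := fun x => by
    rw [← hVmem, hV]; trivial
  have hrow : ∀ M N : SL(2, F), N ∈ H → M 1 0 = N 1 0 → M 1 1 = N 1 1 → M ∈ H := by
    intro M N hN e0 e1
    have hM := sl2_det M
    have hNd := sl2_det N
    have : M * N⁻¹ = upperUnipotent (M 0 1 * N 0 0 - M 0 0 * N 0 1) := by
      apply sl2_ext
      · simp only [sl2_mul_apply, sl2_inv_zero_zero, sl2_inv_one_zero, upperUnipotent_zero_zero,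
          ← e0, ← e1]
        linear_combination hM
      · simp only [sl2_mul_apply, sl2_inv_zero_one, sl2_inv_one_one, upperUnipotent_zero_one]
        ring
      · simp only [sl2_mul_apply, sl2_inv_zero_zero, sl2_inv_one_zero, upperUnipotent_one_zero,
          e0, e1]
        ring
      · simp only [sl2_mul_apply, sl2_inv_zero_one, sl2_inv_one_one, upperUnipotent_one_one,
          e0, e1]
        linear_combination hNd
    have h' := H.mul_mem (hU (M 0 1 * N 0 0 - M 0 0 * N 0 1)) hN
    rwa [← this, inv_mul_cancel_right] at h'
  rw [eq_top_iff]
  intro M _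
  by_cases hM : M 1 0 = 0
  · have hM1 : M 1 1 ≠ 0 := by
      intro h1; have := sl2_det M; simp [hM, h1] at this
    exact hrow M _ (hD (Units.mk0 _ hM1)⁻¹) (by simp [hM]) (by simp)
  · refine hrow M _ (H.mul_mem (H.mul_mem (hD (Units.mk0 _ (div_ne_zero hc hM))) hS)
      (hU (((S 1 0 / M 1 0) * M 1 1 - S 1 1) / S 1 0))) ?_ ?_
    · simp only [sl2_mul_apply, diagTorus_one_zero, diagTorus_one_one, Units.val_mk0,
        upperUnipotent_zero_zero, upperUnipotent_one_zero]
      field_simp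
      ring
    · simp only [sl2_mul_apply, diagTorus_one_zero, diagTorus_one_one, Units.val_mk0,
        upperUnipotent_zero_one, upperUnipotent_one_one]
      field_simp
      ring

/-- A subgroup of `SL₂` containing the diagonal torus and an element of trace zero in general
position with respect to it is everything. -/
theorem eq_top_of_diagTorus_mem (hF : 11 < Fintype.card F) (H : Subgroup SL(2, F))
    (hD : ∀ t, diagTorus F t ∈ H) {S : SL(2, F)} (hS : S ∈ H) (htr : S 0 0 + S 1 1 = 0)
    (ha : S 0 0 ≠ 0) (hb : S 0 1 ≠ 0) (hc : S 1 0 ≠ 0) : H = ⊤ := by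
  obtain ⟨h, hh, ⟨h10, h01⟩ | ⟨h10, h01⟩⟩ :=
    exists_triangular_not_diagonal_mem hF H hD hS htr ha hb hc
  · exact eq_top_of_diagTorus_mem_of_upper_mem H hD hS hc hh h10 h01
  · let W : SL(2, F) := sl2Mk 0 1 (-1) 0 (by simp)
    have hmem : ∀ x ∈ H, W * x * W⁻¹ ∈ H.map (MulAut.conj W).toMonoidHom := fun x hx =>
      Subgroup.mem_map.2 ⟨x, hx, rfl⟩
    have key : H.map (MulAut.conj W).toMonoidHom = ⊤ := by
      refine eq_top_of_diagTorus_mem_of_upper_mem _ (fun t => ?_) (hmem S hS) ?_ (hmem h hh) ?_ ?_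
      · have : diagTorus F t = W * diagTorus F t⁻¹ * W⁻¹ := by
          apply sl2_ext <;> simp [sl2_mul_apply, W]
        rw [this]
        exact hmem _ (hD _)
      · simpa [sl2_mul_apply, W] using hb
      · simpa [sl2_mul_apply, W] using h01
      · simpa [sl2_mul_apply, W] using h10
    apply Subgroup.map_injective (f := (MulAut.conj W).toMonoidHom) (MulAut.conj W).injective
    rw [key]
    exact (Subgroup.map_top_of_surjective _ (MulAut.conj W).surjective).symm

/-- An element `S` of trace zero and a generator `g` of a split maximal torus in general position
with respect to `S` generate `SL₂`. -/
theorem closure_pair_eq_top (hF : 11 < Fintype.card F) {S g : SL(2, F)}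
    (htr : S 0 0 + S 1 1 = 0) {t : Fˣ} (ht : ∀ x : Fˣ, x ∈ Subgroup.zpowers t)
    (ht2 : (t : F) ^ 2 ≠ 1) (hg : g 0 0 + g 1 1 = t + (t : F)⁻¹) (hg10 : g 1 0 ≠ 0)
    (h0 : (S * g) 0 0 + (S * g) 1 1 ≠ 0)
    (h1 : ((S * g) 0 0 + (S * g) 1 1) ^ 2 ≠ -((t : F) - (t : F)⁻¹) ^ 2) :
    Subgroup.closure {S, g} = ⊤ := by
  have ht0 : (t : F) ≠ 0 := t.ne_zero
  have hδ : (t : F) - (t : F)⁻¹ ≠ 0 := by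
    intro h; apply ht2; field_simp at h; linear_combination h
  have hdet := sl2_det g
  have hg00 : g 0 0 = t + (t : F)⁻¹ - g 1 1 := by linear_combination hg
  let P : SL(2, F) := sl2Mk (((t : F) - g 1 1) / (g 1 0 * ((t : F) - (t : F)⁻¹)))
    ((t : F)⁻¹ - g 1 1) (g 1 0 / (g 1 0 * ((t : F) - (t : F)⁻¹))) (g 1 0) (by
      field_simp
      ring)
  have hPg : P * diagTorus F t = g * P := by
    have e : g 0 1 * g 1 0 = (t + (t : F)⁻¹ - g 1 1) * g 1 1 - 1 := by
      rw [hg00] at hdet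
      linear_combination -hdet
    have ett : (t : F) * (t : F)⁻¹ = 1 := mul_inv_cancel₀ ht0
    apply sl2_ext
    · simp only [sl2_mul_apply, P, sl2Mk_zero_zero, sl2Mk_zero_one, sl2Mk_one_zero,
        diagTorus_zero_zero, diagTorus_one_zero]
      rw [div_mul_eq_mul_div, mul_zero, add_zero, mul_div_assoc', mul_div_assoc', ← add_div]
      congr 1
      rw [hg00]
      linear_combination -e - ett
    · simp only [sl2_mul_apply, P, sl2Mk_zero_zero, sl2Mk_zero_one, sl2Mk_one_one,
        diagTorus_zero_one, diagTorus_one_one]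
      rw [hg00]
      linear_combination -e - ett
    · simp only [sl2_mul_apply, P, sl2Mk_zero_zero, sl2Mk_one_zero, sl2Mk_one_one,
        diagTorus_zero_zero, diagTorus_one_zero]
      ring
    · simp only [sl2_mul_apply, P, sl2Mk_zero_one, sl2Mk_one_zero, sl2Mk_one_one,
        diagTorus_zero_one, diagTorus_one_one]
      ring
  have hconj : P⁻¹ * g * P = diagTorus F t := by
    rw [mul_assoc, ← hPg, inv_mul_cancel_left]
  set H := Subgroup.closure {S, g}
  have hmem : ∀ x ∈ H, P⁻¹ * x * P ∈ H.map (MulAut.conj P⁻¹).toMonoidHom := fun x hx =>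
    Subgroup.mem_map.2 ⟨x, hx, by simp⟩
  have hSH : S ∈ H := Subgroup.subset_closure (by simp)
  have hgH : g ∈ H := Subgroup.subset_closure (by simp)
  have hS'tr : (P⁻¹ * S * P) 0 0 + (P⁻¹ * S * P) 1 1 = 0 := by rw [sl2_trace_conj, htr]
  have hS'det := sl2_det (P⁻¹ * S * P)
  have hκ : (S * g) 0 0 + (S * g) 1 1 = (P⁻¹ * S * P) 0 0 * ((t : F) - (t : F)⁻¹) := by
    have e : P⁻¹ * (S * g) * P = (P⁻¹ * S * P) * diagTorus F t := by rw [← hconj]; group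
    rw [← sl2_trace_conj P, e, sl2_mul_apply, sl2_mul_apply _ _ 1 1]
    simp only [diagTorus_zero_zero, diagTorus_zero_one, diagTorus_one_zero, diagTorus_one_one]
    linear_combination (t : F)⁻¹ * hS'tr
  rw [hκ] at h0 h1
  set S' := P⁻¹ * S * P with hS'
  have hbc : S' 0 1 * S' 1 0 ≠ 0 := by
    intro h
    apply h1
    have : S' 0 0 ^ 2 = -1 := by linear_combination S' 0 0 * hS'tr - hS'det - h
    rw [mul_pow, this]
    ring
  have key : H.map (MulAut.conj P⁻¹).toMonoidHom = ⊤ := by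
    refine eq_top_of_diagTorus_mem hF _ (fun x => ?_) (hmem S hSH) hS'tr
      (left_ne_zero_of_mul h0) (left_ne_zero_of_mul hbc) (right_ne_zero_of_mul hbc)
    obtain ⟨k, rfl⟩ := ht x
    rw [map_zpow, ← hconj]
    exact Subgroup.zpow_mem _ (hmem g hgH) k
  apply Subgroup.map_injective (f := (MulAut.conj P⁻¹).toMonoidHom) (MulAut.conj P⁻¹).injective
  rw [key]
  exact (Subgroup.map_top_of_surjective _ (MulAut.conj P⁻¹).surjective).symm

end SpecialLinear

section Conjugation
variable {G : Type*} [Group G]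

theorem closure_pair_conj_eq_top {s g : G} (p : G) (h : Subgroup.closure {p⁻¹ * s * p, g} = ⊤) :
    Subgroup.closure {s, p * g * p⁻¹} = ⊤ := by
  have e : (Subgroup.closure {p⁻¹ * s * p, g}).map (MulAut.conj p).toMonoidHom = ⊤ := by
    rw [h]
    exact Subgroup.map_top_of_surjective _ (MulAut.conj p).surjective
  rw [MonoidHom.map_closure, Set.image_pair] at e
  simpa [mul_assoc] using e

theorem ncard_generating_conj_le [Finite G] (s p : G) :
    {g : G | Subgroup.closure {p⁻¹ * s * p, g} = ⊤}.ncard ≤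
      {g : G | Subgroup.closure {s, g} = ⊤}.ncard :=
  Set.ncard_le_ncard_of_injOn (fun g => p * g * p⁻¹)
    (fun _ hg => closure_pair_conj_eq_top p hg)
    (fun _ _ _ _ h => (MulAut.conj p).injective h)

end Conjugation

theorem pow_ne_one_of_forall_mem_zpowers {G : Type*} [Group G] [Finite G] {t : G}
    (ht : ∀ x, x ∈ Subgroup.zpowers t) {k : ℕ} (hk : k ≠ 0) (hk' : k < Nat.card G) :
    t ^ k ≠ 1 := by
  intro h
  have := Nat.le_of_dvd (Nat.pos_of_ne_zero hk) (orderOf_dvd_of_pow_eq_one h)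
  rw [orderOf_eq_card_of_forall_mem_zpowers ht] at this
  omega

theorem card_sub_le_card_filter {α : Type*} [Fintype α] [DecidableEq α] (p : α → Prop)
    [DecidablePred p] {B : Finset α} (h : ∀ a, ¬p a → a ∈ B) {k : ℕ} (hk : B.card ≤ k) :
    Fintype.card α - k ≤ (Finset.univ.filter p).card := by
  have h1 : (Finset.univ.filter fun a => ¬p a).card ≤ B.card :=
    Finset.card_le_card fun a ha => h a (Finset.mem_filter.1 ha).2
  have h2 := Finset.card_filter_add_card_filter_not (s := (Finset.univ : Finset α)) p
  rw [Finset.card_univ] at h2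
  omega

section Projective
open scoped MatrixGroups
variable {F : Type*} [Field F]

/-- The projection from `SL₂` to `PSL₂`. -/
def toPSL (F : Type*) [Field F] : SL(2, F) →* PSL(2, F) :=
  QuotientGroup.mk' (Subgroup.center SL(2, F))

theorem toPSL_surjective : Function.Surjective (toPSL F) :=
  QuotientGroup.mk'_surjective _

theorem toPSL_eq_iff {g h : SL(2, F)} :
    toPSL F g = toPSL F h ↔ ∃ r : F, r ^ 2 = 1 ∧ ∀ i j, h i j = r * g i j := by
  have : toPSL F g = toPSL F h ↔ g⁻¹ * h ∈ Subgroup.center SL(2, F) := QuotientGroup.eq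
  rw [this, Matrix.SpecialLinearGroup.mem_center_iff]
  simp only [Fintype.card_fin]
  refine exists_congr fun r => and_congr_right fun _ => ⟨fun hr i j => ?_, fun hr => ?_⟩
  · have e : h = g * (g⁻¹ * h) := by group
    rw [e, Matrix.SpecialLinearGroup.coe_mul, ← hr]
    simp [mul_comm]
  · have hdet := sl2_det g
    ext i j
    fin_cases i <;> fin_cases j
    · simp [sl2_mul_apply, hr]
      linear_combination -r * hdet
    · simp [sl2_mul_apply, hr]
      ring
    · simp [sl2_mul_apply, hr]
      ring
    · simp [sl2_mul_apply, hr]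
      linear_combination -r * hdet

theorem trace_eq_zero_of_toPSL_sq {S : SL(2, F)} (h2 : toPSL F S ^ 2 = 1) (h1 : toPSL F S ≠ 1) :
    S 0 0 + S 1 1 = 0 := by
  by_contra hne
  rw [← map_pow, ← map_one (toPSL F), eq_comm, toPSL_eq_iff] at h2
  obtain ⟨r, -, hr⟩ := h2
  have e00 := hr 0 0
  have e01 := hr 0 1
  have e10 := hr 1 0
  have e11 := hr 1 1
  simp only [pow_two, sl2_mul_apply, Matrix.SpecialLinearGroup.coe_one, one_apply_eq, ne_eq,
    zero_ne_one, one_ne_zero, not_false_eq_true, one_apply_ne, mul_zero, mul_one] at e00 e01 e10 e11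
  have h01 : S 0 1 = 0 :=
    (mul_eq_zero.1 (by linear_combination e01 : S 0 1 * (S 0 0 + S 1 1) = 0)).resolve_right hne
  have h10 : S 1 0 = 0 :=
    (mul_eq_zero.1 (by linear_combination e10 : S 1 0 * (S 0 0 + S 1 1) = 0)).resolve_right hne
  have hd : S 0 0 - S 1 1 = 0 :=
    (mul_eq_zero.1 (by linear_combination e00 - e11 :
      (S 0 0 - S 1 1) * (S 0 0 + S 1 1) = 0)).resolve_right hne
  have hdet := sl2_det S
  apply h1
  rw [← map_one (toPSL F), eq_comm, toPSL_eq_iff]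
  refine ⟨S 0 0, by linear_combination hdet + S 0 0 * hd + S 0 1 * h10, fun i j => ?_⟩
  fin_cases i <;> fin_cases j <;> simp [h01, h10]
  linear_combination -hd

/-- The element of `SL₂` with trace `τ`, upper left entry `x` and lower left entry `z`. -/
def traceElt (τ x : F) (z : Fˣ) : SL(2, F) :=
  sl2Mk x ((x * (τ - x) - 1) / z) z (τ - x) (by field_simp; ring)

theorem trace_mul_traceElt (S : SL(2, F)) (τ x : F) (z : Fˣ) :
    (S * traceElt τ x z) 0 0 + (S * traceElt τ x z) 1 1 =
      S 0 0 * x + S 0 1 * z + (S 1 0 * ((x * (τ - x) - 1) / z) + S 1 1 * (τ - x)) := by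
  simp [sl2_mul_apply, traceElt]

theorem exists_conj_upper {S : SL(2, F)} (htr : S 0 0 + S 1 1 = 0) (hi : IsSquare (-1 : F)) :
    ∃ P : SL(2, F), (P⁻¹ * S * P) 1 0 = 0 := by
  by_cases h10 : S 1 0 = 0
  · exact ⟨1, by simpa using h10⟩
  obtain ⟨i, hi⟩ := hi
  have hdet := sl2_det S
  refine ⟨sl2Mk ((S 0 0 + i) / S 1 0) (-1) 1 0 (by ring), ?_⟩
  simp [sl2_mul_apply]
  field_simp
  grind

theorem ncard_involutions_le [Finite F] :
    {t : PSL(2, F) | t ^ 2 = 1 ∧ t ≠ 1}.ncard ≤ {M : SL(2, F) | M 0 0 + M 1 1 = 0}.ncard := by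
  refine (Set.ncard_le_ncard (t := toPSL F '' {M | M 0 0 + M 1 1 = 0}) ?_).trans
    (Set.ncard_image_le)
  rintro t ⟨h2, h1⟩
  obtain ⟨M, rfl⟩ := toPSL_surjective t
  exact ⟨M, trace_eq_zero_of_toPSL_sq h2 h1, rfl⟩

theorem two_mul_ncard_involutions_le [Finite F] (h2 : (2 : F) ≠ 0) :
    2 * {t : PSL(2, F) | t ^ 2 = 1 ∧ t ≠ 1}.ncard ≤ {M : SL(2, F) | M 0 0 + M 1 1 = 0}.ncard := by
  let ε : SL(2, F) := sl2Mk (-1) 0 0 (-1) (by ring)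
  have hε : toPSL F ε = 1 := by
    rw [← map_one (toPSL F), toPSL_eq_iff]
    refine ⟨-1, by ring, fun i j => ?_⟩
    fin_cases i <;> fin_cases j <;> simp [ε]
  have hε1 : ε ≠ 1 := by
    intro h
    have : (-1 : F) = 1 := by simpa [ε] using congrArg (fun M : SL(2, F) => M 0 0) h
    exact h2 (by linear_combination -this)
  obtain ⟨σ, hσ⟩ := toPSL_surjective (F := F).hasRightInverse
  have hval : ∀ (t : PSL(2, F)) (b : Bool), toPSL F (σ t * cond b ε 1) = t := by
    rintro t (_ | _) <;> simp [hσ t, hε]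
  have hcard : 2 * {t : PSL(2, F) | t ^ 2 = 1 ∧ t ≠ 1}.ncard =
      ({t : PSL(2, F) | t ^ 2 = 1 ∧ t ≠ 1} ×ˢ (Set.univ : Set Bool)).ncard := by
    rw [Set.ncard_prod, Set.ncard_univ, Nat.card_eq_fintype_card, Fintype.card_bool, mul_comm]
  rw [hcard]
  refine Set.ncard_le_ncard_of_injOn (fun p => σ p.1 * cond p.2 ε 1) ?_ ?_
  · rintro ⟨t, b⟩ ⟨⟨ht2, ht1⟩, -⟩
    rw [← hval t b] at ht2 ht1
    exact trace_eq_zero_of_toPSL_sq ht2 ht1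
  · rintro ⟨t, b⟩ - ⟨t', b'⟩ - h
    have ht : t = t' := by rw [← hval t b, ← hval t' b']; exact congrArg _ h
    subst ht
    have h := mul_left_cancel h
    cases b <;> cases b'
    · rfl
    · exact absurd h.symm hε1
    · exact absurd h hε1
    · rfl

theorem le_ncard_generating_of_conj [Finite F] {S : SL(2, F)} (P : SL(2, F)) {m : ℕ}
    (h : m ≤ {g : PSL(2, F) | Subgroup.closure {toPSL F (P⁻¹ * S * P), g} = ⊤}.ncard) :
    m ≤ {g : PSL(2, F) | Subgroup.closure {toPSL F S, g} = ⊤}.ncard := by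
  rw [map_mul, map_mul, map_inv] at h
  exact h.trans (ncard_generating_conj_le _ _)

variable [Fintype F] [DecidableEq F]

/-- The parameters of the elements of trace `t + t⁻¹` in general position with respect to `S`. -/
def genericParams (S : SL(2, F)) (t : Fˣ) : Finset (F × Fˣ) :=
  Finset.univ.filter fun p =>
    (S * traceElt (t + (t : F)⁻¹) p.1 p.2) 0 0 + (S * traceElt (t + (t : F)⁻¹) p.1 p.2) 1 1 ≠ 0 ∧
    ((S * traceElt (t + (t : F)⁻¹) p.1 p.2) 0 0 +
      (S * traceElt (t + (t : F)⁻¹) p.1 p.2) 1 1) ^ 2 ≠ -((t : F) - (t : F)⁻¹) ^ 2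

theorem card_units_add_one : Nat.card Fˣ + 1 = Fintype.card F := by
  rw [Nat.card_eq_fintype_card, Fintype.card_units]
  have := Fintype.card_pos (α := F)
  omega

theorem card_mul_le_ncard_generating (hF : 11 < Fintype.card F) {S : SL(2, F)}
    (htr : S 0 0 + S 1 1 = 0) (T : Finset Fˣ) (hT : ∀ t ∈ T, ∀ x, x ∈ Subgroup.zpowers t)
    (hinj : ∀ t ∈ T, ∀ t' ∈ T, ∀ r : F, r ^ 2 = 1 →
      (t' : F) + (t' : F)⁻¹ = r * (t + (t : F)⁻¹) → r = 1 ∧ t = t')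
    {m : ℕ} (hm : ∀ t ∈ T, m ≤ (genericParams S t).card) :
    T.card * m ≤ {g : PSL(2, F) | Subgroup.closure {toPSL F S, g} = ⊤}.ncard := by
  have hcard := card_units_add_one (F := F)
  have : Finite (PSL(2, F)) := Finite.of_surjective _ toPSL_surjective
  have h1 : T.card * m ≤ (T.sigma fun t => genericParams S t).card := by
    rw [Finset.card_sigma, ← smul_eq_mul]
    exact Finset.card_nsmul_le_sum _ _ _ hm
  rw [← Set.ncard_coe_finset (T.sigma fun t => genericParams S t)] at h1
  refine h1.trans (Set.ncard_le_ncard_of_injOn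
    (fun p : (_ : Fˣ) × (F × Fˣ) => toPSL F (traceElt (p.1 + (p.1 : F)⁻¹) p.2.1 p.2.2)) ?_ ?_
    (Set.toFinite _))
  · rintro ⟨t, x, z⟩ hp
    simp only [Finset.coe_sigma, Set.mem_sigma_iff, Finset.mem_coe, genericParams,
      Finset.mem_filter, Finset.mem_univ, true_and] at hp
    obtain ⟨htT, h0, h1⟩ := hp
    have ht2 : (t : F) ^ 2 ≠ 1 := fun h => pow_ne_one_of_forall_mem_zpowers (hT t htT)
      two_ne_zero (by omega) (Units.ext (by simpa using h))
    have := closure_pair_eq_top hF htr (hT t htT) ht2 (by simp [traceElt]) (by simp [traceElt])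
      h0 h1
    have h2 : (Subgroup.closure {S, traceElt (t + (t : F)⁻¹) x z}).map (toPSL F) = ⊤ := by
      rw [this]
      exact Subgroup.map_top_of_surjective _ toPSL_surjective
    rwa [MonoidHom.map_closure, Set.image_pair] at h2
  · rintro ⟨t, x, z⟩ hp ⟨t', x', z'⟩ hp' h
    simp only [Finset.coe_sigma, Set.mem_sigma_iff, Finset.mem_coe] at hp hp'
    obtain ⟨r, hr, h⟩ := toPSL_eq_iff.1 h
    have e00 := h 0 0
    have e10 := h 1 0
    have e11 := h 1 1
    simp only [traceElt, sl2Mk_zero_zero, sl2Mk_one_zero, sl2Mk_one_one] at e00 e10 e11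
    obtain ⟨rfl, rfl⟩ := hinj t hp.1 t' hp'.1 r hr (by linear_combination e00 + e11)
    rw [one_mul] at e00 e10
    subst e00
    obtain rfl := Units.ext e10
    rfl

theorem mul_card_sub_le_card_filter_prod {α β : Type*} [Fintype α] [Fintype β]
    (p : α × β → Prop) [DecidablePred p] {k : ℕ}
    (h : ∀ a, Fintype.card β - k ≤ (Finset.univ.filter fun b => p (a, b)).card) :
    Fintype.card α * (Fintype.card β - k) ≤ (Finset.univ.filter p).card := by
  rw [Finset.card_filter, Fintype.sum_prod_type, ← Finset.card_univ, ← smul_eq_mul]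
  refine Finset.card_nsmul_le_sum _ _ _ fun a _ => ?_
  rw [← Finset.card_filter]
  exact h a

theorem mul_card_sub_le_card_filter_prod_right {α β : Type*} [Fintype α] [Fintype β]
    (p : α × β → Prop) [DecidablePred p] {k : ℕ}
    (h : ∀ b, Fintype.card α - k ≤ (Finset.univ.filter fun a => p (a, b)).card) :
    Fintype.card β * (Fintype.card α - k) ≤ (Finset.univ.filter p).card := by
  rw [Finset.card_filter, Fintype.sum_prod_type_right, ← Finset.card_univ (α := β), ← smul_eq_mul]
  refine Finset.card_nsmul_le_sum _ _ _ fun b _ => ?_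
  rw [← Finset.card_filter]
  exact h b

theorem card_units_quadratic_roots_le {a : F} (ha : a ≠ 0) (b c : F) :
    (Finset.univ.filter fun z : Fˣ => a * (z : F) ^ 2 + b * z + c = 0).card ≤ 2 :=
  (Finset.card_le_card_of_injOn (fun z : Fˣ => (z : F)) (fun z hz => by simpa using hz)
    Units.val_injective.injOn).trans (card_quadratic_roots_le ha b c)

theorem le_card_genericParams_of_not_isSquare {S : SL(2, F)} (htr : S 0 0 + S 1 1 = 0)
    (hi : ¬IsSquare (-1 : F)) (t : Fˣ) :
    Fintype.card F * (Fintype.card Fˣ - 2) ≤ (genericParams S t).card := by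
  have hdet := sl2_det S
  have h11 : S 1 1 = -S 0 0 := by linear_combination htr
  rw [h11] at hdet
  have h01 : S 0 1 ≠ 0 := fun h => hi ⟨S 0 0, by linear_combination hdet + S 1 0 * h⟩
  refine mul_card_sub_le_card_filter_prod _ fun x => card_sub_le_card_filter _ ?_
    (card_units_quadratic_roots_le h01 (S 0 0 * (2 * x - (t + (t : F)⁻¹)))
      (S 1 0 * (x * (t + (t : F)⁻¹ - x) - 1)))
  intro z hz
  have hz0 : (z : F) ≠ 0 := z.ne_zero
  simp only [Finset.mem_filter, Finset.mem_univ, true_and]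
  by_contra hne
  refine hz ⟨fun h => hne ?_, fun h => ?_⟩
  · rw [trace_mul_traceElt, h11] at h
    field_simp at h
    field_simp
    linear_combination h
  · by_cases hδ : (t : F) - (t : F)⁻¹ = 0
    · rw [hδ] at h
      rw [trace_mul_traceElt, h11] at h
      apply hne
      have h := pow_eq_zero_iff (two_ne_zero) |>.1 (h.trans (by ring : -(0 : F) ^ 2 = 0))
      field_simp at h
      field_simp
      linear_combination h
    · have key : ∀ a b : F, b ≠ 0 → a ^ 2 = -b ^ 2 → IsSquare (-1 : F) := fun a b hb hab =>
        ⟨a / b, by rw [div_mul_div_comm, ← pow_two, ← pow_two, hab]; field_simp⟩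
      exact hi (key _ _ hδ h)

theorem le_card_genericParams_of_upper {S : SL(2, F)} (htr : S 0 0 + S 1 1 = 0)
    (h10 : S 1 0 = 0) (h2 : (2 : F) ≠ 0) (t : Fˣ) :
    Fintype.card Fˣ * (Fintype.card F - 3) ≤ (genericParams S t).card := by
  have hdet := sl2_det S
  have h11 : S 1 1 = -S 0 0 := by linear_combination htr
  rw [h11, h10] at hdet
  have h00 : S 0 0 ≠ 0 := by rintro h; simp [h] at hdet
  refine mul_card_sub_le_card_filter_prod_right _ fun z => card_sub_le_card_filter _
    (B := ({0, S 0 0 * (t - (t : F)⁻¹), -(S 0 0 * (t - (t : F)⁻¹))} : Finset F).image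
      fun k => (k - S 0 1 * z + S 0 0 * (t + (t : F)⁻¹)) / (2 * S 0 0)) ?_
    (Finset.card_image_le.trans Finset.card_le_three)
  intro x hx
  rw [Finset.mem_image]
  refine ⟨S 0 0 * (2 * x - (t + (t : F)⁻¹)) + S 0 1 * z, ?_, by field_simp; ring⟩
  rw [trace_mul_traceElt, h10, h11] at hx
  simp only [Finset.mem_insert, Finset.mem_singleton]
  by_contra hne
  push Not at hne
  refine hx ⟨fun h => hne.1 (by linear_combination h), fun h => ?_⟩
  rcases mul_eq_zero.1 (show (S 0 0 * (2 * x - (t + (t : F)⁻¹)) + S 0 1 * z -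
    S 0 0 * (t - (t : F)⁻¹)) * (S 0 0 * (2 * x - (t + (t : F)⁻¹)) + S 0 1 * z +
    S 0 0 * (t - (t : F)⁻¹)) = 0 by
      linear_combination h + (t - (t : F)⁻¹) ^ 2 * hdet) with h | h
  · exact hne.2.1 (by linear_combination h)
  · exact hne.2.2 (by linear_combination h)

theorem le_card_genericParams_of_upper_of_two_eq_zero {S : SL(2, F)} (htr : S 0 0 + S 1 1 = 0)
    (h10 : S 1 0 = 0) (h01 : S 0 1 ≠ 0) (h2 : (2 : F) = 0) (t : Fˣ) :
    Fintype.card F * (Fintype.card Fˣ - 1) ≤ (genericParams S t).card := by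
  have hdet := sl2_det S
  have h11 : S 1 1 = -S 0 0 := by linear_combination htr
  rw [h11, h10] at hdet
  have h00 : S 0 0 = 1 := by
    have : (S 0 0 - 1) ^ 2 = 0 := by linear_combination -hdet - S 0 0 * h2
    exact sub_eq_zero.1 (pow_eq_zero_iff two_ne_zero |>.1 this)
  refine mul_card_sub_le_card_filter_prod _ fun x => card_sub_le_card_filter _
    (B := Finset.univ.filter fun z : Fˣ => S 0 1 * (z : F) = t + (t : F)⁻¹) ?_ ?_
  · intro z hz
    rw [trace_mul_traceElt, h10, h11, h00] at hz
    simp only [Finset.mem_filter, Finset.mem_univ, true_and]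
    by_contra hne
    refine hz ⟨fun h => hne ?_, fun h => ?_⟩
    · linear_combination h - x * h2
    · have : (S 0 1 * z) ^ 2 = 0 := by
        linear_combination h + h2 * (S 0 1 * z * (t + (t : F)⁻¹ - 2 * x) + 2 * t * x - t ^ 2 +
          2 * (t : F)⁻¹ * x - (t : F)⁻¹ ^ 2 - 2 * x ^ 2)
      simp [h01] at this
  · refine Finset.card_le_one.2 fun z hz z' hz' => ?_
    simp only [Finset.mem_filter, Finset.mem_univ, true_and] at hz hz'
    exact Units.ext (mul_left_cancel₀ h01 (hz.trans hz'.symm))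

theorem ncard_trace_eq_zero_le {k : ℕ}
    (hk : (Finset.univ.filter fun a : F => a ^ 2 + 1 = 0).card ≤ k) :
    {M : SL(2, F) | M 0 0 + M 1 1 = 0}.ncard ≤
      Fintype.card F * (Fintype.card F - 1) + Fintype.card F * k := by
  have hsub : {M : SL(2, F) | M 0 0 + M 1 1 = 0} ⊆
      {M : SL(2, F) | M 0 0 + M 1 1 = 0 ∧ M 0 1 ≠ 0} ∪
        {M : SL(2, F) | M 0 0 + M 1 1 = 0 ∧ M 0 1 = 0} := fun M hM =>
    (ne_or_eq (M 0 1) 0).imp (⟨hM, ·⟩) (⟨hM, ·⟩)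
  refine (Set.ncard_le_ncard hsub).trans ((Set.ncard_union_le _ _).trans (add_le_add ?_ ?_))
  · have hcard : (Finset.univ ×ˢ Finset.univ.erase 0 : Finset (F × F)).card =
        Fintype.card F * (Fintype.card F - 1) := by
      rw [Finset.card_product, Finset.card_erase_of_mem (Finset.mem_univ _), Finset.card_univ]
    rw [← hcard, ← Set.ncard_coe_finset]
    refine Set.ncard_le_ncard_of_injOn (fun M => (M 0 0, M 0 1)) ?_ ?_
    · rintro M ⟨-, hM⟩
      simpa using hM
    · rintro M ⟨hM, hM0⟩ N ⟨hN, -⟩ h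
      obtain ⟨h00, h01⟩ := Prod.ext_iff.1 h
      dsimp only at h00 h01
      have hdM := sl2_det M
      have hdN := sl2_det N
      have h11 : M 1 1 = N 1 1 := by linear_combination hM - hN - h00
      rw [← h00, ← h01, ← h11] at hdN
      exact sl2_ext h00 h01 (mul_left_cancel₀ hM0 (by linear_combination hdN - hdM)) h11
  · have hcard : ((Finset.univ : Finset F) ×ˢ Finset.univ.filter fun a : F => a ^ 2 + 1 = 0).card ≤
        Fintype.card F * k := by
      rw [Finset.card_product, Finset.card_univ]
      exact Nat.mul_le_mul_left _ hk
    refine le_trans ?_ hcard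
    rw [← Set.ncard_coe_finset]
    refine Set.ncard_le_ncard_of_injOn (fun M => (M 1 0, M 0 0)) ?_ ?_
    · rintro M ⟨hM, hM0⟩
      have hdM := sl2_det M
      simp
      linear_combination M 0 0 * hM - hdM - M 1 0 * hM0
    · rintro M ⟨hM, hM0⟩ N ⟨hN, hN0⟩ h
      obtain ⟨h10, h00⟩ := Prod.ext_iff.1 h
      exact sl2_ext h00 (hM0.trans hN0.symm) h10 (by linear_combination hM - hN - h00)

theorem two_mul_le_ncard_generating {S : SL(2, F)} (hF : 11 < Fintype.card F)
    (htr : S 0 0 + S 1 1 = 0) (h2 : (2 : F) = 0) {m : ℕ}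
    (hm : ∀ t, m ≤ (genericParams S t).card) :
    2 * m ≤ {g : PSL(2, F) | Subgroup.closure {toPSL F S, g} = ⊤}.ncard := by
  have hcard := card_units_add_one (F := F)
  obtain ⟨t, ht⟩ := IsCyclic.exists_generator (α := Fˣ)
  have hpow : ∀ k : ℕ, k ≠ 0 → k < 11 → t ^ k ≠ 1 := fun k hk hk' =>
    pow_ne_one_of_forall_mem_zpowers ht hk (by omega)
  have hone : ∀ r : F, r ^ 2 = 1 → r = 1 := fun r hr => by
    have : (r - 1) ^ 2 = 0 := by linear_combination hr + (1 - r) * h2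
    exact sub_eq_zero.1 (pow_eq_zero_iff two_ne_zero |>.1 this)
  have ht2 : ∀ x, x ∈ Subgroup.zpowers (t ^ 2) := by
    intro x
    obtain ⟨y, hy⟩ := FiniteField.isSquare_of_char_two (CharP.ringChar_of_prime_eq_zero
      Nat.prime_two (by exact_mod_cast h2)) (x : F)
    have hy0 : y ≠ 0 := by rintro rfl; simp at hy
    obtain ⟨n, hn⟩ := Subgroup.mem_zpowers_iff.1 (ht (Units.mk0 y hy0))
    refine Subgroup.mem_zpowers_iff.2 ⟨n, ?_⟩
    rw [← zpow_natCast, zpow_comm, hn]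
    exact Units.ext (by simpa [pow_two] using hy.symm)
  have hτ : (t : F) + (t : F)⁻¹ ≠ (t : F) ^ 2 + ((t : F) ^ 2)⁻¹ := by
    intro h
    have h0 : (t : F) ≠ 0 := t.ne_zero
    have h1 : ((t : F) ^ 2 + 1) * ((t : F) ^ 2 - t + 1) = 0 := by
      field_simp at h
      linear_combination -h + (t : F) ^ 2 * h2
    rcases mul_eq_zero.1 h1 with h | h
    · refine hpow 4 (by norm_num) (by norm_num) (Units.ext ?_)
      push_cast
      linear_combination ((t : F) ^ 2 - 1) * h
    · refine hpow 6 (by norm_num) (by norm_num) (Units.ext ?_)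
      push_cast
      linear_combination ((t : F) ^ 3 - 1) * (t + 1) * h
  have hne : t ≠ t ^ 2 := fun h => hτ (by rw [← Units.val_pow_eq_pow_val, ← h])
  have := card_mul_le_ncard_generating hF htr {t, t ^ 2} (by simp [ht, ht2]) ?_ (fun t _ => hm t)
  · rwa [Finset.card_pair hne] at this
  · intro u hu v hv r hr h
    rw [hone r hr, one_mul] at h
    refine ⟨hone r hr, ?_⟩
    simp only [Finset.mem_insert, Finset.mem_singleton] at hu hv
    rcases hu with rfl | rfl <;> rcases hv with rfl | rfl
    · rfl
    · exact absurd h.symm (by simpa using hτ)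
    · exact absurd h (by simpa using hτ)
    · rfl

theorem le_ncard_generating {S : SL(2, F)} (hF : 11 < Fintype.card F)
    (htr : S 0 0 + S 1 1 = 0) {m : ℕ} (hm : ∀ t, m ≤ (genericParams S t).card) :
    m ≤ {g : PSL(2, F) | Subgroup.closure {toPSL F S, g} = ⊤}.ncard := by
  have hcard := card_units_add_one (F := F)
  obtain ⟨t, ht⟩ := IsCyclic.exists_generator (α := Fˣ)
  have hτ : (t : F) + (t : F)⁻¹ ≠ 0 := by
    intro h
    have h4 : (t : F) ^ 4 = 1 := by
      have h0 : (t : F) ≠ 0 := t.ne_zero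
      field_simp at h
      linear_combination ((t : F) ^ 2 - 1) * h
    exact pow_ne_one_of_forall_mem_zpowers ht four_ne_zero (by omega)
      (Units.ext (by simpa using h4))
  have := card_mul_le_ncard_generating hF htr {t} (by simpa using ht) ?_ (fun t _ => hm t)
  · simpa using this
  · intro u hu v hv r hr h
    obtain rfl := Finset.mem_singleton.1 hu
    obtain rfl := Finset.mem_singleton.1 hv
    exact ⟨(mul_right_cancel₀ hτ ((one_mul _).trans h)).symm, rfl⟩

/-- In `PSL(2, q)` with `q > 11`, every involution forms a generating pair with more elements than
there are involutions. -/
theorem ncard_involutions_lt_ncard_generating (hF : 11 < Fintype.card F) {s : PSL(2, F)}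
    (hs2 : s ^ 2 = 1) (hs1 : s ≠ 1) :
    {t : PSL(2, F) | t ^ 2 = 1 ∧ t ≠ 1}.ncard <
      {g : PSL(2, F) | Subgroup.closure {s, g} = ⊤}.ncard := by
  obtain ⟨S, rfl⟩ := toPSL_surjective s
  have htr := trace_eq_zero_of_toPSL_sq hs2 hs1
  have hu : Fintype.card Fˣ = Fintype.card F - 1 := Fintype.card_units F
  have htrP : ∀ P : SL(2, F), (P⁻¹ * S * P) 0 0 + (P⁻¹ * S * P) 1 1 = 0 := fun P => by
    rw [sl2_trace_conj, htr]
  obtain ⟨n, hn⟩ : ∃ n, Fintype.card F = n + 12 := Nat.exists_eq_add_of_le' hF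
  by_cases h2 : (2 : F) = 0
  · obtain ⟨P, hP⟩ := exists_conj_upper htr ⟨1, by linear_combination -h2⟩
    have hP01 : (P⁻¹ * S * P) 0 1 ≠ 0 := by
      intro h01
      have hdet := sl2_det (P⁻¹ * S * P)
      have h00 : ((P⁻¹ * S * P) 0 0 - 1) ^ 2 = 0 := by
        linear_combination (P⁻¹ * S * P) 0 0 * htrP P - hdet - (P⁻¹ * S * P) 1 0 * h01 -
          (P⁻¹ * S * P) 0 0 * h2
      have h00 := sub_eq_zero.1 (pow_eq_zero_iff two_ne_zero |>.1 h00)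
      have h1 : P⁻¹ * S * P = 1 := sl2_ext h00 h01 hP
        (by simp only [Matrix.SpecialLinearGroup.coe_one, one_apply_eq]
            linear_combination htrP P - h00 - h2)
      have : S = 1 := by
        rw [mul_eq_one_iff_eq_inv, inv_mul_eq_iff_eq_mul, mul_inv_cancel] at h1
        exact h1
      exact hs1 (by rw [this, map_one])
    have hlow := le_ncard_generating_of_conj P (two_mul_le_ncard_generating hF (htrP P) h2
      (le_card_genericParams_of_upper_of_two_eq_zero (htrP P) hP hP01 h2))
    refine lt_of_lt_of_le ?_ hlow
    have hup := ncard_involutions_le.trans (ncard_trace_eq_zero_le (F := F) (k := 1) ?_)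
    · refine hup.trans_lt ?_
      rw [hu, hn]
      simp only [Nat.reduceSubDiff]
      nlinarith
    · refine Finset.card_le_one.2 fun a ha b hb => ?_
      simp only [Finset.mem_filter, Finset.mem_univ, true_and] at ha hb
      have : (a - b) ^ 2 = 0 := by linear_combination ha + hb - (1 + a * b) * h2
      exact sub_eq_zero.1 (pow_eq_zero_iff two_ne_zero |>.1 this)
  · have hlow : (Fintype.card F - 1) * (Fintype.card F - 3) ≤
        {g : PSL(2, F) | Subgroup.closure {toPSL F S, g} = ⊤}.ncard := by
      by_cases hi : IsSquare (-1 : F)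
      · obtain ⟨P, hP⟩ := exists_conj_upper htr hi
        rw [← hu]
        exact le_ncard_generating_of_conj P (le_ncard_generating hF (htrP P)
          (le_card_genericParams_of_upper (htrP P) hP h2))
      · refine le_trans ?_ (le_ncard_generating hF htr
          (le_card_genericParams_of_not_isSquare htr hi))
        rw [hu, Nat.sub_sub]
        exact Nat.mul_le_mul_right _ (Nat.sub_le _ _)
    have hup := (two_mul_ncard_involutions_le h2).trans (ncard_trace_eq_zero_le (F := F) (k := 2) (by
      simpa using card_quadratic_roots_le (one_ne_zero (α := F)) 0 1))
    rw [hn] at hlow hup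
    simp only [Nat.reduceSubDiff] at hlow hup
    nlinarith

end Projective

/-- for a prime power `q > 11`, every involution `s` in
`G = PSL(2,q)` has generating-graph vertex degree greater than the number of
involutions of `G`: `|{g : ⟨s,g⟩ = G}| > |{t : t² = 1, t ≠ 1}|`. -/
theorem stmt_18 (p f : ℕ) [Fact p.Prime] (hf : f ≠ 0)
    (q : ℕ) (hq : q = p ^ f) (hq11 : 11 < q)
    (s : ProjectiveSpecialLinearGroup (Fin 2) (GaloisField p f))
    (hs : orderOf s = 2) :
    {g : ProjectiveSpecialLinearGroup (Fin 2) (GaloisField p f) |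
        Subgroup.closure {s, g} = ⊤}.ncard >
      {t : ProjectiveSpecialLinearGroup (Fin 2) (GaloisField p f) |
        t ^ 2 = 1 ∧ t ≠ 1}.ncard := by
  classical
  have := Fintype.ofFinite (GaloisField p f)
  refine ncard_involutions_lt_ncard_generating ?_ (orderOf_dvd_iff_pow_eq_one.1 hs.dvd) ?_
  · rwa [← Nat.card_eq_fintype_card, GaloisField.card p f hf, ← hq]
  · rintro rfl
    simp at hs
end

section
/- Let q be a prime power with φ((q+1)/gcd(q−1,2)) ≥ 12, and let G = PSL(2,q). Then every element s of G of order 3, 4, or 5 has vertex degree in the generating graph greater than the total number of elements of G of order between 2 and 5; that is, |{g ∈ G : ⟨s,g⟩ = G}| > Σ_{m=2}^{5} |{t ∈ G : ord(t) = m}|. -/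
open Matrix

section Counting

open MulAction

variable {G X : Type*} [Group G] [MulAction G X]

lemma ncard_orbit_mul_eq_index (Z : Subgroup G) (hZ : ∀ g ∈ Z, ∀ x : X, g • x = x) (x : X) :
    (orbit G x).ncard * Z.relIndex (stabilizer G x) = Z.index := by
  have hle : Z ≤ stabilizer G x := fun g hg => hZ g hg x
  rw [← index_stabilizer, mul_comm, Subgroup.relIndex_mul_index hle]

variable [Finite G]

/-- Orbit counting, for a group whose elements outside a subgroup `Z` acting trivially fix exactly
two points. -/
lemma card_add_two_mul_index_eq [Finite X] (Z : Subgroup G) (hZ : ∀ g ∈ Z, ∀ x : X, g • x = x)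
    (hfix : ∀ g ∉ Z, (fixedBy X g).ncard = 2) :
    Nat.card X + 2 * Z.index = Nat.card (orbitRel.Quotient G X) * Z.index + 2 := by
  classical
  have := Fintype.ofFinite G
  have := Fintype.ofFinite X
  have h1 := sum_card_fixedBy_eq_card_orbits_mul_card_group G X
  have h2 : ∀ g : G, Fintype.card (fixedBy X g) = if g ∈ Z then Nat.card X else 2 := by
    intro g
    rw [← Nat.card_eq_fintype_card, Nat.card_coe_set_eq]
    split_ifs with h
    · have : fixedBy X g = Set.univ := by ext x; simpa using hZ g h x
      rw [this, Set.ncard_univ]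
    · exact hfix g h
  simp only [h2] at h1
  rw [Finset.sum_ite] at h1
  simp only [Finset.sum_const, smul_eq_mul] at h1
  have h3 : (Finset.univ.filter fun g : G => g ∈ Z).card = Nat.card Z := by
    rw [Nat.card_eq_fintype_card, Fintype.card_subtype]
  have h4 := Finset.card_filter_add_card_filter_not (s := (Finset.univ : Finset G)) (fun g => g ∈ Z)
  rw [h3, Finset.card_univ, ← Nat.card_eq_fintype_card, ← Z.card_mul_index] at h4
  rw [h3, ← Nat.card_eq_fintype_card, ← Nat.card_eq_fintype_card (α := G),
    ← Z.card_mul_index] at h1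
  have hpos : 0 < Nat.card Z := Nat.card_pos
  have h5 : Nat.card (Quotient (orbitRel G X)) = Nat.card (orbitRel.Quotient G X) := rfl
  rw [h5] at h1
  refine Nat.eq_of_mul_eq_mul_left hpos ?_
  nlinarith

/-- The numerical part of the classification of orbits of poles. -/
lemma ncard_orbit_le_two_of_finite [Finite X] (Z : Subgroup G)
    (hZ : ∀ g ∈ Z, ∀ x : X, g • x = x)
    (hfix : ∀ g ∉ Z, (fixedBy X g).ncard = 2) (hstab : ∀ x : X, ∃ g ∉ Z, g • x = x)
    (x₁ : X) (hx₁ : 6 * Nat.card Z ≤ Nat.card (stabilizer G x₁)) :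
    (orbit G x₁).ncard ≤ 2 := by
  classical
  have := Fintype.ofFinite X
  have hcount := card_add_two_mul_index_eq Z hZ hfix
  have hfin : Finite (orbitRel.Quotient G X) := Quotient.finite _
  have := Fintype.ofFinite (orbitRel.Quotient G X)
  have hX : Nat.card X = ∑ ω : orbitRel.Quotient G X, (orbit G ω.out).ncard := by
    rw [Nat.card_congr (selfEquivSigmaOrbits G X), Nat.card_sigma]
    rfl
  have hle : ∀ x : X, Z ≤ stabilizer G x := fun x g hg => hZ g hg x
  have horb := fun x : X => ncard_orbit_mul_eq_index Z hZ x
  have hrel : ∀ x : X, 2 ≤ Z.relIndex (stabilizer G x) := by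
    intro x
    obtain ⟨g, hg, hgx⟩ := hstab x
    have h0 : Z.relIndex (stabilizer G x) ≠ 0 := Subgroup.FiniteIndex.index_ne_zero
    have h1 : Z.relIndex (stabilizer G x) ≠ 1 := by
      rw [Ne, Subgroup.relIndex_eq_one]
      exact fun h => hg (h hgx)
    omega
  have hN : 0 < Z.index := Nat.pos_of_ne_zero Subgroup.FiniteIndex.index_ne_zero
  have hrel₁ : 6 ≤ Z.relIndex (stabilizer G x₁) := by
    have h := Subgroup.card_mul_index (Z.subgroupOf (stabilizer G x₁))
    rw [Nat.card_congr (Subgroup.subgroupOfEquivOfLe (hle x₁)).toEquiv] at h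
    change Nat.card Z * Z.relIndex (stabilizer G x₁) = _ at h
    rw [← h, mul_comm] at hx₁
    exact Nat.le_of_mul_le_mul_left hx₁ Nat.card_pos
  set N := Z.index with hNdef
  have hpos : ∀ x : X, 0 < (orbit G x).ncard := fun x =>
    Nat.pos_of_ne_zero fun h => by have := horb x; rw [h, zero_mul] at this; omega
  have htwo : ∀ x : X, 2 * (orbit G x).ncard ≤ N := fun x => by
    have := horb x; nlinarith [hrel x]
  have hthree : ∀ x : X, 2 * (orbit G x).ncard = N ∨ 3 * (orbit G x).ncard ≤ N := fun x => by
    rcases (hrel x).eq_or_lt with h | h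
    · left; rw [← horb x, ← h, mul_comm]
    · right; have := horb x; nlinarith
  have hsix : 6 * (orbit G x₁).ncard ≤ N := by
    have := horb x₁; nlinarith
  set ω₁ : orbitRel.Quotient G X := Quotient.mk _ x₁ with hω
  have hω₁ : orbit G ω₁.out = orbit G x₁ := by
    rw [orbit_eq_iff, ← orbitRel_apply]
    exact Quotient.mk_out x₁
  have hsplit : Nat.card X = (orbit G x₁).ncard +
      ∑ ω ∈ Finset.univ.erase ω₁, (orbit G ω.out).ncard := by
    rw [hX, ← hω₁]
    exact (Finset.add_sum_erase _ (fun ω => (orbit G (Quotient.out ω)).ncard)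
      (Finset.mem_univ ω₁)).symm
  have hcard : (Finset.univ.erase ω₁).card + 1 = Nat.card (orbitRel.Quotient G X) := by
    rw [Finset.card_erase_add_one (Finset.mem_univ _), Finset.card_univ, Nat.card_eq_fintype_card]
  rw [← hcard] at hcount
  have hbound : 2 * ∑ ω ∈ Finset.univ.erase ω₁, (orbit G ω.out).ncard ≤
      (Finset.univ.erase ω₁).card * N := by
    rw [Finset.mul_sum, ← smul_eq_mul (Finset.card _) N]
    exact Finset.sum_le_card_nsmul _ _ _ fun ω _ => htwo _
  set r := (Finset.univ.erase ω₁).card with hr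
  have hr3 : r ≤ 2 := by
    by_contra! h
    nlinarith
  have hp₁ := hpos x₁
  interval_cases r
  · omega
  · omega
  · obtain ⟨a, b, hab, heq⟩ := Finset.card_eq_two.mp hr.symm
    rw [heq, Finset.sum_pair hab] at hsplit
    have ha := hthree a.out
    have hb := hthree b.out
    have ha' := htwo a.out
    have hb' := htwo b.out
    omega

/-- If the elements of a finite group acting nontrivially have exactly two fixed points each,
then an orbit with large stabilizers has at most two points. -/
lemma ncard_orbit_le_two (Z : Subgroup G) [Z.Normal] (hZ : ∀ g ∈ Z, ∀ x : X, g • x = x)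
    (hfix : ∀ g ∉ Z, (fixedBy X g).ncard = 2)
    (x₁ : X) (hx₁ : 6 * Nat.card Z ≤ Nat.card (stabilizer G x₁)) :
    (orbit G x₁).ncard ≤ 2 := by
  let Y : SubMulAction G X :=
    { carrier := {x | ∃ g ∉ Z, g • x = x}
      smul_mem' := by
        rintro c x ⟨g, hg, hgx⟩
        refine ⟨c * g * c⁻¹, fun h => hg ?_, by simp [mul_smul, hgx]⟩
        simpa [mul_assoc] using Subgroup.Normal.conj_mem ‹Z.Normal› _ h c⁻¹ }
  have hfixfin : ∀ g ∉ Z, (fixedBy X g).Finite := fun g hg =>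
    Set.finite_of_ncard_ne_zero (by rw [hfix g hg]; simp)
  have hYfin : (Y : Set X).Finite := by
    have : (Y : Set X) = ⋃ g ∈ {g : G | g ∉ Z}, fixedBy X g := by
      ext x
      simp only [Set.mem_iUnion, Set.mem_ofPred_eq, exists_prop, mem_fixedBy]
      rfl
    rw [this]
    exact (Set.toFinite _).biUnion hfixfin
  have : Finite Y := hYfin
  have hx₁Y : x₁ ∈ Y := by
    by_contra h
    have hle : stabilizer G x₁ ≤ Z := fun g hg => by
      by_contra hgZ
      exact h ⟨g, hgZ, hg⟩
    have := Subgroup.card_le_of_le hle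
    have : 0 < Nat.card Z := Nat.card_pos
    omega
  have key := ncard_orbit_le_two_of_finite (X := Y) Z (fun g hg x => Subtype.ext (hZ g hg x))
    (fun g hg => ?_) (fun x => ?_) ⟨x₁, hx₁Y⟩ ?_
  · rwa [← Set.ncard_image_of_injective _ Subtype.val_injective,
      SubMulAction.val_image_orbit] at key
  · rw [← hfix g hg, ← Set.ncard_image_of_injective _ Subtype.val_injective]
    congr 1
    ext x
    simp only [Set.mem_image, mem_fixedBy, Subtype.exists, exists_and_right, exists_eq_right]
    constructor
    · rintro ⟨h, hx⟩
      exact congrArg Subtype.val hx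
    · intro hx
      exact ⟨⟨g, hg, hx⟩, Subtype.ext hx⟩
  · obtain ⟨g, hg, hx⟩ := x.2
    exact ⟨g, hg, Subtype.ext hx⟩
  · rwa [SubMulAction.stabilizer_of_subMul]

/-- The number of pairs of a group element and a fixed point of it in a given orbit. -/
lemma sum_ncard_fixedBy_inter_orbit [Fintype G] (x : X) :
    ∑ g : G, (fixedBy X g ∩ orbit G x).ncard = Nat.card G := by
  classical
  have := (Set.finite_range fun g : G => g • x).to_subtype
  have : Fintype (orbit G x) := Fintype.ofFinite (Set.range fun g : G => g • x)
  have : Fintype (Quotient (orbitRel G (orbit G x))) := Fintype.ofFinite _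
  have h := sum_card_fixedBy_eq_card_orbits_mul_card_group G (orbit G x)
  have h1 : Fintype.card (Quotient (orbitRel G (orbit G x))) = 1 := by
    rw [Fintype.card_eq_one_iff]
    refine ⟨Quotient.mk _ ⟨x, mem_orbit_self x⟩, fun y => ?_⟩
    induction y using Quotient.inductionOn with | _ y
    refine Quotient.sound ?_
    exact exists_smul_eq G _ _
  rw [h1, one_mul, ← Nat.card_eq_fintype_card] at h
  rw [← h]
  refine Finset.sum_congr rfl fun g _ => ?_
  rw [← Nat.card_eq_fintype_card, Nat.card_coe_set_eq,
    ← Set.ncard_image_of_injective _ Subtype.val_injective]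
  congr 1
  ext y
  simp only [Set.mem_inter_iff, mem_fixedBy, Set.mem_image, Subtype.exists, exists_and_right,
    exists_eq_right, Subtype.ext_iff, orbit.coe_smul]
  tauto

/-- Suppose the elements outside `Z` have at most two fixed points each, and the ones in `U` have
at most one. Then two distinct orbits bound the size of `U`. -/
lemma ncard_add_le_of_orbit_ne (Z : Subgroup G) (U : Set G)
    (hU : ∀ g ∈ U, g ∉ Z) (hfix : ∀ g ∉ Z, (fixedBy X g).encard ≤ 2)
    (hfixU : ∀ g ∈ U, (fixedBy X g).encard ≤ 1) (x y : X) (hxy : orbit G x ≠ orbit G y) :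
    U.ncard + 2 * Nat.card Z ≤ Nat.card Z * ((orbit G x).ncard + (orbit G y).ncard) := by
  classical
  have := Fintype.ofFinite G
  have hdisj : Disjoint (orbit G x) (orbit G y) := orbit.pairwiseDisjoint ⟨x, rfl⟩ ⟨y, rfl⟩ hxy
  have hfinx : (orbit G x).Finite := Set.finite_range _
  have hfiny : (orbit G y).Finite := Set.finite_range _
  have hsum : ∑ g : G, (fixedBy X g ∩ (orbit G x ∪ orbit G y)).ncard = 2 * Nat.card G := by
    rw [two_mul]
    nth_rewrite 1 [← sum_ncard_fixedBy_inter_orbit x]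
    rw [← sum_ncard_fixedBy_inter_orbit y, ← Finset.sum_add_distrib]
    refine Finset.sum_congr rfl fun g _ => ?_
    rw [Set.inter_union_distrib_left, Set.ncard_union_eq
      (hdisj.mono Set.inter_subset_right Set.inter_subset_right)
      (hfinx.subset Set.inter_subset_right) (hfiny.subset Set.inter_subset_right)]
  have hle : ∀ g : G, (fixedBy X g ∩ (orbit G x ∪ orbit G y)).ncard + (if g ∈ U then 1 else 0) +
      (if g ∈ Z then 2 else 0) ≤
      2 + if g ∈ Z then (orbit G x).ncard + (orbit G y).ncard else 0 := by
    intro g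
    have key : ∀ n : ℕ, (fixedBy X g).encard ≤ n →
        (fixedBy X g ∩ (orbit G x ∪ orbit G y)).ncard ≤ n := by
      intro n h
      have h1 := (Set.encard_le_encard (s := fixedBy X g ∩ (orbit G x ∪ orbit G y))
        Set.inter_subset_left).trans h
      rw [← Set.Finite.cast_ncard_eq ((hfinx.union hfiny).subset Set.inter_subset_right)] at h1
      exact_mod_cast h1
    by_cases hgZ : g ∈ Z
    · have hgU : g ∉ U := fun h => hU g h hgZ
      simp only [hgU, hgZ, if_true, if_false]
      have h1 := Set.ncard_le_ncard (s := fixedBy X g ∩ (orbit G x ∪ orbit G y))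
        Set.inter_subset_right (hfinx.union hfiny)
      have h2 := Set.ncard_union_le (orbit G x) (orbit G y)
      omega
    · by_cases hgU : g ∈ U
      · simp only [hgU, hgZ, if_true, if_false]
        have := key 1 (by exact_mod_cast hfixU g hgU)
        omega
      · simp only [hgU, hgZ, if_false]
        have := key 2 (by exact_mod_cast hfix g hgZ)
        omega
  have htot := Finset.sum_le_sum fun (g : G) (_ : g ∈ Finset.univ) => hle g
  simp only [Finset.sum_add_distrib, hsum, Finset.sum_ite, Finset.sum_const, smul_eq_mul,
    mul_zero, add_zero, Finset.card_univ] at htot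
  have h3 : (Finset.univ.filter fun g : G => g ∈ Z).card = Nat.card Z := by
    rw [Nat.card_eq_fintype_card, Fintype.card_subtype]
  have h4 : (Finset.univ.filter fun g : G => g ∈ U).card = U.ncard := by
    rw [← Nat.card_coe_set_eq, Nat.card_eq_fintype_card, Fintype.card_subtype]
  rw [h3, h4, ← Nat.card_eq_fintype_card] at htot
  rw [mul_add]
  linarith

end Counting

section Moebius

open MulAction OnePoint

variable {F K : Type*} [Field F] [Field K] [Algebra F K]

open Classical in
/-- The action of `SL(2, F)` on the projective line over an extension of `F`. -/
noncomputable instance moebiusAction : MulAction (SpecialLinearGroup (Fin 2) F) (OnePoint K) :=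
  MulAction.compHom (OnePoint K)
    (SpecialLinearGroup.toGL.comp (SpecialLinearGroup.map (n := Fin 2) (algebraMap F K)))

lemma moebius_infty (g : SpecialLinearGroup (Fin 2) F) :
    g • (∞ : OnePoint K) = ∞ ↔ g 1 0 = 0 := by
  classical
  rw [MulAction.compHom_smul_def]
  convert OnePoint.smul_infty_eq_self_iff using 1
  simp

lemma sl_det (g : SpecialLinearGroup (Fin 2) F) : g 0 0 * g 1 1 - g 0 1 * g 1 0 = 1 := by
  rw [← Matrix.det_fin_two, g.det_coe]

lemma moebius_coe (g : SpecialLinearGroup (Fin 2) F) (x : K) :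
    g • (x : OnePoint K) = x ↔ algebraMap F K (g 1 0) * x ^ 2 +
      algebraMap F K (g 1 1 - g 0 0) * x - algebraMap F K (g 0 1) = 0 := by
  classical
  rw [MulAction.compHom_smul_def]
  convert (Matrix.GeneralLinearGroup.fixpointPolynomial_aeval_eq_zero_iff).symm using 1
  simp [GeneralLinearGroup.fixpointPolynomial]

lemma mem_center_iff_entries (g : SpecialLinearGroup (Fin 2) F) :
    g ∈ Subgroup.center (SpecialLinearGroup (Fin 2) F) ↔
      g 0 1 = 0 ∧ g 1 0 = 0 ∧ g 0 0 = g 1 1 := by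
  rw [Matrix.SpecialLinearGroup.mem_center_iff]
  constructor
  · rintro ⟨r, -, hr⟩
    have h := fun i j => congrFun (congrFun hr i) j
    have h00 := h 0 0
    have h01 := h 0 1
    have h10 := h 1 0
    have h11 := h 1 1
    simp at h00 h01 h10 h11
    exact ⟨h01.symm, h10.symm, h00.symm.trans h11⟩
  · rintro ⟨h1, h2, h3⟩
    have := sl_det g
    refine ⟨g 0 0, by rw [Fintype.card_fin]; grind, ?_⟩
    ext i j
    fin_cases i <;> fin_cases j <;> simp [h1, h2, h3]

lemma moebius_center (g : SpecialLinearGroup (Fin 2) F)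
    (hg : g ∈ Subgroup.center (SpecialLinearGroup (Fin 2) F)) (x : OnePoint K) : g • x = x := by
  obtain ⟨h1, h2, h3⟩ := (mem_center_iff_entries g).mp hg
  cases x with
  | infty => exact (moebius_infty g).mpr h2
  | coe x => exact (moebius_coe g x).mpr (by simp [h1, h2, h3])

lemma fixedBy_of_lower_left_eq_zero (g : SpecialLinearGroup (Fin 2) F) (hc : g 1 0 = 0)
    (he : g 1 1 - g 0 0 ≠ 0) : fixedBy (OnePoint K) g =
      {∞, ((algebraMap F K (g 0 1 / (g 1 1 - g 0 0)) : K) : OnePoint K)} := by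
  ext x
  rw [mem_fixedBy, Set.mem_insert_iff, Set.mem_singleton_iff]
  cases x with
  | infty => simp [moebius_infty, hc]
  | coe x =>
    have he' : algebraMap F K (g 1 1 - g 0 0) ≠ 0 := (map_ne_zero _).mpr he
    rw [moebius_coe, hc, OnePoint.coe_eq_coe, map_div₀, eq_div_iff he', map_zero, zero_mul,
      zero_add, sub_eq_zero, mul_comm]
    simp

lemma fixedBy_of_lower_left_eq_zero' (g : SpecialLinearGroup (Fin 2) F) (hc : g 1 0 = 0)
    (he : g 1 1 - g 0 0 = 0) (hb : g 0 1 ≠ 0) : fixedBy (OnePoint K) g = {∞} := by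
  ext x
  rw [mem_fixedBy, Set.mem_singleton_iff]
  cases x with
  | infty => simp [moebius_infty, hc]
  | coe x => simp [moebius_coe, hc, he, hb]

lemma fixedBy_of_root (g : SpecialLinearGroup (Fin 2) F) (hc : g 1 0 ≠ 0) (r : K)
    (hr : g • (r : OnePoint K) = r) : fixedBy (OnePoint K) g =
      {(r : OnePoint K), ((-(algebraMap F K (g 1 1 - g 0 0)) / algebraMap F K (g 1 0) - r : K) :
        OnePoint K)} := by
  have hc' : algebraMap F K (g 1 0) ≠ 0 := by simpa using hc
  rw [moebius_coe] at hr
  ext x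
  rw [mem_fixedBy, Set.mem_insert_iff, Set.mem_singleton_iff]
  cases x with
  | infty => simp [moebius_infty, hc]
  | coe x =>
    rw [moebius_coe, OnePoint.coe_eq_coe, OnePoint.coe_eq_coe, eq_sub_iff_add_eq, eq_div_iff hc',
      ← sub_eq_zero (a := x)]
    constructor
    · intro h
      by_cases h1 : x - r = 0
      · exact Or.inl h1
      · right
        refine mul_left_cancel₀ h1 ?_
        linear_combination h - hr
    · rintro (h | h)
      · rw [sub_eq_zero.mp h]; exact hr
      · linear_combination hr + (x - r) * h

lemma encard_pair_le_two {α : Type*} (a b : α) : ({a, b} : Set α).encard ≤ 2 := by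
  refine (Set.encard_insert_le _ _).trans ?_
  rw [Set.encard_singleton, one_add_one_eq_two]

/-- A noncentral element has at most two fixed points. -/
lemma encard_fixedBy_le_two (g : SpecialLinearGroup (Fin 2) F)
    (hg : g ∉ Subgroup.center (SpecialLinearGroup (Fin 2) F)) :
    (fixedBy (OnePoint K) g).encard ≤ 2 := by
  by_cases hc : g 1 0 = 0
  · by_cases he : g 1 1 - g 0 0 = 0
    · have hb : g 0 1 ≠ 0 := fun hb =>
        hg ((mem_center_iff_entries g).mpr ⟨hb, hc, (sub_eq_zero.mp he).symm⟩)
      rw [fixedBy_of_lower_left_eq_zero' g hc he hb, Set.encard_singleton]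
      norm_num
    · rw [fixedBy_of_lower_left_eq_zero g hc he]
      exact encard_pair_le_two _ _
  · rcases (fixedBy (OnePoint K) g).eq_empty_or_nonempty with h | ⟨x, hx⟩
    · simp [h]
    · cases x with
      | infty => exact absurd ((moebius_infty g).mp hx) hc
      | coe r =>
        rw [fixedBy_of_root g hc r hx]
        exact encard_pair_le_two _ _

/-- A noncentral element of trace different from `±2` has two fixed points. -/
lemma ncard_fixedBy_eq_two [IsAlgClosed K] (g : SpecialLinearGroup (Fin 2) F)
    (ht : (g 0 0 + g 1 1) ^ 2 ≠ 4) :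
    (fixedBy (OnePoint K) g).ncard = 2 := by
  have hdet := sl_det g
  by_cases hc : g 1 0 = 0
  · have he : g 1 1 - g 0 0 ≠ 0 := fun he => ht (by grind)
    rw [fixedBy_of_lower_left_eq_zero g hc he, Set.ncard_pair (OnePoint.infty_ne_coe _)]
  · have hc' : algebraMap F K (g 1 0) ≠ 0 := by simpa using hc
    obtain ⟨r, hr⟩ := IsAlgClosed.exists_root (k := K)
      (Polynomial.C (algebraMap F K (g 1 0)) * Polynomial.X ^ 2 +
        Polynomial.C (algebraMap F K (g 1 1 - g 0 0)) * Polynomial.X +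
        Polynomial.C (-algebraMap F K (g 0 1)))
      (by rw [Polynomial.degree_quadratic hc']; norm_num)
    have hr' : g • (r : OnePoint K) = r := by
      rw [moebius_coe]
      simpa [Polynomial.IsRoot, sub_eq_add_neg] using hr
    rw [fixedBy_of_root g hc r hr', Set.ncard_pair]
    rw [moebius_coe] at hr'
    rw [Ne, OnePoint.coe_eq_coe, eq_sub_iff_add_eq, eq_div_iff hc']
    intro h
    apply ht
    apply (algebraMap F K).injective
    have hdet' := congrArg (algebraMap F K) hdet
    simp only [map_sub, map_mul, map_one, map_pow, map_add, map_ofNat] at *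
    linear_combination (algebraMap F K (g 1 1) - algebraMap F K (g 0 0) +
      2 * algebraMap F K (g 1 0) * r) * h - 4 * algebraMap F K (g 1 0) * hr' + 4 * hdet'

/-- A noncentral element of trace `±2` has exactly one fixed point, and it is rational. -/
lemma fixedBy_eq_singleton [Finite F] (g : SpecialLinearGroup (Fin 2) F)
    (hg : g ∉ Subgroup.center (SpecialLinearGroup (Fin 2) F))
    (ht : (g 0 0 + g 1 1) ^ 2 = 4) :
    ∃ y : OnePoint F, fixedBy (OnePoint K) g = {OnePoint.map (algebraMap F K) y} := by
  have hdet := sl_det g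
  by_cases hc : g 1 0 = 0
  · have he : g 1 1 - g 0 0 = 0 := by
      rw [← sq_eq_zero_iff]; grind
    have hb : g 0 1 ≠ 0 := fun hb =>
      hg ((mem_center_iff_entries g).mpr ⟨hb, hc, (sub_eq_zero.mp he).symm⟩)
    exact ⟨∞, fixedBy_of_lower_left_eq_zero' g hc he hb⟩
  · have hroot : ∃ r : F, 2 * g 1 0 * r + (g 1 1 - g 0 0) = 0 ∧
        g 1 0 * r ^ 2 + (g 1 1 - g 0 0) * r - g 0 1 = 0 := by
      by_cases h2 : (2 : F) = 0
      · have he : g 1 1 - g 0 0 = 0 := by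
          rw [← sq_eq_zero_iff]; grind
        have : CharP F 2 := CharTwo.of_one_ne_zero_of_two_eq_zero one_ne_zero h2
        have := Fintype.ofFinite F
        obtain ⟨r, hr⟩ := FiniteField.isSquare_of_char_two (ringChar.eq F 2) (g 0 1 / g 1 0)
        refine ⟨r, by rw [h2, he]; ring, ?_⟩
        rw [div_eq_iff hc] at hr
        rw [he, hr]; ring
      · refine ⟨-(g 1 1 - g 0 0) / (2 * g 1 0), ?_, ?_⟩
        · field_simp; ring
        · field_simp; grind
    obtain ⟨r, hr1, hr2⟩ := hroot
    refine ⟨(r : OnePoint F), ?_⟩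
    have hr' : g • ((algebraMap F K r : K) : OnePoint K) = (algebraMap F K r : K) := by
      rw [moebius_coe]
      simpa using congrArg (algebraMap F K) hr2
    rw [fixedBy_of_root g hc _ hr', OnePoint.map_some]
    have : -(algebraMap F K (g 1 1 - g 0 0)) / algebraMap F K (g 1 0) - algebraMap F K r =
        algebraMap F K r := by
      rw [← map_neg, ← map_div₀, ← map_sub]
      congr 1
      field_simp
      linear_combination -hr1
    rw [this, Set.pair_eq_singleton]

/-- A noncentral element fixing an irrational point fixes no rational point. -/
lemma not_rational_of_fixed_irrational (g : SpecialLinearGroup (Fin 2) F)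
    (hg : g ∉ Subgroup.center (SpecialLinearGroup (Fin 2) F)) (x : OnePoint K)
    (hx : x ∉ Set.range (OnePoint.map (algebraMap F K))) (hgx : g • x = x) (y : OnePoint F) :
    g • (OnePoint.map (algebraMap F K) y) ≠ OnePoint.map (algebraMap F K) y := by
  intro hy
  have hx' : x ∈ fixedBy (OnePoint K) g := hgx
  by_cases hc : g 1 0 = 0
  · by_cases he : g 1 1 - g 0 0 = 0
    · have hb : g 0 1 ≠ 0 := fun hb =>
        hg ((mem_center_iff_entries g).mpr ⟨hb, hc, (sub_eq_zero.mp he).symm⟩)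
      rw [fixedBy_of_lower_left_eq_zero' g hc he hb] at hx'
      exact hx ⟨∞, hx'.symm⟩
    · rw [fixedBy_of_lower_left_eq_zero g hc he] at hx'
      rcases hx' with h | h
      · exact hx ⟨∞, h.symm⟩
      · exact hx ⟨((g 0 1 / (g 1 1 - g 0 0) : F) : OnePoint F), h.symm⟩
  · cases y with
    | infty => exact hc ((moebius_infty (K := K) g).mp hy)
    | coe y =>
      rw [OnePoint.map_some] at hy
      rw [fixedBy_of_root g hc _ hy] at hx'
      rcases hx' with h | h
      · exact hx ⟨(y : OnePoint F), h.symm⟩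
      · refine hx ⟨((-(g 1 1 - g 0 0) / g 1 0 - y : F) : OnePoint F), ?_⟩
        rw [h, OnePoint.map_some, map_sub, map_div₀, map_neg]

end Moebius

local notation "SL₂" => Matrix.SpecialLinearGroup (Fin 2)

section Transvections

open MulAction OnePoint

variable {F K : Type*} [Field F] [Field K] [Algebra F K]

lemma map_moebius (g : SL₂ F) (y : OnePoint F) :
    OnePoint.map (algebraMap F K) (g • y) = g • OnePoint.map (algebraMap F K) y := by
  classical
  rw [MulAction.compHom_smul_def, MulAction.compHom_smul_def]
  convert OnePoint.map_smul (algebraMap F K) _ y using 2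
  ext i j
  simp

lemma card_onePoint {F : Type*} [Finite F] : Nat.card (OnePoint F) = Nat.card F + 1 :=
  Finite.card_option

lemma sl_mul_apply (g h : SL₂ F) (i j : Fin 2) :
    (g * h) i j = g i 0 * h 0 j + g i 1 * h 1 j := by
  rw [Matrix.SpecialLinearGroup.coe_mul, Matrix.mul_apply, Fin.sum_univ_two]

lemma sl_inv_apply (g : SL₂ F) :
    g⁻¹ 0 0 = g 1 1 ∧ g⁻¹ 0 1 = - g 0 1 ∧ g⁻¹ 1 0 = - g 1 0 ∧ g⁻¹ 1 1 = g 0 0 := by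
  rw [Matrix.SpecialLinearGroup.SL2_inv_expl]
  simp

/-- The upper unitriangular matrix with entry `b`. -/
def upperUnitriangular (b : F) : SL₂ F := ⟨!![1, b; 0, 1], by simp [Matrix.det_fin_two]⟩

lemma upperUnitriangular_add (b c : F) :
    upperUnitriangular (b + c) = upperUnitriangular b * upperUnitriangular c := by
  ext i j
  rw [sl_mul_apply]
  fin_cases i <;> fin_cases j <;> simp [upperUnitriangular, add_comm]

lemma upperUnitriangular_zero : upperUnitriangular (0 : F) = 1 := by
  ext i j
  fin_cases i <;> fin_cases j <;> simp [upperUnitriangular]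

lemma upperUnitriangular_neg (b : F) : upperUnitriangular (-b) = (upperUnitriangular b)⁻¹ := by
  rw [eq_inv_iff_mul_eq_one, ← upperUnitriangular_add, neg_add_cancel, upperUnitriangular_zero]

/-- The entries of the upper unitriangular matrices in a subgroup. -/
def unitriangularEntries (H : Subgroup (SL₂ F)) : AddSubgroup F where
  carrier := {b | upperUnitriangular b ∈ H}
  zero_mem' := by
    change upperUnitriangular 0 ∈ H
    rw [upperUnitriangular_zero]; exact H.one_mem
  add_mem' {a b} ha hb := by
    change upperUnitriangular (a + b) ∈ H
    rw [upperUnitriangular_add]; exact H.mul_mem ha hb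
  neg_mem' {a} ha := by
    change upperUnitriangular (-a) ∈ H
    rw [upperUnitriangular_neg]; exact H.inv_mem ha

lemma mem_unitriangularEntries {H : Subgroup (SL₂ F)} {b : F} :
    b ∈ unitriangularEntries H ↔ upperUnitriangular b ∈ H := Iff.rfl

/-- An upper triangular matrix with equal diagonal entries up to the centre is unitriangular. -/
lemma exists_eq_center_mul_upperUnitriangular (g : SL₂ F) (hc : g 1 0 = 0)
    (ha : g 0 0 = g 1 1) :
    ∃ z ∈ Subgroup.center (SL₂ F), ∃ b, g = z * upperUnitriangular b ∧ (b = 0 → g 0 1 = 0) := by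
  have hdet := sl_det g
  have h1 : g 0 0 * g 0 0 = 1 := by grind
  obtain ⟨z, hz⟩ : ∃ z : SL₂ F, (z : Matrix (Fin 2) (Fin 2) F) = !![g 0 0, 0; 0, g 0 0] :=
    ⟨⟨!![g 0 0, 0; 0, g 0 0], by simp [Matrix.det_fin_two, h1]⟩, rfl⟩
  refine ⟨z, (mem_center_iff_entries _).mpr (by simp [hz]), g 0 0 * g 0 1, ?_, ?_⟩
  · ext i j
    rw [sl_mul_apply, hz]
    fin_cases i <;> fin_cases j <;> simp [upperUnitriangular, hc, ha]
    rw [← mul_assoc, ← ha, h1, one_mul]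
  · intro h
    rcases mul_eq_zero.mp h with h | h
    · rw [h] at h1; simp at h1
    · exact h

lemma trace_conj_eq (g h : SL₂ F) :
    (h * g * h⁻¹) 0 0 + (h * g * h⁻¹) 1 1 = g 0 0 + g 1 1 := by
  obtain ⟨h0, h1, h2, h3⟩ := sl_inv_apply h
  have hdet := sl_det h
  simp only [sl_mul_apply, h0, h1, h2, h3]
  linear_combination (g 0 0 + g 1 1) * hdet

lemma conj_mem_center_iff (g h : SL₂ F) :
    h * g * h⁻¹ ∈ Subgroup.center (SL₂ F) ↔ g ∈ Subgroup.center (SL₂ F) := by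
  constructor
  · intro hg
    simpa [mul_assoc] using Subgroup.Normal.conj_mem inferInstance _ hg h⁻¹
  · exact fun hg => Subgroup.Normal.conj_mem inferInstance _ hg h

/-- The `p`-th power of an element of trace `±2` is central. -/
lemma pow_char_mem_center (p : ℕ) [Fact p.Prime] [CharP F p] (g : SL₂ F)
    (ht : (g 0 0 + g 1 1) ^ 2 = 4) : g ^ p ∈ Subgroup.center (SL₂ F) := by
  have hdet := sl_det g
  obtain ⟨e, he⟩ : ∃ e : F, g 0 0 + g 1 1 = 2 * e ∧ e ^ 2 = 1 := by
    have : (g 0 0 + g 1 1 - 2) * (g 0 0 + g 1 1 + 2) = 0 := by linear_combination ht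
    rcases mul_eq_zero.mp this with h | h
    · exact ⟨1, by linear_combination h, by ring⟩
    · exact ⟨-1, by linear_combination h, by ring⟩
  have hsq : ((g : Matrix (Fin 2) (Fin 2) F) - Matrix.scalar (Fin 2) e) ^ 2 = 0 := by
    rw [sq]
    ext i j
    fin_cases i <;> fin_cases j <;> simp [Matrix.mul_apply] <;> grind
  have hp := sub_pow_char_of_commute (p := p)
    (Matrix.scalar_commute e (fun r => mul_comm _ _) (g : Matrix (Fin 2) (Fin 2) F)).symm
  have h2 : 2 ≤ p := (Fact.out : p.Prime).two_le
  rw [pow_eq_zero_of_le h2 hsq, eq_comm, sub_eq_zero, ← map_pow,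
    ← Matrix.SpecialLinearGroup.coe_pow] at hp
  rw [mem_center_iff_entries, hp]
  simp

end Transvections

section Center

variable {F : Type*} [Field F]

lemma mem_center_iff_eq_one_or_neg_one (g : SL₂ F) :
    g ∈ Subgroup.center (SL₂ F) ↔ g = 1 ∨ g = -1 := by
  rw [mem_center_iff_entries]
  constructor
  · rintro ⟨h1, h2, h3⟩
    have hdet := sl_det g
    have : (g 0 0 - 1) * (g 0 0 + 1) = 0 := by grind
    rcases mul_eq_zero.mp this with h | h
    · left
      ext i j
      fin_cases i <;> fin_cases j <;> simp <;> grind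
    · right
      ext i j
      fin_cases i <;> fin_cases j <;> simp <;> grind
  · rintro (rfl | rfl) <;> simp

lemma card_center_of_two_ne_zero (h : (2 : F) ≠ 0) : Nat.card (Subgroup.center (SL₂ F)) = 2 := by
  have : ((Subgroup.center (SL₂ F) : Subgroup (SL₂ F)) : Set (SL₂ F)) = {1, -1} := by
    ext g
    exact mem_center_iff_eq_one_or_neg_one g
  change Nat.card ((Subgroup.center (SL₂ F) : Subgroup (SL₂ F)) : Set (SL₂ F)) = 2
  rw [this, Nat.card_coe_set_eq, Set.ncard_pair]
  intro h1
  have h2 := congrArg (fun g : SL₂ F => g 0 0) h1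
  simp at h2
  grind

lemma card_center_of_two_eq_zero (h : (2 : F) = 0) : Nat.card (Subgroup.center (SL₂ F)) = 1 := by
  have h1 : (-1 : F) = 1 := by grind
  have : ((Subgroup.center (SL₂ F) : Subgroup (SL₂ F)) : Set (SL₂ F)) = {1} := by
    ext g
    rw [Set.mem_singleton_iff]
    refine (mem_center_iff_eq_one_or_neg_one g).trans ⟨?_, Or.inl⟩
    rintro (h | h)
    · exact h
    · rw [h]
      ext i j
      fin_cases i <;> fin_cases j <;> simp [h1]
  change Nat.card ((Subgroup.center (SL₂ F) : Subgroup (SL₂ F)) : Set (SL₂ F)) = 1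
  rw [this, Nat.card_coe_set_eq, Set.ncard_singleton]

end Center

section Irrational

open MulAction OnePoint

variable {F K : Type*} [Field F] [Finite F] [Field K] [Algebra F K]

instance finiteOnePoint {F : Type*} [Finite F] : Finite (OnePoint F) :=
  inferInstanceAs (Finite (Option F))

lemma ncard_orbit_mul_card_stabilizer {G X : Type*} [Group G] [MulAction G X] (x : X) :
    (orbit G x).ncard * Nat.card (stabilizer G x) = Nat.card G := by
  rw [← MulAction.index_stabilizer, mul_comm, Subgroup.card_mul_index]

lemma card_le_center_mul_ncard_orbit (H : Subgroup (SL₂ F)) (x : OnePoint K)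
    (hx : x ∉ Set.range (OnePoint.map (algebraMap F K))) (y : OnePoint F) :
    Nat.card (stabilizer H x) ≤ Nat.card (Subgroup.center (SL₂ F)) * (orbit H y).ncard := by
  have h1 : Nat.card (stabilizer (stabilizer H x) y) ≤ Nat.card (Subgroup.center (SL₂ F)) := by
    refine Nat.card_le_card_of_injective (fun g => ⟨(g.1.1.1 : SL₂ F), ?_⟩) ?_
    · by_contra hg
      refine not_rational_of_fixed_irrational (K := K) _ hg x hx g.1.2 y ?_
      rw [← map_moebius]
      exact congrArg _ g.2
    · intro g g' h
      have h' : (g.1.1.1 : SL₂ F) = g'.1.1.1 :=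
        congrArg (fun c : Subgroup.center (SL₂ F) => (c : SL₂ F)) h
      exact Subtype.ext (Subtype.ext (Subtype.ext h'))
  have h2 : (orbit (stabilizer H x) y).ncard ≤ (orbit H y).ncard := by
    refine Set.ncard_le_ncard ?_
    rintro _ ⟨g, rfl⟩
    exact ⟨g.1, rfl⟩
  rw [← ncard_orbit_mul_card_stabilizer (G := stabilizer H x) y, mul_comm]
  gcongr

/-- A subgroup containing a transvection and a large irrational stabilizer is transitive on
the rational points. -/
lemma orbit_eq_univ (p : ℕ) [Fact p.Prime] [CharP F p] (H : Subgroup (SL₂ F)) (x : OnePoint K)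
    (hx : x ∉ Set.range (OnePoint.map (algebraMap F K)))
    (hS : Nat.card F + 1 ≤ Nat.card (stabilizer H x))
    (u : SL₂ F) (huH : u ∈ H) (hu : u ∉ Subgroup.center (SL₂ F))
    (ht : (u 0 0 + u 1 1) ^ 2 = 4) (y₀ y : OnePoint F) (hy₀ : u • y₀ = y₀) :
    y ∈ orbit H y₀ := by
  by_contra hy
  have hdisj : Disjoint (orbit H y₀) (orbit H y) := by
    rw [Set.disjoint_left]
    intro w hw hw'
    apply hy
    rw [← orbit_eq_iff.mpr hw, orbit_eq_iff.mpr hw']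
    exact mem_orbit_self y
  have hsum : (orbit H y₀).ncard + (orbit H y).ncard ≤ Nat.card F + 1 := by
    rw [← Set.ncard_union_eq hdisj, ← card_onePoint, ← Set.ncard_univ]
    exact Set.ncard_le_ncard (Set.subset_univ _)
  have h0 := hS.trans (card_le_center_mul_ncard_orbit H x hx y₀)
  have h1 := hS.trans (card_le_center_mul_ncard_orbit H x hx y)
  by_cases h2 : (2 : F) = 0
  · rw [card_center_of_two_eq_zero h2] at h0 h1
    omega
  · rw [card_center_of_two_ne_zero h2] at h0 h1
    have h3 : 2 * (orbit H y).ncard = Nat.card F + 1 := by omega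
    have hpF : p ∣ Nat.card F := by
      have := Fintype.ofFinite F
      obtain ⟨n, -, hn⟩ := FiniteField.card F p
      rw [Nat.card_eq_fintype_card, hn]
      exact dvd_pow_self p n.pos.ne'
    have := Fintype.ofFinite (orbit H y)
    have hp : ¬ p ∣ Fintype.card (orbit H y) := by
      intro hdvd
      rw [← Nat.card_eq_fintype_card, Nat.card_coe_set_eq] at hdvd
      have : p ∣ Nat.card F + 1 := h3 ▸ hdvd.mul_left 2
      exact (Fact.out : p.Prime).one_lt.ne' (Nat.dvd_one.mp ((Nat.dvd_add_right hpF).mp this))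
    obtain ⟨w, hw⟩ := Equiv.Perm.exists_fixed_point_of_prime (n := 1) hp
      (σ := MulAction.toPerm (⟨u, huH⟩ : H)) (by
        ext w
        rw [← MulAction.toPermHom_apply, ← map_pow, pow_one]
        exact moebius_center (u ^ p) (pow_char_mem_center p u ht) w.1)
    obtain ⟨y₁, hy₁⟩ := fixedBy_eq_singleton (K := F) u hu ht
    have e0 : y₀ ∈ fixedBy (OnePoint F) u := hy₀
    have e1 : (w : OnePoint F) ∈ fixedBy (OnePoint F) u := congrArg Subtype.val hw
    rw [hy₁] at e0 e1
    rw [Set.mem_singleton_iff] at e0 e1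
    exact Set.disjoint_left.mp hdisj (mem_orbit_self y₀) (e0.trans e1.symm ▸ w.2)

end Irrational

section Subgroups

open MulAction OnePoint

variable {F : Type*} [Field F]

lemma mul_upperUnitriangular_apply (g : SL₂ F) (b : F) :
    (g * upperUnitriangular b) 0 0 = g 0 0 ∧ (g * upperUnitriangular b) 0 1 = g 0 0 * b + g 0 1 ∧
    (g * upperUnitriangular b) 1 0 = g 1 0 ∧
    (g * upperUnitriangular b) 1 1 = g 1 0 * b + g 1 1 := by
  refine ⟨?_, ?_, ?_, ?_⟩ <;> rw [sl_mul_apply] <;> simp [upperUnitriangular]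

lemma exists_ne_zero_mem_unitriangularEntries (H : Subgroup (SL₂ F))
    (hZ : Subgroup.center (SL₂ F) ≤ H) (u h : SL₂ F) (huH : u ∈ H) (hhH : h ∈ H)
    (hu : u ∉ Subgroup.center (SL₂ F)) (ht : (u 0 0 + u 1 1) ^ 2 = 4)
    (hy : u • h • (∞ : OnePoint F) = h • (∞ : OnePoint F)) :
    ∃ b ∈ unitriangularEntries H, b ≠ 0 := by
  obtain ⟨g, hg⟩ : ∃ g, g = h⁻¹ * u * h := ⟨_, rfl⟩
  have hgH : g ∈ H := hg ▸ H.mul_mem (H.mul_mem (H.inv_mem hhH) huH) hhH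
  have hc : g 1 0 = 0 := by
    rw [← moebius_infty (K := F), hg, mul_smul, mul_smul, hy, inv_smul_smul]
  have htr : g 0 0 + g 1 1 = u 0 0 + u 1 1 := by
    have := trace_conj_eq u h⁻¹
    rwa [inv_inv, ← hg] at this
  have hgZ : g ∉ Subgroup.center (SL₂ F) := by
    have := conj_mem_center_iff u h⁻¹
    rw [inv_inv, ← hg] at this
    rwa [this]
  have hdet := sl_det g
  have ha : g 0 0 = g 1 1 := by
    rw [← sub_eq_zero, ← sq_eq_zero_iff]
    rw [← htr] at ht
    linear_combination ht - 4 * hdet - 4 * g 0 1 * hc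
  obtain ⟨z, hz, b, hb, hb0⟩ := exists_eq_center_mul_upperUnitriangular g hc ha
  refine ⟨b, ?_, fun h0 => hgZ ((mem_center_iff_entries g).mpr ⟨hb0 h0, hc, ha⟩)⟩
  have : upperUnitriangular b = z⁻¹ * g := by rw [hb, inv_mul_cancel_left]
  rw [mem_unitriangularEntries, this]
  exact H.mul_mem (H.inv_mem (hZ hz)) hgH

variable [Finite F]

lemma card_le_ncard_transvections (H : Subgroup (SL₂ F)) (hZ : Subgroup.center (SL₂ F) ≤ H)
    (htrans : ∀ y : OnePoint F, ∃ h ∈ H, h • (∞ : OnePoint F) = y) :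
    (Nat.card F + 1) * ((Nat.card (unitriangularEntries H) - 1) *
      Nat.card (Subgroup.center (SL₂ F))) ≤
      {g : H | (g : SL₂ F) ∉ Subgroup.center (SL₂ F) ∧ (g.1 0 0 + g.1 1 1) ^ 2 = 4}.ncard := by
  choose h hhH hh using htrans
  have hcardA : Nat.card {b : unitriangularEntries H // b ≠ 0} =
      Nat.card (unitriangularEntries H) - 1 := by
    have := Fintype.ofFinite (unitriangularEntries H)
    classical
    rw [Nat.card_eq_fintype_card, Nat.card_eq_fintype_card, Fintype.card_subtype_compl,
      Fintype.card_subtype_eq]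
  rw [← hcardA, ← card_onePoint, ← Nat.card_prod, ← Nat.card_prod, ← Nat.card_coe_set_eq]
  have key (b : F) (hb : b ≠ 0) (z : SL₂ F) (hz : z ∈ Subgroup.center (SL₂ F)) :
      z * upperUnitriangular b ∉ Subgroup.center (SL₂ F) ∧
      ((z * upperUnitriangular b) 0 0 + (z * upperUnitriangular b) 1 1) ^ 2 = 4 ∧
      (z * upperUnitriangular b) • (∞ : OnePoint F) = ∞ := by
    obtain ⟨h1, h2, h3⟩ := (mem_center_iff_entries z).mp hz
    obtain ⟨e1, e2, e3, e4⟩ := mul_upperUnitriangular_apply z b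
    have hdet := sl_det z
    rw [mem_center_iff_entries, moebius_infty, e1, e2, e3, e4]
    refine ⟨?_, ?_, h2⟩
    · rintro ⟨h4, -, -⟩
      grind
    · grind
  refine Nat.card_le_card_of_injective (fun w => ⟨⟨h w.1 * (w.2.2.1 *
    upperUnitriangular w.2.1.1.1) * (h w.1)⁻¹, ?_⟩, ?_⟩) ?_
  · exact H.mul_mem (H.mul_mem (hhH _) (H.mul_mem (hZ w.2.2.2) w.2.1.1.2)) (H.inv_mem (hhH _))
  · have hb : (w.2.1.1.1 : F) ≠ 0 := fun h0 => w.2.1.2 (Subtype.ext h0)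
    obtain ⟨k1, k2, -⟩ := key _ hb _ w.2.2.2
    refine ⟨?_, ?_⟩
    · rwa [conj_mem_center_iff]
    · rwa [trace_conj_eq]
  · rintro ⟨y, ⟨b, hb⟩, z⟩ ⟨y', ⟨b', hb'⟩, z'⟩ heq
    have hb0 : (b : F) ≠ 0 := fun h0 => hb (Subtype.ext h0)
    have hb0' : (b' : F) ≠ 0 := fun h0 => hb' (Subtype.ext h0)
    have heq' : h y * (z * upperUnitriangular (b : F)) * (h y)⁻¹ =
        h y' * (z' * upperUnitriangular (b' : F)) * (h y')⁻¹ :=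
      congrArg (fun g : {g : H | (g : SL₂ F) ∉ Subgroup.center (SL₂ F) ∧
        (g.1 0 0 + g.1 1 1) ^ 2 = 4} => (g.1 : SL₂ F)) heq
    obtain ⟨k1, k2, k3⟩ := key _ hb0 _ z.2
    obtain ⟨-, -, k3'⟩ := key _ hb0' _ z'.2
    have fix (y : OnePoint F) (g : SL₂ F) (hg : g • (∞ : OnePoint F) = ∞) :
        (h y * g * (h y)⁻¹) • y = y := by
      nth_rw 3 [← hh y]
      rw [← smul_smul, inv_smul_smul, ← smul_smul, hg, hh]
    have f1 := fix y _ k3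
    have f2 := fix y' _ k3'
    rw [← heq'] at f2
    obtain ⟨y₁, hy₁⟩ := fixedBy_eq_singleton (K := F)
      (h y * (z.1 * upperUnitriangular (b : F)) * (h y)⁻¹)
      (by rwa [conj_mem_center_iff]) (by rwa [trace_conj_eq])
    have e1 : y ∈ ({OnePoint.map (algebraMap F F) y₁} : Set (OnePoint F)) := hy₁ ▸ f1
    have e2 : y' ∈ ({OnePoint.map (algebraMap F F) y₁} : Set (OnePoint F)) := hy₁ ▸ f2
    rw [Set.mem_singleton_iff] at e1 e2
    obtain rfl : y = y' := e1.trans e2.symm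
    have e3 : (z : SL₂ F) * upperUnitriangular (b : F) = z' * upperUnitriangular (b' : F) :=
      mul_left_cancel (mul_right_cancel heq')
    obtain ⟨m1, m2, m3⟩ := (mem_center_iff_entries z.1).mp z.2
    obtain ⟨n1, n2, n3⟩ := (mem_center_iff_entries z'.1).mp z'.2
    obtain ⟨p1, p2, -, -⟩ := mul_upperUnitriangular_apply z.1 (b : F)
    obtain ⟨q1, q2, -, -⟩ := mul_upperUnitriangular_apply z'.1 (b' : F)
    have hdet := sl_det z.1
    rw [e3] at p1 p2
    have hbb : (b : F) = b' := by grind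
    obtain rfl : b = b' := Subtype.ext hbb
    have hzz : z = z' := Subtype.ext (mul_right_cancel e3)
    rw [hzz]

lemma card_stabilizer_infty_le (H : Subgroup (SL₂ F)) (hZ : Subgroup.center (SL₂ F) ≤ H)
    (b₀ : F) (hb₀ : b₀ ∈ unitriangularEntries H) (hb₀' : b₀ ≠ 0) :
    Nat.card (stabilizer H (∞ : OnePoint F)) ≤ Nat.card (Subgroup.center (SL₂ F)) *
      Nat.card (unitriangularEntries H) * (Nat.card (unitriangularEntries H) - 1) := by
  classical
  have := Fintype.ofFinite F
  have := Fintype.ofFinite (stabilizer H (∞ : OnePoint F))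
  have hc (g : stabilizer H (∞ : OnePoint F)) : g.1.1 1 0 = 0 :=
    (moebius_infty (K := F) g.1.1).mp g.2
  have hfib : ∀ a ∈ Finset.univ.image
      (fun g : stabilizer H (∞ : OnePoint F) => g.1.1 0 0 ^ 2 * b₀),
      (Finset.univ.filter (fun g : stabilizer H (∞ : OnePoint F) =>
        g.1.1 0 0 ^ 2 * b₀ = a)).card ≤
      Nat.card (Subgroup.center (SL₂ F)) * Nat.card (unitriangularEntries H) := by
    intro a ha
    obtain ⟨g₀, -, rfl⟩ := Finset.mem_image.mp ha
    have ex (g : {g : stabilizer H (∞ : OnePoint F) //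
        g.1.1 0 0 ^ 2 * b₀ = g₀.1.1 0 0 ^ 2 * b₀}) :
        ∃ w : Subgroup.center (SL₂ F) × unitriangularEntries H,
          (g.1.1.1 : SL₂ F) = g₀.1.1 * (w.1.1 * upperUnitriangular (w.2.1 : F)) := by
      obtain ⟨r, hr⟩ : ∃ r, r = (g₀.1.1 : SL₂ F)⁻¹ * g.1.1.1 := ⟨_, rfl⟩
      have hsq : (g.1.1.1 : SL₂ F) 0 0 ^ 2 = g₀.1.1 0 0 ^ 2 := mul_right_cancel₀ hb₀' g.2
      obtain ⟨i1, i2, i3, i4⟩ := sl_inv_apply (g₀.1.1 : SL₂ F)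
      have hrH : r ∈ H := hr ▸ H.mul_mem (H.inv_mem g₀.1.2) g.1.1.2
      have c1 := hc g.1
      have c2 := hc g₀
      have d1 := sl_det (g.1.1.1 : SL₂ F)
      have d2 := sl_det (g₀.1.1 : SL₂ F)
      have r10 : r 1 0 = 0 := by rw [hr, sl_mul_apply, i3, i4, c1, c2]; ring
      have rd : r 0 0 = r 1 1 := by
        rw [hr, sl_mul_apply, sl_mul_apply, i1, i2, i3, i4, c1, c2]
        rw [c1] at d1
        rw [c2] at d2
        simp only [mul_zero, sub_zero, neg_zero, zero_mul, add_zero, zero_add] at d1 d2 ⊢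
        have : (g.1.1.1 : SL₂ F) 0 0 ≠ 0 := by rintro h; simp [h] at d1
        have : (g₀.1.1 : SL₂ F) 0 0 ≠ 0 := by rintro h; simp [h] at d2
        refine mul_left_cancel₀ (mul_ne_zero (a := (g.1.1.1 : SL₂ F) 0 0)
          (b := (g₀.1.1 : SL₂ F) 0 0) ‹_› ‹_›) ?_
        linear_combination ((g.1.1.1 : SL₂ F) 0 0) ^ 2 * d2 -
          ((g₀.1.1 : SL₂ F) 0 0) ^ 2 * d1 + hsq
      obtain ⟨z, hz, b, hb, -⟩ := exists_eq_center_mul_upperUnitriangular r r10 rd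
      have hbH : upperUnitriangular b ∈ H := by
        have : upperUnitriangular b = z⁻¹ * r := by rw [hb, inv_mul_cancel_left]
        rw [this]
        exact H.mul_mem (H.inv_mem (hZ hz)) hrH
      refine ⟨⟨⟨z, hz⟩, ⟨b, hbH⟩⟩, ?_⟩
      change _ = (g₀.1.1 : SL₂ F) * (z * upperUnitriangular b)
      rw [← hb, hr, mul_inv_cancel_left]
    choose w hw using ex
    rw [← Nat.card_prod, ← Fintype.card_subtype, ← Nat.card_eq_fintype_card]
    refine Nat.card_le_card_of_injective w fun g g' hgg => ?_
    have h' : (g.1.1.1 : SL₂ F) = g'.1.1.1 := by rw [hw g, hw g', hgg]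
    exact Subtype.ext (Subtype.ext (Subtype.ext h'))
  have himg : (Finset.univ.image
      (fun g : stabilizer H (∞ : OnePoint F) => g.1.1 0 0 ^ 2 * b₀)).card ≤
      Nat.card (unitriangularEntries H) - 1 := by
    have h0 : ((unitriangularEntries H : AddSubgroup F) : Set F).ncard - 1 =
        (((unitriangularEntries H : AddSubgroup F) : Set F) \ {0}).ncard :=
      (Set.ncard_sdiff_singleton_of_mem (unitriangularEntries H).zero_mem).symm
    rw [← Nat.card_coe_set_eq] at h0
    refine le_of_le_of_eq ?_ h0.symm
    rw [← Set.ncard_coe_finset]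
    refine Set.ncard_le_ncard ?_
    intro a ha
    obtain ⟨g, -, rfl⟩ := Finset.mem_image.mp (Finset.mem_coe.mp ha)
    have c1 := hc g
    have d1 := sl_det (g.1.1 : SL₂ F)
    rw [c1, mul_zero, sub_zero] at d1
    have ha0 : (g.1.1 : SL₂ F) 0 0 ≠ 0 := by rintro h; simp [h] at d1
    refine ⟨?_, mul_ne_zero (pow_ne_zero 2 ha0) hb₀'⟩
    change upperUnitriangular _ ∈ H
    have : upperUnitriangular ((g.1.1 : SL₂ F) 0 0 ^ 2 * b₀) =
        g.1.1 * upperUnitriangular b₀ * (g.1.1)⁻¹ := by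
      rw [eq_mul_inv_iff_mul_eq]
      ext i j
      rw [sl_mul_apply, sl_mul_apply]
      fin_cases i <;> fin_cases j <;> simp [upperUnitriangular, c1]
      linear_combination (g.1.1 : SL₂ F) 0 0 * b₀ * d1
    rw [this]
    exact H.mul_mem (H.mul_mem g.1.2 hb₀) (H.inv_mem g.1.2)
  rw [Nat.card_eq_fintype_card, ← Finset.card_univ]
  exact (Finset.card_le_mul_card_image _ _ hfib).trans (Nat.mul_le_mul_left _ himg)

lemma card_sl_le : Nat.card (SL₂ F) ≤ (Nat.card F + 1) * (Nat.card F * (Nat.card F - 1)) := by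
  have h1 : (orbit (SL₂ F) (∞ : OnePoint F)).ncard ≤ Nat.card F + 1 := by
    rw [← card_onePoint, ← Set.ncard_univ]
    exact Set.ncard_le_ncard (Set.subset_univ _)
  have h2 : Nat.card (stabilizer (SL₂ F) (∞ : OnePoint F)) ≤ Nat.card F * (Nat.card F - 1) := by
    have hunits : Nat.card F - 1 = Nat.card {a : F // a ≠ 0} := by
      have := Fintype.ofFinite F
      classical
      rw [Nat.card_eq_fintype_card, Nat.card_eq_fintype_card, Fintype.card_subtype_compl,
        Fintype.card_subtype_eq]
    have hc (g : stabilizer (SL₂ F) (∞ : OnePoint F)) : g.1 1 0 = 0 :=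
      (moebius_infty (K := F) g.1).mp g.2
    have hd (g : stabilizer (SL₂ F) (∞ : OnePoint F)) : g.1 0 0 * g.1 1 1 = 1 := by
      have d1 := sl_det g.1
      rwa [hc, mul_zero, sub_zero] at d1
    rw [hunits, ← Nat.card_prod]
    refine Nat.card_le_card_of_injective (fun g => ⟨g.1 0 1, g.1 0 0, ?_⟩) ?_
    · intro h
      simpa [h] using hd g
    · intro g g' h
      have e1 : g.1 0 1 = g'.1 0 1 := congrArg Prod.fst h
      have e2 : g.1 0 0 = g'.1 0 0 :=
        congrArg (fun w : F × {a : F // a ≠ 0} => (w.2 : F)) h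
      have d1 := hd g
      have d2 := hd g'
      have c1 := hc g
      have c2 := hc g'
      have e3 : g.1 1 1 = g'.1 1 1 := by grind
      refine Subtype.ext (Matrix.SpecialLinearGroup.ext _ _ fun i j => ?_)
      fin_cases i <;> fin_cases j <;> simp [e1, e2, e3, c1, c2]
  rw [← ncard_orbit_mul_card_stabilizer (∞ : OnePoint F)]
  gcongr

end Subgroups

section Generation

open MulAction OnePoint

variable {F K : Type*} [Field F] [Finite F] [Field K] [Algebra F K]

lemma card_center_subgroupOf {F : Type*} [Field F] (H : Subgroup (SL₂ F))
    (hZ : Subgroup.center (SL₂ F) ≤ H) :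
    Nat.card ((Subgroup.center (SL₂ F)).subgroupOf H) = Nat.card (Subgroup.center (SL₂ F)) :=
  Nat.card_congr (Subgroup.subgroupOfEquivOfLe hZ).toEquiv

/-- If a prime power `q` and a divisor `M` of it satisfy the inequalities between orbit and
stabilizer sizes, then either `M = q` or the orbit is tiny. -/
lemma eq_or_le_two_of_orbit_bounds {p q M z o β : ℕ} (hp : p.Prime) (hM : M ∣ q) {f : ℕ}
    (hq : q = p ^ f) (hM1 : M ≠ 1) (hz : z = 1 ∧ p = 2 ∨ z = 2 ∧ p ≠ 2)
    (hqz : 13 * z ≤ q + 1)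
    (h1 : (q + 1) * ((M - 1) * z) + 2 * z ≤ z * (o + (q + 1)))
    (h2 : o ≤ β) (h3 : β ≤ z * M * (M - 1)) : M = q ∨ o ≤ 2 := by
  rw [or_iff_not_imp_left]
  intro hMq
  obtain ⟨c, hc⟩ := hM
  have hc1 : c ≠ 1 := by rintro rfl; apply hMq; rw [hc, mul_one]
  have hpc : p ∣ c := by
    obtain ⟨i, -, rfl⟩ := (Nat.dvd_prime_pow hp).mp (hq ▸ hc ▸ Dvd.intro_left M rfl : c ∣ p ^ f)
    exact dvd_pow_self p (by rintro rfl; exact hc1 (pow_zero p))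
  have hpM : p ∣ M := by
    obtain ⟨i, -, rfl⟩ := (Nat.dvd_prime_pow hp).mp (hq ▸ hc ▸ Dvd.intro c rfl : M ∣ p ^ f)
    exact dvd_pow_self p (by rintro rfl; exact hM1 (pow_zero p))
  have hc0 : c ≠ 0 := by rintro rfl; rw [hc] at hqz; omega
  have hM0 : M ≠ 0 := by rintro rfl; rw [hc] at hqz; omega
  have hpq : p * M ≤ q := by
    rw [hc, mul_comm]
    exact Nat.mul_le_mul_left _ (Nat.le_of_dvd (Nat.pos_of_ne_zero hc0) hpc)
  have hpM' := Nat.le_of_dvd (Nat.pos_of_ne_zero hM0) hpM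
  obtain ⟨N, rfl⟩ : ∃ N, M = N + 1 := ⟨M - 1, by omega⟩
  rw [Nat.add_sub_cancel] at h1 h3
  rcases hz with ⟨rfl, rfl⟩ | ⟨rfl, hp2⟩
  · by_contra ho
    rcases Nat.lt_or_ge N 2 with hN | hN
    · interval_cases N <;> omega
    · nlinarith
  · have : 2 ≤ p := hp.two_le
    have hp3 : 3 ≤ p := by omega
    have hq3 : 3 * (N + 1) ≤ q := (Nat.mul_le_mul_right _ hp3).trans hpq
    exfalso
    have h1' : (q + 1) * N + 2 ≤ o + (q + 1) := by nlinarith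
    have hN2 : 2 ≤ N := by omega
    rcases Nat.lt_or_ge N 3 with hN | hN
    · obtain rfl : N = 2 := by omega
      omega
    · nlinarith

/-- A subgroup of `SL(2, F)` with a large irrational stabilizer is the whole group or has an
orbit of size at most two. -/
theorem ncard_orbit_le_two_or_eq_top [IsAlgClosed K] (p : ℕ) [Fact p.Prime] [CharP F p]
    (H : Subgroup (SL₂ F)) (hZ : Subgroup.center (SL₂ F) ≤ H) (x : OnePoint K)
    (hx : x ∉ Set.range (OnePoint.map (algebraMap F K)))
    (hS : Nat.card F + 1 ≤ Nat.card (stabilizer H x))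
    (hq : 13 * Nat.card (Subgroup.center (SL₂ F)) ≤ Nat.card F + 1) :
    (orbit H x).ncard ≤ 2 ∨ H = ⊤ := by
  have hcardZ := card_center_subgroupOf H hZ
  by_cases hu : ∃ u ∈ H, u ∉ Subgroup.center (SL₂ F) ∧ (u 0 0 + u 1 1) ^ 2 = 4
  swap
  · push Not at hu
    left
    refine ncard_orbit_le_two ((Subgroup.center (SL₂ F)).subgroupOf H) ?_ ?_ x ?_
    · exact fun g hg y => moebius_center g.1 hg y
    · exact fun g hg => ncard_fixedBy_eq_two g.1 (hu g.1 g.2 hg)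
    · rw [hcardZ]; omega
  obtain ⟨u, huH, huZ, ht⟩ := hu
  obtain ⟨y₀, hy₀⟩ := fixedBy_eq_singleton (K := F) u huZ ht
  have hy₀' : u • y₀ = y₀ := by
    have : OnePoint.map (algebraMap F F) y₀ = y₀ := by cases y₀ <;> rfl
    rw [this] at hy₀
    have : y₀ ∈ fixedBy (OnePoint F) u := by rw [hy₀]; exact Set.mem_singleton y₀
    exact this
  have htrans₀ (y : OnePoint F) : y ∈ orbit H y₀ :=
    orbit_eq_univ p H x hx hS u huH huZ ht y₀ y hy₀'
  have htrans (y : OnePoint F) : ∃ h ∈ H, h • (∞ : OnePoint F) = y := by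
    have := htrans₀ y
    rw [← orbit_eq_iff.mpr (htrans₀ ∞)] at this
    obtain ⟨h, hh⟩ := this
    exact ⟨h.1, h.2, hh⟩
  obtain ⟨b₀, hb₀, hb₀'⟩ : ∃ b ∈ unitriangularEntries H, b ≠ 0 := by
    obtain ⟨h, hhH, hh⟩ := htrans y₀
    exact exists_ne_zero_mem_unitriangularEntries H hZ u h huH hhH huZ ht (by rw [hh, hy₀'])
  have hB := card_stabilizer_infty_le H hZ b₀ hb₀ hb₀'
  have hU := card_le_ncard_transvections H hZ htrans
  have horb : (orbit H (∞ : OnePoint F)).ncard = Nat.card F + 1 := by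
    rw [← card_onePoint, ← Set.ncard_univ]
    congr 1
    rw [Set.eq_univ_iff_forall]
    intro y
    obtain ⟨h, hhH, hh⟩ := htrans y
    exact ⟨⟨h, hhH⟩, hh⟩
  have horbK : orbit H (∞ : OnePoint K) ⊆ Set.range (OnePoint.map (algebraMap F K)) := by
    rintro _ ⟨h, rfl⟩
    exact ⟨h.1 • ∞, map_moebius h.1 ∞⟩
  have horbK' : (orbit H (∞ : OnePoint K)).ncard ≤ Nat.card F + 1 := by
    refine (Set.ncard_le_ncard horbK (Set.finite_range _)).trans ?_
    rw [← card_onePoint, ← Set.image_univ, ← Set.ncard_univ]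
    exact Set.ncard_image_le
  have hle := ncard_add_le_of_orbit_ne ((Subgroup.center (SL₂ F)).subgroupOf H)
    {g : H | (g : SL₂ F) ∉ Subgroup.center (SL₂ F) ∧ (g.1 0 0 + g.1 1 1) ^ 2 = 4}
    (fun g hg => hg.1) (fun g hg => encard_fixedBy_le_two (K := K) g.1 hg)
    (fun g hg => by
      obtain ⟨y, hy⟩ := fixedBy_eq_singleton (K := K) g.1 hg.1 hg.2
      exact (congrArg Set.encard hy).trans_le (Set.encard_singleton _).le) x ∞
    (fun h => hx (horbK (h ▸ mem_orbit_self x)))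
  rw [hcardZ] at hle
  have hcard1 := ncard_orbit_mul_card_stabilizer (G := H) x
  have hcard2 := ncard_orbit_mul_card_stabilizer (G := H) (∞ : OnePoint F)
  rw [horb] at hcard2
  have hoβ : (orbit H x).ncard ≤ Nat.card (stabilizer H (∞ : OnePoint F)) := by
    refine Nat.le_of_mul_le_mul_left ?_ (Nat.succ_pos (Nat.card F))
    rw [Nat.succ_eq_add_one, hcard2, ← hcard1, mul_comm]
    gcongr
  have hz : Nat.card (Subgroup.center (SL₂ F)) = 1 ∧ p = 2 ∨
      Nat.card (Subgroup.center (SL₂ F)) = 2 ∧ p ≠ 2 := by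
    by_cases h2 : (2 : F) = 0
    · left
      refine ⟨card_center_of_two_eq_zero h2, ?_⟩
      have := (CharP.cast_eq_zero_iff F p 2).mp (by exact_mod_cast h2)
      exact (Nat.prime_dvd_prime_iff_eq Fact.out Nat.prime_two).mp this
    · right
      refine ⟨card_center_of_two_ne_zero h2, ?_⟩
      rintro rfl
      exact h2 (by exact_mod_cast CharP.cast_eq_zero F 2)
  obtain ⟨f, -, hf⟩ := (have := Fintype.ofFinite F; FiniteField.card F p)
  rw [← @Nat.card_eq_fintype_card] at hf
  have hle' : (Nat.card F + 1) * ((Nat.card (unitriangularEntries H) - 1) *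
      Nat.card (Subgroup.center (SL₂ F))) + 2 * Nat.card (Subgroup.center (SL₂ F)) ≤
      Nat.card (Subgroup.center (SL₂ F)) * ((orbit H x).ncard + (Nat.card F + 1)) :=
    (Nat.add_le_add_right hU _).trans (hle.trans (Nat.mul_le_mul_left _ (by omega)))
  have hM1 : Nat.card (unitriangularEntries H) ≠ 1 := by
    intro h
    have := (Nat.card_eq_one_iff_unique.mp h).1
    exact hb₀' (congrArg Subtype.val (Subsingleton.elim
      (⟨b₀, hb₀⟩ : unitriangularEntries H) 0))
  rcases eq_or_le_two_of_orbit_bounds Fact.out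
    (AddSubgroup.card_addSubgroup_dvd_card (unitriangularEntries H)) hf hM1 hz hq hle' hoβ hB
    with h | h
  · right
    apply Subgroup.eq_top_of_le_card
    refine card_sl_le.trans ?_
    rw [← hcard1, mul_comm]
    refine Nat.mul_le_mul ?_ hS
    rw [h] at hle'
    have hzpos : 0 < Nat.card (Subgroup.center (SL₂ F)) := Nat.card_pos
    have : Nat.card F * (Nat.card F - 1) + (Nat.card F + 1) ≤
        (orbit H x).ncard + (Nat.card F + 1) := by
      refine Nat.le_of_mul_le_mul_left ?_ hzpos
      refine le_of_eq_of_le ?_ hle'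
      obtain ⟨N, hN⟩ : ∃ N, Nat.card F = N + 1 := ⟨Nat.card F - 1, by omega⟩
      rw [hN, Nat.add_sub_cancel]
      ring
    omega
  · exact Or.inl h

end Generation

section NonsplitTraces

variable {F K : Type*} [Field F] [Field K] [Algebra F K]

/-- The traces of the matrices with an eigenvalue whose square is a primitive `n`-th root of
unity. -/
def nonsplitTraces (F K : Type*) [Field F] [Field K] [Algebra F K] (n : ℕ) : Set F :=
  {t | ∃ u : K, IsPrimitiveRoot (u ^ 2) n ∧ algebraMap F K t = u + u⁻¹}

lemma center_entry_sq {z : SL₂ F} (hz : z ∈ Subgroup.center (SL₂ F)) : z 0 0 ^ 2 = 1 := by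
  obtain ⟨h1, h2, h3⟩ := (mem_center_iff_entries z).mp hz
  have := sl_det z
  grind

lemma center_ext {z w : SL₂ F} (hz : z ∈ Subgroup.center (SL₂ F))
    (hw : w ∈ Subgroup.center (SL₂ F)) (h : z 0 0 = w 0 0) : z = w := by
  obtain ⟨h1, h2, h3⟩ := (mem_center_iff_entries z).mp hz
  obtain ⟨k1, k2, k3⟩ := (mem_center_iff_entries w).mp hw
  ext i j
  fin_cases i <;> fin_cases j <;> simp <;> grind

lemma pow_card_add_one_eq_one {n : ℕ}
    (hn : n * Nat.card (Subgroup.center (SL₂ F)) = Nat.card F + 1) {u : K}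
    (hu : (u ^ 2) ^ n = 1) : u ^ (Nat.card F + 1) = 1 := by
  by_cases h2 : (2 : F) = 0
  · rw [card_center_of_two_eq_zero h2, mul_one] at hn
    have h2K : (2 : K) = 0 := by
      rw [← map_ofNat (algebraMap F K) 2, h2, map_zero]
    rw [hn, ← pow_mul, mul_comm, pow_mul] at hu
    rw [← sub_eq_zero, ← sq_eq_zero_iff]
    linear_combination hu + (1 - u ^ (Nat.card F + 1)) * h2K
  · rw [card_center_of_two_ne_zero h2] at hn
    rw [← hn, mul_comm, pow_mul, hu]

variable [Finite F]

lemma mem_range_algebraMap_of_pow_card {t : K} (ht : t ^ Nat.card F = t) :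
    t ∈ Set.range (algebraMap F K) := by
  classical
  have := Fintype.ofFinite F
  have h1 : 1 < Nat.card F := Finite.one_lt_card
  have hne : (Polynomial.X ^ Nat.card F - Polynomial.X : Polynomial K) ≠ 0 :=
    FiniteField.X_pow_card_sub_X_ne_zero K h1
  have hsub : Finset.univ.image (algebraMap F K) ⊆
      (Polynomial.X ^ Nat.card F - Polynomial.X : Polynomial K).roots.toFinset := by
    intro a ha
    obtain ⟨b, -, rfl⟩ := Finset.mem_image.mp ha
    rw [Multiset.mem_toFinset, Polynomial.mem_roots hne]
    simp [← map_pow, FiniteField.pow_card, Nat.card_eq_fintype_card]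
  have heq := Finset.eq_of_subset_of_card_le hsub (by
    rw [Finset.card_image_of_injective _ (algebraMap F K).injective, Finset.card_univ,
      ← Nat.card_eq_fintype_card]
    refine (Multiset.toFinset_card_le _).trans ((Polynomial.card_roots' _).trans ?_)
    rw [FiniteField.X_pow_card_sub_X_natDegree_eq K h1])
  have hmem : t ∈ (Polynomial.X ^ Nat.card F - Polynomial.X : Polynomial K).roots.toFinset := by
    rw [Multiset.mem_toFinset, Polynomial.mem_roots hne]
    simp [ht, -Nat.card_eq_fintype_card]
  rw [← heq] at hmem
  obtain ⟨b, -, hb⟩ := Finset.mem_image.mp hmem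
  exact ⟨b, hb⟩

/-- An element whose square is a root of unity of large order dividing `q + 1` is irrational. -/
lemma notMem_range_of_isPrimitiveRoot {n : ℕ} (hn1 : n ≠ 1)
    (hn : n * Nat.card (Subgroup.center (SL₂ F)) = Nat.card F + 1) {u : K}
    (hu : IsPrimitiveRoot (u ^ 2) n) : u ∉ Set.range (algebraMap F K) := by
  rintro ⟨a, rfl⟩
  have := Fintype.ofFinite F
  have h1 := pow_card_add_one_eq_one hn hu.pow_eq_one
  rw [← map_pow, pow_succ, Nat.card_eq_fintype_card, FiniteField.pow_card, map_mul, ← sq] at h1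
  exact hn1 (Nat.dvd_one.mp (hu.dvd_of_pow_eq_one (l := 1) (by rw [pow_one, h1])))

lemma card_center_mul_totient_le [IsAlgClosed K] {n : ℕ} [NeZero (n : K)] (p f : ℕ)
    [Fact p.Prime] [CharP F p] (hq : Nat.card F = p ^ f)
    (hn : n * Nat.card (Subgroup.center (SL₂ F)) = Nat.card F + 1) :
    Nat.card (Subgroup.center (SL₂ F)) * n.totient ≤ 2 * (nonsplitTraces F K n).ncard := by
  classical
  have := Fintype.ofFinite (Subgroup.center (SL₂ F))
  have hcharK : CharP K p := charP_of_injective_algebraMap (algebraMap F K).injective p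
  have : NeZero n := .of_neZero_natCast K
  obtain ⟨ζ, hζ⟩ := HasEnoughRootsOfUnity.exists_primitiveRoot K n
  choose r hr using fun x : K => IsAlgClosed.exists_pow_nat_eq x two_pos
  obtain ⟨S, hS⟩ : ∃ S : Finset K, S = (Finset.univ ×ˢ primitiveRoots n K).image
      (fun w : Subgroup.center (SL₂ F) × K => algebraMap F K (w.1.1 0 0) * r w.2) := ⟨_, rfl⟩
  have hsq (z : Subgroup.center (SL₂ F)) (x : K) : (algebraMap F K (z.1 0 0) * r x) ^ 2 = x := by
    rw [mul_pow, hr, ← map_pow, center_entry_sq z.2, map_one, one_mul]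
  have hScard : S.card = Nat.card (Subgroup.center (SL₂ F)) * n.totient := by
    rw [hS, Finset.card_image_of_injOn, Finset.card_product, hζ.card_primitiveRoots,
      Finset.card_univ, Nat.card_eq_fintype_card]
    rintro ⟨z, x⟩ hx ⟨w, y⟩ hy h
    change algebraMap F K (z.1 0 0) * r x = algebraMap F K (w.1 0 0) * r y at h
    obtain rfl : x = y := by rw [← hsq z x, h, hsq]
    have hx' : IsPrimitiveRoot x n := isPrimitiveRoot_of_mem_primitiveRoots
      (Finset.mem_product.mp (Finset.mem_coe.mp hx)).2
    have hr0 : r x ≠ 0 := by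
      intro h0
      have h1 := hr x
      rw [h0, zero_pow two_ne_zero] at h1
      exact hx'.ne_zero (NeZero.ne n) h1.symm
    have := (algebraMap F K).injective (mul_right_cancel₀ hr0 h)
    rw [Subtype.ext (center_ext z.2 w.2 this)]
  have hSprim : ∀ u ∈ S, IsPrimitiveRoot (u ^ 2) n := by
    intro u hu
    rw [hS] at hu
    obtain ⟨⟨z, x⟩, hx, rfl⟩ := Finset.mem_image.mp hu
    change IsPrimitiveRoot ((algebraMap F K (z.1 0 0) * r x) ^ 2) n
    rw [hsq]
    exact isPrimitiveRoot_of_mem_primitiveRoots (Finset.mem_product.mp hx).2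
  have hS0 : ∀ u ∈ S, u ≠ 0 := by
    rintro u hu rfl
    exact (hSprim 0 hu).ne_zero (NeZero.ne n) (zero_pow two_ne_zero)
  have himg : ((S.image fun u => u + u⁻¹ : Finset K) : Set K) ⊆
      algebraMap F K '' nonsplitTraces F K n := by
    intro t ht
    obtain ⟨u, hu, rfl⟩ := Finset.mem_image.mp (Finset.mem_coe.mp ht)
    have hpow := pow_card_add_one_eq_one hn (hSprim u hu).pow_eq_one
    have hu0 := hS0 u hu
    have hinv : u ^ Nat.card F = u⁻¹ := by
      exact eq_inv_of_mul_eq_one_left (by rw [← pow_succ, hpow])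
    obtain ⟨t, ht⟩ := mem_range_algebraMap_of_pow_card (F := F) (t := u + u⁻¹) (by
      have := hinv
      rw [hq] at this ⊢
      rw [add_pow_char_pow, inv_pow, this, inv_inv, add_comm])
    exact ⟨t, ⟨u, hSprim u hu, ht⟩, ht⟩
  have hfib : ∀ t ∈ S.image (fun u => u + u⁻¹), (S.filter fun u => u + u⁻¹ = t).card ≤ 2 := by
    intro t ht
    obtain ⟨v, hv, rfl⟩ := Finset.mem_image.mp ht
    refine (Finset.card_le_card (t := {v, v⁻¹}) ?_).trans Finset.card_le_two
    intro u hu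
    obtain ⟨hu, h⟩ := Finset.mem_filter.mp hu
    have hu0 := hS0 u hu
    have hv0 := hS0 v hv
    have h' : (u - v) * (u * v - 1) = 0 := by
      field_simp at h
      linear_combination h
    rw [Finset.mem_insert, Finset.mem_singleton]
    rcases mul_eq_zero.mp h' with h' | h'
    · exact Or.inl (sub_eq_zero.mp h')
    · exact Or.inr (eq_inv_of_mul_eq_one_left (sub_eq_zero.mp h'))
  rw [← hScard]
  refine (Finset.card_le_mul_card_image _ _ hfib).trans ?_
  rw [← Set.ncard_coe_finset]
  refine Nat.mul_le_mul_left _ ((Set.ncard_le_ncard himg (Set.toFinite _)).trans ?_)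
  exact Set.ncard_image_le

end NonsplitTraces

section NonsplitElements

open MulAction OnePoint

variable {F K : Type*} [Field F] [Field K] [Algebra F K]

/-- The eigenvalue of `g` at the fixed point `x`. -/
def fixedPointMultiplier (g : SL₂ F) (x : K) : K :=
  algebraMap F K (g 1 0) * x + algebraMap F K (g 1 1)

lemma upper_row_eq (g : SL₂ F) (x : K) (h : g • (x : OnePoint K) = x) :
    algebraMap F K (g 0 0) * x + algebraMap F K (g 0 1) = fixedPointMultiplier g x * x := by
  rw [moebius_coe] at h
  simp only [fixedPointMultiplier, map_sub] at *
  linear_combination -h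

lemma fixedPointMultiplier_mul (g h : SL₂ F) (x : K) (hh : h • (x : OnePoint K) = x) :
    fixedPointMultiplier (g * h) x = fixedPointMultiplier g x * fixedPointMultiplier h x := by
  have := upper_row_eq h x hh
  simp only [fixedPointMultiplier, sl_mul_apply, map_add, map_mul] at *
  linear_combination algebraMap F K (g 1 0) * this

lemma fixedPointMultiplier_pow (g : SL₂ F) (x : K) (hg : g • (x : OnePoint K) = x) (j : ℕ) :
    fixedPointMultiplier (g ^ j) x = fixedPointMultiplier g x ^ j := by
  induction j with
  | zero => simp [fixedPointMultiplier]
  | succ j ih => rw [pow_succ, fixedPointMultiplier_mul _ _ _ hg, ih, pow_succ]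

lemma fixedPointMultiplier_center {z : SL₂ F} (hz : z ∈ Subgroup.center (SL₂ F)) (x : K) :
    fixedPointMultiplier z x = algebraMap F K (z 0 0) := by
  obtain ⟨h1, h2, h3⟩ := (mem_center_iff_entries z).mp hz
  simp [fixedPointMultiplier, h2, h3]

/-- The multiplier at a fixed point is a root of the characteristic polynomial. -/
lemma fixedPointMultiplier_sq (g : SL₂ F) (x : K) (hg : g • (x : OnePoint K) = x) :
    fixedPointMultiplier g x ^ 2 - algebraMap F K (g 0 0 + g 1 1) * fixedPointMultiplier g x + 1 =
      0 := by
  rw [moebius_coe] at hg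
  have hdet := congrArg (algebraMap F K) (sl_det g)
  simp only [fixedPointMultiplier, map_sub, map_add, map_mul, map_one] at *
  linear_combination algebraMap F K (g 1 0) * hg - hdet

/-- A matrix fixing an irrational point is determined by its multiplier. -/
lemma eq_of_fixedPointMultiplier_eq (g h : SL₂ F) (x : K) (hx : x ∉ Set.range (algebraMap F K))
    (hg : g • (x : OnePoint K) = x) (hh : h • (x : OnePoint K) = x)
    (heq : fixedPointMultiplier g x = fixedPointMultiplier h x) : g = h := by
  have key (a b c d : F) (h : algebraMap F K a * x + algebraMap F K b =
      algebraMap F K c * x + algebraMap F K d) : a = c ∧ b = d := by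
    have hac : a = c := by
      by_contra hac
      have hac' : algebraMap F K a - algebraMap F K c ≠ 0 := by
        rw [← map_sub]
        exact (map_ne_zero _).mpr (sub_ne_zero.mpr hac)
      refine hx ⟨(d - b) / (a - c), ?_⟩
      rw [map_div₀, map_sub, map_sub, div_eq_iff hac']
      linear_combination -h
    subst hac
    exact ⟨rfl, (algebraMap F K).injective (add_left_cancel h)⟩
  obtain ⟨h1, h2⟩ := key _ _ _ _ heq
  obtain ⟨h3, h4⟩ := key _ _ _ _
    ((upper_row_eq g x hg).trans (heq ▸ (upper_row_eq h x hh).symm))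
  ext i j
  fin_cases i <;> fin_cases j <;> simp [h1, h2, h3, h4]

lemma coe_mem_range_map_iff (x : K) :
    (x : OnePoint K) ∈ Set.range (OnePoint.map (algebraMap F K)) ↔
      x ∈ Set.range (algebraMap F K) := by
  constructor
  · rintro ⟨y, hy⟩
    cases y with
    | infty => exact absurd hy (OnePoint.infty_ne_coe x)
    | coe y => exact ⟨y, OnePoint.coe_injective hy⟩
  · rintro ⟨y, rfl⟩
    exact ⟨(y : OnePoint F), rfl⟩

/-- A matrix with an irrational eigenvalue has an irrational fixed point with that multiplier. -/
lemma exists_fixed_of_irrational_eigenvalue (g : SL₂ F) (u : K)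
    (hu : u ∉ Set.range (algebraMap F K)) (ht : algebraMap F K (g 0 0 + g 1 1) = u + u⁻¹) :
    ∃ x : K, x ∉ Set.range (algebraMap F K) ∧ g • (x : OnePoint K) = x ∧
      fixedPointMultiplier g x = u := by
  have hu0 : u ≠ 0 := by
    rintro rfl
    exact hu ⟨0, map_zero _⟩
  have hchar : u ^ 2 - algebraMap F K (g 0 0 + g 1 1) * u + 1 = 0 := by
    rw [ht]
    field_simp
    ring
  have hdet := congrArg (algebraMap F K) (sl_det g)
  have hc : algebraMap F K (g 1 0) ≠ 0 := by
    intro hc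
    simp only [map_sub, map_add, map_mul, map_one] at *
    have : (u - algebraMap F K (g 0 0)) * (u - algebraMap F K (g 1 1)) = 0 := by
      linear_combination hchar + hdet + algebraMap F K (g 0 1) * hc
    rcases mul_eq_zero.mp this with h | h
    · exact hu ⟨_, (sub_eq_zero.mp h).symm⟩
    · exact hu ⟨_, (sub_eq_zero.mp h).symm⟩
  have hmul : fixedPointMultiplier g ((u - algebraMap F K (g 1 1)) / algebraMap F K (g 1 0)) =
      u := by
    rw [fixedPointMultiplier]
    field_simp
    ring
  refine ⟨(u - algebraMap F K (g 1 1)) / algebraMap F K (g 1 0), ?_, ?_, hmul⟩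
  · rintro ⟨a, ha⟩
    refine hu ⟨g 1 0 * a + g 1 1, ?_⟩
    rw [map_add, map_mul, ha]
    exact hmul
  · rw [moebius_coe]
    simp only [map_sub, map_add, map_mul, map_one] at *
    field_simp
    linear_combination hchar + hdet

/-- The stabilizer of the irrational fixed point is large. -/
lemma card_add_one_le_card_stabilizer [Finite F] {n : ℕ}
    (hn : n * Nat.card (Subgroup.center (SL₂ F)) = Nat.card F + 1) (H : Subgroup (SL₂ F))
    (hZ : Subgroup.center (SL₂ F) ≤ H) (g : SL₂ F) (hgH : g ∈ H) (x : K)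
    (hg : g • (x : OnePoint K) = x) (hu : IsPrimitiveRoot (fixedPointMultiplier g x ^ 2) n) :
    Nat.card F + 1 ≤ Nat.card (stabilizer H (x : OnePoint K)) := by
  rw [← hn]
  nth_rw 1 [← Nat.card_fin n]
  rw [← Nat.card_prod]
  refine Nat.card_le_card_of_injective (fun w => ⟨⟨g ^ w.1.1 * w.2.1, ?_⟩, ?_⟩) ?_
  · exact H.mul_mem (H.pow_mem hgH _) (hZ w.2.2)
  · change (g ^ w.1.1 * w.2.1) • (x : OnePoint K) = x
    rw [mul_smul, moebius_center _ w.2.2]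
    exact (stabilizer (SL₂ F) (x : OnePoint K)).pow_mem hg _
  · rintro ⟨i, z⟩ ⟨j, w⟩ h
    have h' : g ^ i.1 * z.1 = g ^ j.1 * w.1 :=
      congrArg (fun a : stabilizer H (x : OnePoint K) => (a.1 : SL₂ F)) h
    have hm := congrArg (fun a => fixedPointMultiplier a x ^ 2) h'
    simp only [fixedPointMultiplier_mul _ _ _ (moebius_center _ z.2 _),
      fixedPointMultiplier_mul _ _ _ (moebius_center _ w.2 _), fixedPointMultiplier_pow _ _ hg,
      fixedPointMultiplier_center z.2, fixedPointMultiplier_center w.2, mul_pow, ← map_pow,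
      center_entry_sq z.2, center_entry_sq w.2, map_one, mul_one] at hm
    rw [← pow_mul, mul_comm, pow_mul, ← pow_mul _ j.1, mul_comm j.1, pow_mul] at hm
    obtain rfl : i = j := Fin.ext (hu.pow_inj i.2 j.2 hm)
    rw [Subtype.ext (mul_left_cancel h')]

/-- Few matrices with trace in `nonsplitTraces` fix a given irrational point. -/
lemma ncard_nonsplit_fixing_le {n : ℕ}
    (hn : n * Nat.card (Subgroup.center (SL₂ F)) = Nat.card F + 1) (x : K)
    (hx : x ∉ Set.range (algebraMap F K)) :
    {g : SL₂ F | g 0 0 + g 1 1 ∈ nonsplitTraces F K n ∧ g • (x : OnePoint K) = x}.ncard ≤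
      Nat.card F + 1 := by
  classical
  have hsub : (fun g => fixedPointMultiplier g x) ''
      {g : SL₂ F | g 0 0 + g 1 1 ∈ nonsplitTraces F K n ∧ g • (x : OnePoint K) = x} ⊆
      ((Polynomial.nthRoots (Nat.card F + 1) (1 : K)).toFinset : Set K) := by
    rintro _ ⟨g, ⟨⟨u, hu, ht⟩, hg⟩, rfl⟩
    rw [Finset.mem_coe, Multiset.mem_toFinset, Polynomial.mem_nthRoots (Nat.succ_pos _)]
    have hpow := pow_card_add_one_eq_one hn hu.pow_eq_one
    have hu0 : u ≠ 0 := by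
      rintro rfl
      rw [zero_pow (Nat.succ_ne_zero _)] at hpow
      exact zero_ne_one hpow
    have hsq := fixedPointMultiplier_sq g x hg
    rw [ht] at hsq
    have h' : (fixedPointMultiplier g x - u) * (fixedPointMultiplier g x - u⁻¹) = 0 := by
      field_simp at hsq ⊢
      linear_combination hsq
    change fixedPointMultiplier g x ^ (Nat.card F + 1) = 1
    rcases mul_eq_zero.mp h' with h' | h'
    · rw [sub_eq_zero.mp h', hpow]
    · rw [sub_eq_zero.mp h', inv_pow, hpow, inv_one]
  rw [← Set.InjOn.ncard_image (f := fun g => fixedPointMultiplier g x)]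
  · refine (Set.ncard_le_ncard hsub).trans ?_
    rw [Set.ncard_coe_finset]
    exact (Multiset.toFinset_card_le _).trans (Polynomial.card_nthRoots _ _)
  · exact fun g hg h hh heq => eq_of_fixedPointMultiplier_eq g h x hx hg.2 hh.2 heq

end NonsplitElements

section TraceCounts

variable {F : Type*} [Field F]

lemma sl_ext {g h : SL₂ F} (h00 : g 0 0 = h 0 0) (h01 : g 0 1 = h 0 1) (h10 : g 1 0 = h 1 0)
    (h11 : g 1 1 = h 1 1) : g = h := by
  ext i j
  fin_cases i <;> fin_cases j <;> assumption

/-- A matrix with prescribed first row and trace. -/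
def ofRowTrace (t a : F) (b : Fˣ) : SL₂ F :=
  ⟨!![a, b; (a * (t - a) - 1) / b, t - a], by
    rw [Matrix.det_fin_two_of, mul_div_cancel₀ _ b.ne_zero]
    ring⟩

variable [Finite F]

lemma card_mul_card_sub_one_le_ncard_trace_eq (t : F) :
    Nat.card F * (Nat.card F - 1) ≤ {g : SL₂ F | g 0 0 + g 1 1 = t}.ncard := by
  rw [← Nat.card_units, ← Nat.card_prod, ← Nat.card_coe_set_eq]
  refine Nat.card_le_card_of_injective
    (fun w : F × Fˣ => ⟨ofRowTrace t w.1 w.2, add_sub_cancel w.1 t⟩) ?_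
  rintro ⟨a, b⟩ ⟨c, d⟩ h
  have h' : ofRowTrace t a b = ofRowTrace t c d := congrArg Subtype.val h
  have h0 := congrArg (fun g : SL₂ F => g 0 0) h'
  have h1 := congrArg (fun g : SL₂ F => g 0 1) h'
  simp only [ofRowTrace, Matrix.SpecialLinearGroup.coe_mk, Matrix.of_apply, Matrix.cons_val_zero,
    Matrix.cons_val_one, Matrix.cons_val', Matrix.cons_val_fin_one] at h0 h1
  rw [h0, Units.ext h1]

lemma ncard_setOf_quadratic_le (t : F) : {a : F | a * (t - a) = 1}.ncard ≤ 2 := by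
  classical
  rcases Set.eq_empty_or_nonempty {a : F | a * (t - a) = 1} with h | ⟨a, ha⟩
  · simp [h]
  · refine (Set.ncard_le_ncard (t := {a, t - a}) ?_).trans
      ((Set.ncard_insert_le _ _).trans_eq (by rw [Set.ncard_singleton]))
    intro b hb
    have ha' : a * (t - a) = 1 := ha
    have hb' : b * (t - b) = 1 := hb
    have : (b - a) * (b - (t - a)) = 0 := by linear_combination ha' - hb'
    rcases mul_eq_zero.mp this with h | h
    · exact Or.inl (sub_eq_zero.mp h)
    · exact Or.inr (sub_eq_zero.mp h)

lemma ncard_trace_eq_le (t : F) :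
    {g : SL₂ F | g 0 0 + g 1 1 = t}.ncard ≤ Nat.card F ^ 2 + Nat.card F := by
  have hsub : {g : SL₂ F | g 0 0 + g 1 1 = t} ⊆
      {g : SL₂ F | g 0 0 + g 1 1 = t ∧ g 0 1 ≠ 0} ∪ {g : SL₂ F | g 0 0 + g 1 1 = t ∧ g 0 1 = 0} :=
    fun g hg => (em (g 0 1 = 0)).symm.imp (fun h => ⟨hg, h⟩) fun h => ⟨hg, h⟩
  have h1 : {g : SL₂ F | g 0 0 + g 1 1 = t ∧ g 0 1 ≠ 0}.ncard ≤
      Nat.card F * (Nat.card F - 1) := by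
    rw [← Nat.card_units, ← Nat.card_prod, ← Nat.card_coe_set_eq]
    refine Nat.card_le_card_of_injective (fun g => (g.1 0 0, Units.mk0 (g.1 0 1) g.2.2)) ?_
    rintro ⟨g, hg, hg0⟩ ⟨h, hh, hh0⟩ heq
    obtain ⟨h00, h01⟩ := Prod.mk.inj heq
    replace h01 : g 0 1 = h 0 1 := congrArg Units.val h01
    have h11 : g 1 1 = h 1 1 := by linear_combination hg - hh - h00
    have hdet : g 0 0 * g 1 1 - g 0 1 * g 1 0 = h 0 0 * h 1 1 - h 0 1 * h 1 0 :=
      (sl_det g).trans (sl_det h).symm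
    rw [h00, h01, h11] at hdet
    exact Subtype.ext (sl_ext h00 h01 (mul_left_cancel₀ hh0 (sub_right_injective hdet)) h11)
  have h2 : {g : SL₂ F | g 0 0 + g 1 1 = t ∧ g 0 1 = 0}.ncard ≤ 2 * Nat.card F := by
    refine le_trans ?_ (Nat.mul_le_mul_right (Nat.card F) (ncard_setOf_quadratic_le t))
    rw [← Nat.card_coe_set_eq, ← Nat.card_coe_set_eq, ← Nat.card_prod]
    have hq (g : SL₂ F) (hg : g 0 0 + g 1 1 = t ∧ g 0 1 = 0) : g 0 0 * (t - g 0 0) = 1 := by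
      have := sl_det g
      rw [hg.2] at this
      rw [← hg.1]
      linear_combination this
    refine Nat.card_le_card_of_injective
      (fun g => (⟨g.1 0 0, hq g.1 g.2⟩, g.1 1 0)) ?_
    rintro ⟨g, hg, hg0⟩ ⟨h, hh, hh0⟩ heq
    obtain ⟨h00, h10⟩ := Prod.mk.inj heq
    replace h00 : g 0 0 = h 0 0 := congrArg Subtype.val h00
    exact Subtype.ext (sl_ext h00 (hg0.trans hh0.symm) h10 (by linear_combination hg - hh - h00))
  have hq : 1 ≤ Nat.card F := Nat.card_pos
  calc _ ≤ _ := Set.ncard_le_ncard hsub (Set.toFinite _)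
    _ ≤ _ := Set.ncard_union_le _ _
    _ ≤ Nat.card F * (Nat.card F - 1) + 2 * Nat.card F := Nat.add_le_add h1 h2
    _ = Nat.card F ^ 2 + Nat.card F := by
      obtain ⟨m, hm⟩ := Nat.exists_eq_add_of_le hq
      rw [hm, Nat.add_sub_cancel_left]
      ring

lemma ncard_trace_mem_eq_sum (R : Finset F) :
    {g : SL₂ F | g 0 0 + g 1 1 ∈ R}.ncard = ∑ t ∈ R, {g : SL₂ F | g 0 0 + g 1 1 = t}.ncard := by
  classical
  have := Fintype.ofFinite (SL₂ F)
  simp only [Set.ncard_eq_toFinset_card', Set.toFinset_ofPred]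
  rw [Finset.card_eq_sum_card_fiberwise (t := R) (f := fun g : SL₂ F => g 0 0 + g 1 1)]
  · refine Finset.sum_congr rfl fun t ht => congrArg Finset.card ?_
    ext g
    simp only [Finset.mem_filter, Finset.mem_univ, true_and]
    exact ⟨fun h => h.2, fun h => ⟨h ▸ ht, h⟩⟩
  · intro g hg
    simpa using hg

lemma ncard_trace_mem_le (R : Finset F) : {g : SL₂ F | g 0 0 + g 1 1 ∈ R}.ncard ≤
    R.card * (Nat.card F ^ 2 + Nat.card F) := by
  rw [ncard_trace_mem_eq_sum]
  exact Finset.sum_le_card_nsmul _ _ _ fun t _ => ncard_trace_eq_le t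

lemma le_ncard_trace_mem (T : Set F) : T.ncard * (Nat.card F * (Nat.card F - 1)) ≤
    {g : SL₂ F | g 0 0 + g 1 1 ∈ T}.ncard := by
  have := ncard_trace_mem_eq_sum (Set.toFinite T).toFinset
  simp only [Set.Finite.mem_toFinset] at this
  rw [this, Set.ncard_eq_toFinset_card T]
  exact Finset.card_nsmul_le_sum _ _ _ fun t _ => card_mul_card_sub_one_le_ncard_trace_eq t

end TraceCounts

section SmallOrders

variable {F : Type*} [Field F]

lemma sl_pow_succ_apply (g : SL₂ F) (m : ℕ) (a b : F)
    (h : ∀ i j, (g ^ m) i j = a * g i j - b * (1 : SL₂ F) i j) (i j : Fin 2) :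
    (g ^ (m + 1)) i j = ((g 0 0 + g 1 1) * a - b) * g i j - a * (1 : SL₂ F) i j := by
  have := sl_det g
  rw [pow_succ, sl_mul_apply, h, h]
  fin_cases i <;> fin_cases j <;> simp <;> grind

lemma eq_zero_of_pow_mem_center (g : SL₂ F) (hg : g ∉ Subgroup.center (SL₂ F)) (m : ℕ) (a b : F)
    (h : ∀ i j, (g ^ m) i j = a * g i j - b * (1 : SL₂ F) i j)
    (hm : g ^ m ∈ Subgroup.center (SL₂ F)) : a = 0 := by
  by_contra ha
  obtain ⟨h1, h2, h3⟩ := (mem_center_iff_entries _).mp hm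
  rw [h] at h1 h2
  rw [h, h] at h3
  simp at h1 h2 h3
  exact hg ((mem_center_iff_entries g).mpr ⟨by tauto, by tauto, by tauto⟩)

/-- A noncentral element of order at most `5` modulo scalars has one of a few traces. -/
lemma trace_of_pow_mem_center (g : SL₂ F) (hg : g ∉ Subgroup.center (SL₂ F)) (m : ℕ)
    (hm : m ∈ Finset.Icc 2 5) (hgm : g ^ m ∈ Subgroup.center (SL₂ F)) (t : F)
    (ht : g 0 0 + g 1 1 = t) :
    t * ((t ^ 2 - 1) * ((t ^ 2 - 2) * (t ^ 4 - 3 * t ^ 2 + 1))) = 0 := by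
  have h1 (i j : Fin 2) : (g ^ 1) i j = 1 * g i j - 0 * (1 : SL₂ F) i j := by simp
  have h2 := sl_pow_succ_apply g 1 _ _ h1
  have h3 := sl_pow_succ_apply g 2 _ _ h2
  have h4 := sl_pow_succ_apply g 3 _ _ h3
  have h5 := sl_pow_succ_apply g 4 _ _ h4
  obtain ⟨hm2, hm5⟩ := Finset.mem_Icc.mp hm
  interval_cases m
  · have := eq_zero_of_pow_mem_center g hg _ _ _ h2 hgm
    rw [ht] at this
    linear_combination ((t ^ 2 - 1) * ((t ^ 2 - 2) * (t ^ 4 - 3 * t ^ 2 + 1))) * this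
  · have := eq_zero_of_pow_mem_center g hg _ _ _ h3 hgm
    rw [ht] at this
    linear_combination (t * ((t ^ 2 - 2) * (t ^ 4 - 3 * t ^ 2 + 1))) * this
  · have := eq_zero_of_pow_mem_center g hg _ _ _ h4 hgm
    rw [ht] at this
    linear_combination ((t ^ 2 - 1) * (t ^ 4 - 3 * t ^ 2 + 1)) * this
  · have := eq_zero_of_pow_mem_center g hg _ _ _ h5 hgm
    rw [ht] at this
    linear_combination (t * ((t ^ 2 - 1) * (t ^ 2 - 2))) * this

open Polynomial in
lemma exists_finset_traces (F : Type*) [Field F] : ∃ R : Finset F, R.card ≤ 9 ∧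
    ((2 : F) = 0 → R.card ≤ 4) ∧
    ∀ t : F, t * ((t ^ 2 - 1) * ((t ^ 2 - 2) * (t ^ 4 - 3 * t ^ 2 + 1))) = 0 → t ∈ R := by
  classical
  have key (P : F[X]) (n : ℕ) (hP : P.natDegree = n) (hn : n ≠ 0) :
      P.roots.toFinset.card ≤ n ∧ ∀ t, P.eval t = 0 → t ∈ P.roots.toFinset := by
    refine ⟨hP ▸ (Multiset.toFinset_card_le _).trans P.card_roots', fun t ht => ?_⟩
    rw [Multiset.mem_toFinset, mem_roots]
    · exact ht
    · rintro rfl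
      exact hn (hP.symm.trans natDegree_zero)
  by_cases h2 : (2 : F) = 0
  · obtain ⟨hc, hR⟩ := key (X ^ 4 - X) 4 (by compute_degree!) (by norm_num)
    refine ⟨_, hc.trans (by norm_num), fun _ => hc, fun t ht => hR t ?_⟩
    rw [eval_sub, eval_pow, eval_X]
    have : (t ^ 4 - t) ^ 3 = 0 := by
      linear_combination (t ^ 3 - 1) * ht +
        (t ^ 3 - 1) * (-t ^ 6 + 3 * t ^ 7 - 6 * t ^ 5 + 5 * t ^ 3 - t) * h2
    exact pow_eq_zero_iff (by norm_num) |>.mp this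
  · obtain ⟨hc, hR⟩ := key (X * ((X ^ 2 - 1) * ((X ^ 2 - 2) * (X ^ 4 - 3 * X ^ 2 + 1)))) 9
      (by
        have h : (X * ((X ^ 2 - 1) * ((X ^ 2 - 2) * (X ^ 4 - 3 * X ^ 2 + 1))) : F[X]) =
          X ^ 9 - 6 * X ^ 7 + 12 * X ^ 5 - 9 * X ^ 3 + 2 * X := by ring
        rw [h]
        compute_degree!) (by norm_num)
    refine ⟨_, hc, fun h => absurd h h2, fun t ht => hR t ?_⟩
    simpa using ht

end SmallOrders

section BadElements

open MulAction OnePoint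

variable {F K : Type*} [Field F] [Field K] [Algebra F K]

lemma smul_eq_of_sq_smul_eq (s : SL₂ F) (hs : s ^ 2 ∉ Subgroup.center (SL₂ F)) (x : K)
    (h : (s ^ 2) • (x : OnePoint K) = x) : s • (x : OnePoint K) = x := by
  have h2 := sl_pow_succ_apply s 1 1 0 (fun i j => by simp)
  have ht : s 0 0 + s 1 1 ≠ 0 := fun ht => hs <| (mem_center_iff_entries _).mpr
    ⟨by simp [h2, ht], by simp [h2, ht], by simp [h2, ht]⟩
  rw [moebius_coe] at h ⊢
  simp only [h2] at h
  simp at h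
  refine (mul_eq_zero.mp ?_).resolve_left ((map_ne_zero (algebraMap F K)).mpr ht)
  simp only [map_add, map_sub] at *
  linear_combination h

variable [Finite F]

/-- A proper subgroup containing an element with trace in `nonsplitTraces` is contained in the
normalizer of a nonsplit torus. -/
lemma exists_irrational_fixed_of_ne_top [IsAlgClosed K] {n : ℕ} (p : ℕ) [Fact p.Prime] [CharP F p]
    (hn : n * Nat.card (Subgroup.center (SL₂ F)) = Nat.card F + 1) (hn13 : 13 ≤ n)
    (H : Subgroup (SL₂ F)) (hZ : Subgroup.center (SL₂ F) ≤ H) (hH : H ≠ ⊤) (g : SL₂ F)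
    (hgH : g ∈ H) (hg : g 0 0 + g 1 1 ∈ nonsplitTraces F K n) (s : SL₂ F) (hsH : s ∈ H)
    (hs : s ^ 2 ∉ Subgroup.center (SL₂ F)) :
    ∃ x : K, x ∉ Set.range (algebraMap F K) ∧ g • (x : OnePoint K) = x ∧
      s • (x : OnePoint K) = x := by
  obtain ⟨u, hu, ht⟩ := hg
  have huF := notMem_range_of_isPrimitiveRoot (by lia) hn hu
  obtain ⟨x, hx, hgx, hmul⟩ := exists_fixed_of_irrational_eigenvalue g u huF ht
  refine ⟨x, hx, hgx, ?_⟩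
  have horb := (ncard_orbit_le_two_or_eq_top p H hZ (x : OnePoint K)
    (fun h => hx ((coe_mem_range_map_iff x).mp h))
    (card_add_one_le_card_stabilizer hn H hZ g hgH x hgx (hmul ▸ hu))
    (hn ▸ Nat.mul_le_mul_right _ hn13)).resolve_right hH
  by_contra hsx
  have hfin : (orbit H (x : OnePoint K)).Finite := Set.finite_range _
  have hpair : ({(x : OnePoint K), s • (x : OnePoint K)} : Set (OnePoint K)) =
      orbit H (x : OnePoint K) := by
    refine Set.eq_of_subset_of_ncard_le ?_ ?_ hfin
    · rintro y (rfl | rfl)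
      · exact mem_orbit_self _
      · exact ⟨⟨s, hsH⟩, rfl⟩
    · rwa [Set.ncard_pair (Ne.symm hsx)]
  have hmem : (s ^ 2) • (x : OnePoint K) ∈
      ({(x : OnePoint K), s • (x : OnePoint K)} : Set (OnePoint K)) :=
    hpair ▸ ⟨⟨s ^ 2, H.pow_mem hsH 2⟩, rfl⟩
  rcases hmem with h | h
  · exact hsx (smul_eq_of_sq_smul_eq s hs x h)
  · rw [Set.mem_singleton_iff, sq, mul_smul] at h
    exact hsx (smul_left_cancel s h)

lemma ncard_bad_le {n : ℕ} (hn : n * Nat.card (Subgroup.center (SL₂ F)) = Nat.card F + 1)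
    (s : SL₂ F) (hs : s ∉ Subgroup.center (SL₂ F)) :
    {g : SL₂ F | g 0 0 + g 1 1 ∈ nonsplitTraces F K n ∧ ∃ x : K, x ∉ Set.range (algebraMap F K) ∧
      g • (x : OnePoint K) = x ∧ s • (x : OnePoint K) = x}.ncard ≤ 2 * (Nat.card F + 1) := by
  classical
  have h2 := encard_fixedBy_le_two (K := K) s hs
  have hfin : (fixedBy (OnePoint K) s).Finite :=
    Set.finite_of_encard_le_coe (k := 2) h2
  have hfin' : (((↑) : K → OnePoint K) ⁻¹' fixedBy (OnePoint K) s).Finite :=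
    hfin.preimage OnePoint.coe_injective.injOn
  obtain ⟨T, hT⟩ : ∃ T : Finset K, T = hfin'.toFinset.filter (· ∉ Set.range (algebraMap F K)) :=
    ⟨_, rfl⟩
  have hTcard : T.card ≤ 2 := by
    have h1 : ((T : Set K).image ((↑) : K → OnePoint K)) ⊆ fixedBy (OnePoint K) s := by
      rintro _ ⟨x, hx, rfl⟩
      rw [hT, Finset.mem_coe, Finset.mem_filter, Set.Finite.mem_toFinset] at hx
      exact hx.1
    have := (Set.encard_le_encard h1).trans h2
    rw [OnePoint.coe_injective.encard_image, Set.encard_coe_eq_coe_finsetCard] at this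
    exact_mod_cast this
  have hsub : {g : SL₂ F | g 0 0 + g 1 1 ∈ nonsplitTraces F K n ∧ ∃ x : K,
      x ∉ Set.range (algebraMap F K) ∧ g • (x : OnePoint K) = x ∧ s • (x : OnePoint K) = x} ⊆
      ⋃ x ∈ T, {g : SL₂ F | g 0 0 + g 1 1 ∈ nonsplitTraces F K n ∧ g • (x : OnePoint K) = x} := by
    rintro g ⟨hg, x, hx, hgx, hsx⟩
    simp only [Set.mem_iUnion]
    exact ⟨x, by rw [hT, Finset.mem_filter, Set.Finite.mem_toFinset]; exact ⟨hsx, hx⟩, hg, hgx⟩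
  refine (Set.ncard_le_ncard hsub (Set.toFinite _)).trans ?_
  refine (Finset.set_ncard_biUnion_le _ _).trans ?_
  refine (Finset.sum_le_card_nsmul _ _ (Nat.card F + 1) fun x hx => ?_).trans
    (Nat.mul_le_mul_right _ hTcard)
  rw [hT, Finset.mem_filter] at hx
  exact ncard_nonsplit_fixing_le hn x hx.2

end BadElements

section GeneratingGraph

open OnePoint

lemma card_mul_ncard_eq_ncard_preimage_mk {G : Type*} [Group G] (N : Subgroup G) (S : Set (G ⧸ N)) :
    Nat.card N * S.ncard = ((QuotientGroup.mk : G → G ⧸ N) ⁻¹' S).ncard := by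
  rw [← Nat.card_coe_set_eq, ← Nat.card_coe_set_eq, ← Nat.card_prod]
  exact Nat.card_congr (QuotientGroup.preimageMkEquivSubgroupProdSet N S).symm

variable {F : Type*} [Field F] [Finite F]

lemma le_card_center_mul_ncard_generating {K : Type*} [Field K] [Algebra F K] [IsAlgClosed K]
    {n : ℕ} (p : ℕ) [Fact p.Prime] [CharP F p]
    (hn : n * Nat.card (Subgroup.center (SL₂ F)) = Nat.card F + 1) (hn13 : 13 ≤ n)
    (s : SL₂ F) (hs : s ^ 2 ∉ Subgroup.center (SL₂ F)) :
    (nonsplitTraces F K n).ncard * (Nat.card F * (Nat.card F - 1)) ≤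
      Nat.card (Subgroup.center (SL₂ F)) *
        {g : SL₂ F ⧸ Subgroup.center (SL₂ F) | Subgroup.closure {(s : SL₂ F ⧸ _), g} = ⊤}.ncard +
      2 * (Nat.card F + 1) := by
  have hs1 : s ∉ Subgroup.center (SL₂ F) := fun h => hs (Subgroup.pow_mem _ h 2)
  rw [card_mul_ncard_eq_ncard_preimage_mk]
  refine (le_ncard_trace_mem (nonsplitTraces F K n)).trans ?_
  refine le_trans ?_ (Nat.add_le_add_left (ncard_bad_le (K := K) hn s hs1) _)
  refine le_trans (Set.ncard_le_ncard (fun g hg => ?_) (Set.toFinite _)) (Set.ncard_union_le _ _)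
  let π := QuotientGroup.mk' (Subgroup.center (SL₂ F))
  by_cases hH : (Subgroup.closure {π s, π g}).comap π = ⊤
  · refine Or.inl (top_unique ?_)
    rintro x -
    obtain ⟨y, rfl⟩ := QuotientGroup.mk'_surjective _ x
    have : y ∈ (Subgroup.closure {π s, π g}).comap π := hH ▸ Subgroup.mem_top y
    exact this
  · refine Or.inr ⟨hg, exists_irrational_fixed_of_ne_top p hn hn13
      ((Subgroup.closure {π s, π g}).comap π) (fun z hz => ?_) hH g
      (Subgroup.subset_closure (Or.inr rfl)) hg s (Subgroup.subset_closure (Or.inl rfl)) hs⟩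
    rw [Subgroup.mem_comap, show π z = 1 from (QuotientGroup.eq_one_iff z).mpr hz]
    exact Subgroup.one_mem _

lemma card_center_mul_sum_ncard_orderOf_le (R : Finset F)
    (hR : ∀ t : F, t * ((t ^ 2 - 1) * ((t ^ 2 - 2) * (t ^ 4 - 3 * t ^ 2 + 1))) = 0 → t ∈ R) :
    Nat.card (Subgroup.center (SL₂ F)) * ∑ m ∈ Finset.Icc 2 5,
      {t : SL₂ F ⧸ Subgroup.center (SL₂ F) | orderOf t = m}.ncard ≤
      R.card * (Nat.card F ^ 2 + Nat.card F) := by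
  classical
  have hsum : ∑ m ∈ Finset.Icc 2 5,
      {t : SL₂ F ⧸ Subgroup.center (SL₂ F) | orderOf t = m}.ncard =
      {t : SL₂ F ⧸ Subgroup.center (SL₂ F) | orderOf t ∈ Finset.Icc 2 5}.ncard := by
    have := Fintype.ofFinite (SL₂ F ⧸ Subgroup.center (SL₂ F))
    simp only [Set.ncard_eq_toFinset_card', Set.toFinset_ofPred]
    rw [Finset.card_eq_sum_card_fiberwise (t := Finset.Icc 2 5) (f := orderOf)]
    · refine Finset.sum_congr rfl fun m hm => congrArg Finset.card ?_
      ext t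
      simp only [Finset.mem_filter, Finset.mem_univ, true_and]
      exact ⟨fun h => ⟨h ▸ hm, h⟩, fun h => h.2⟩
    · intro t ht
      exact (Finset.mem_filter.mp ht).2
  rw [hsum, card_mul_ncard_eq_ncard_preimage_mk]
  refine (Set.ncard_le_ncard (fun g hg => ?_) (Set.toFinite _)).trans (ncard_trace_mem_le R)
  have hord : orderOf (g : SL₂ F ⧸ Subgroup.center (SL₂ F)) ∈ Finset.Icc 2 5 := hg
  refine hR _ (trace_of_pow_mem_center g (fun hgc => ?_) _ hord ?_ _ rfl)
  · rw [(QuotientGroup.eq_one_iff g).mpr hgc, orderOf_one] at hord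
    simp at hord
  · rw [← QuotientGroup.eq_one_iff, QuotientGroup.mk_pow, pow_orderOf_eq_one]

theorem sum_ncard_orderOf_lt_ncard_generating {n : ℕ} (p f : ℕ) [Fact p.Prime] [CharP F p]
    (hq : Nat.card F = p ^ f) (hf : f ≠ 0)
    (hn : n * Nat.card (Subgroup.center (SL₂ F)) = Nat.card F + 1) (hphi : 12 ≤ n.totient)
    (s : SL₂ F) (hs : s ^ 2 ∉ Subgroup.center (SL₂ F)) :
    ∑ m ∈ Finset.Icc 2 5, {t : SL₂ F ⧸ Subgroup.center (SL₂ F) | orderOf t = m}.ncard <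
      {g : SL₂ F ⧸ Subgroup.center (SL₂ F) | Subgroup.closure {(s : SL₂ F ⧸ _), g} = ⊤}.ncard := by
  have hp := Fact.out (p := p.Prime)
  have hn13 : 13 ≤ n := by
    have := Nat.totient_lt n (by
      by_contra! h
      have := Nat.totient_le n
      lia)
    lia
  have hK : CharP (AlgebraicClosure F) p :=
    charP_of_injective_algebraMap (algebraMap F (AlgebraicClosure F)).injective p
  have hnK : NeZero (n : AlgebraicClosure F) := by
    refine ⟨fun h => ?_⟩
    have hdvd : p ∣ Nat.card F + 1 := hn ▸ ((CharP.cast_eq_zero_iff _ p n).mp h).mul_right _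
    rw [hq, ← Nat.dvd_add_iff_right (dvd_pow_self p hf)] at hdvd
    exact hp.one_lt.ne' (Nat.dvd_one.mp hdvd)
  obtain ⟨R, hR9, hR4, hR⟩ := exists_finset_traces F
  have h1 := le_card_center_mul_ncard_generating (K := AlgebraicClosure F) p hn hn13 s hs
  have h2 := card_center_mul_sum_ncard_orderOf_le R hR
  have h3 := card_center_mul_totient_le (F := F) (K := AlgebraicClosure F) p f hq hn
  by_contra! hle
  have h4 := Nat.mul_le_mul_left (Nat.card (Subgroup.center (SL₂ F))) hle
  obtain ⟨m, hm⟩ : ∃ m, Nat.card F = m + 12 := Nat.exists_eq_add_of_le' (by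
    have : 0 < Nat.card (Subgroup.center (SL₂ F)) := Nat.card_pos
    nlinarith)
  have h5 : (nonsplitTraces F (AlgebraicClosure F) n).ncard * (Nat.card F * (Nat.card F - 1)) ≤
      R.card * (Nat.card F ^ 2 + Nat.card F) + 2 * (Nat.card F + 1) :=
    h1.trans (Nat.add_le_add_right (h4.trans h2) _)
  rw [hm, show m + 12 - 1 = m + 11 from rfl] at h5
  by_cases h : (2 : F) = 0
  · rw [card_center_of_two_eq_zero h] at h3
    have hT : 6 ≤ (nonsplitTraces F (AlgebraicClosure F) n).ncard := by lia
    have h6 := (Nat.mul_le_mul_right ((m + 12) * (m + 11)) hT).trans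
      (h5.trans (Nat.add_le_add_right (Nat.mul_le_mul_right _ (hR4 h)) _))
    nlinarith
  · rw [card_center_of_two_ne_zero h] at h3
    have hT : 12 ≤ (nonsplitTraces F (AlgebraicClosure F) n).ncard := by lia
    have h6 := (Nat.mul_le_mul_right ((m + 12) * (m + 11)) hT).trans
      (h5.trans (Nat.add_le_add_right (Nat.mul_le_mul_right _ hR9) _))
    nlinarith

end GeneratingGraph

/-- for a prime power `q` with `φ((q+1)/gcd(q−1,2)) ≥ 12`, every
element `s` of `G = PSL(2,q)` of order `3`, `4` or `5` has generating-graph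
vertex degree greater than the total number of elements of `G` of order
between `2` and `5`. -/
theorem stmt_19 (p f : ℕ) [Fact p.Prime] (hf : f ≠ 0)
    (q : ℕ) (hq : q = p ^ f)
    (hphi : 12 ≤ Nat.totient ((q + 1) / Nat.gcd (q - 1) 2))
    (s : ProjectiveSpecialLinearGroup (Fin 2) (GaloisField p f))
    (hs : orderOf s = 3 ∨ orderOf s = 4 ∨ orderOf s = 5) :
    {g : ProjectiveSpecialLinearGroup (Fin 2) (GaloisField p f) |
        Subgroup.closure {s, g} = ⊤}.ncard >
      ∑ m ∈ Finset.Icc 2 5,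
        {t : ProjectiveSpecialLinearGroup (Fin 2) (GaloisField p f) |
          orderOf t = m}.ncard := by
  have hp := Fact.out (p := p.Prime)
  have hcard : Nat.card (GaloisField p f) = q := (GaloisField.card p f hf).trans hq.symm
  have hq0 : q ≠ 0 := hq ▸ pow_ne_zero _ hp.ne_zero
  have htwo : (2 : GaloisField p f) = 0 ↔ p = 2 := by
    rw [← Nat.cast_ofNat, CharP.cast_eq_zero_iff (GaloisField p f) p, Nat.prime_dvd_prime_iff_eq hp
      Nat.prime_two]
  have hk : Nat.gcd (q - 1) 2 =
      Nat.card (Subgroup.center (SpecialLinearGroup (Fin 2) (GaloisField p f))) := by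
    by_cases h : p = 2
    · rw [card_center_of_two_eq_zero (htwo.mpr h)]
      have : Even q := by rw [hq, h]; exact (even_two).pow_of_ne_zero hf
      rw [← Nat.Coprime, Nat.coprime_two_right]
      exact Nat.Even.sub_odd (by lia) this odd_one
    · rw [card_center_of_two_ne_zero (fun h2 => h (htwo.mp h2))]
      have : Odd q := by rw [hq]; exact (hp.odd_of_ne_two h).pow
      exact Nat.gcd_eq_right (Nat.Odd.sub_odd this odd_one).two_dvd
  have hn : (q + 1) / Nat.gcd (q - 1) 2 *
      Nat.card (Subgroup.center (SpecialLinearGroup (Fin 2) (GaloisField p f))) =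
      Nat.card (GaloisField p f) + 1 := by
    rw [hcard, ← hk]
    refine Nat.div_mul_cancel ?_
    have h1 := Nat.gcd_dvd_left (q - 1) 2
    have h2 := Nat.gcd_dvd_right (q - 1) 2
    have := Nat.dvd_add h1 h2
    rwa [show q - 1 + 2 = q + 1 by lia] at this
  obtain ⟨s, rfl⟩ := QuotientGroup.mk'_surjective _ s
  refine sum_ncard_orderOf_lt_ncard_generating p f (hcard.trans hq) hf hn hphi s fun h => ?_
  have := orderOf_dvd_of_pow_eq_one (((QuotientGroup.mk_pow _ s 2).symm.trans
    ((QuotientGroup.eq_one_iff _).mpr h)))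
  have := Nat.le_of_dvd two_pos this
  have hs' : orderOf (s : SpecialLinearGroup (Fin 2) (GaloisField p f) ⧸ Subgroup.center _) = 3 ∨
    orderOf (s : SpecialLinearGroup (Fin 2) (GaloisField p f) ⧸ Subgroup.center _) = 4 ∨
    orderOf (s : SpecialLinearGroup (Fin 2) (GaloisField p f) ⧸ Subgroup.center _) = 5 := hs
  lia
end
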